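/- Assume (cond1), (cond2), |U| = 1 and α ∈ (0,1). Let v⁰ ∈ C^{2,α}(ℝ^d) and let (v^n)_{n≥1} be the policy iteration sequence: π^n(x,u) := Γ(x, Dv^{n−1}(x), D²v^{n−1}(x))(u) and v^n is a bounded C^{2,α} classical solution of ρ v^n(x) − r^n(x) − b^n(x)·Dv^n(x) − (1/2)tr(Σ^n(x) D²v^n(x)) + λ H^n(x) = 0 on ℝ^d, where r^n(x) = ∫_U r(x,u)π^n(x,u)du, b^n(x) = ∫_U b(x,u)π^n(x,u)du, Σ^n(x) = ∫_U Σ(x,u)π^n(x,u)du, H^n(x) = ∫_U ln(π^n(x,u))π^n(x,u)du. Then there exists A₁ ≥ 1, depending only on ‖v⁰‖_{2,α}, C₀, λ (and d, α), such that whenever ρ ≥ A₁^{2/(1−α)}, ε₀ A₁ ρ^{α/2} ≤ 1 and ε₁ A₁ ≤ 1, one has ‖v^n‖₂ ≤ A₁ and ρ^{−α/2}[v^n]_{2,α} ≤ A₁ for all n ≥ 1. -/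

import Mathlib

open MeasureTheory Real Metric
noncomputable section

/-- First-order partial derivative `∂v/∂xᵢ`. -/
def pd1 (d : ℕ) (v : EuclideanSpace ℝ (Fin d) → ℝ) (x : EuclideanSpace ℝ (Fin d))
    (i : Fin d) : ℝ :=
  fderiv ℝ v x (EuclideanSpace.single i 1)

/-- Second-order partial derivative `∂²v/∂xᵢ∂xⱼ`. -/
def pd2 (d : ℕ) (v : EuclideanSpace ℝ (Fin d) → ℝ) (x : EuclideanSpace ℝ (Fin d))
    (i j : Fin d) : ℝ :=
  fderiv ℝ (fun y => fderiv ℝ v y (EuclideanSpace.single j 1)) x (EuclideanSpace.single i 1)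

/-- The exponent `(1/λ)(r(x,u) + b(x,u)·p + (1/2) tr(Σ(x,u) X))` of the Gibbs density. -/
def gibbsExponent (d l : ℕ) (lam : ℝ)
    (r : EuclideanSpace ℝ (Fin d) → EuclideanSpace ℝ (Fin l) → ℝ)
    (b : EuclideanSpace ℝ (Fin d) → EuclideanSpace ℝ (Fin l) → Fin d → ℝ)
    (S : EuclideanSpace ℝ (Fin d) → EuclideanSpace ℝ (Fin l) → Matrix (Fin d) (Fin d) ℝ)
    (x : EuclideanSpace ℝ (Fin d)) (p : Fin d → ℝ) (X : Matrix (Fin d) (Fin d) ℝ)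
    (u : EuclideanSpace ℝ (Fin l)) : ℝ :=
  (1 / lam) * (r x u + ∑ i, b x u i * p i + (1 / 2) * ∑ i, ∑ j, S x u i j * X j i)

/-- The Gibbs density `Γ(x,p,X)(u)`. -/
def gibbsDensity (d l : ℕ) (lam : ℝ) (U : Set (EuclideanSpace ℝ (Fin l)))
    (r : EuclideanSpace ℝ (Fin d) → EuclideanSpace ℝ (Fin l) → ℝ)
    (b : EuclideanSpace ℝ (Fin d) → EuclideanSpace ℝ (Fin l) → Fin d → ℝ)
    (S : EuclideanSpace ℝ (Fin d) → EuclideanSpace ℝ (Fin l) → Matrix (Fin d) (Fin d) ℝ)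
    (x : EuclideanSpace ℝ (Fin d)) (p : Fin d → ℝ) (X : Matrix (Fin d) (Fin d) ℝ)
    (u : EuclideanSpace ℝ (Fin l)) : ℝ :=
  Real.exp (gibbsExponent d l lam r b S x p X u) /
    ∫ u' in U, Real.exp (gibbsExponent d l lam r b S x p X u')

/-- The Hessian matrix of `v` at `x`. -/
def hessian (d : ℕ) (v : EuclideanSpace ℝ (Fin d) → ℝ) (x : EuclideanSpace ℝ (Fin d)) :
    Matrix (Fin d) (Fin d) ℝ :=
  Matrix.of fun i j => pd2 d v x i j

/-- The policy `π(x,·) = Γ(x, Dv(x), D²v(x))` obtained from a value function `v`. -/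
def gibbsPolicy (d l : ℕ) (lam : ℝ) (U : Set (EuclideanSpace ℝ (Fin l)))
    (r : EuclideanSpace ℝ (Fin d) → EuclideanSpace ℝ (Fin l) → ℝ)
    (b : EuclideanSpace ℝ (Fin d) → EuclideanSpace ℝ (Fin l) → Fin d → ℝ)
    (S : EuclideanSpace ℝ (Fin d) → EuclideanSpace ℝ (Fin l) → Matrix (Fin d) (Fin d) ℝ)
    (v : EuclideanSpace ℝ (Fin d) → ℝ)
    (x : EuclideanSpace ℝ (Fin d)) (u : EuclideanSpace ℝ (Fin l)) : ℝ :=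
  gibbsDensity d l lam U r b S x (fun i => pd1 d v x i) (hessian d v x) u

abbrev Euc (d : ℕ) := EuclideanSpace ℝ (Fin d)

/-- The `i`-th vector of the standard basis. -/
def stdVec {d : ℕ} (i : Fin d) : Euc d := EuclideanSpace.single i 1

lemma norm_stdVec {d : ℕ} (i : Fin d) : ‖stdVec i‖ = 1 := by simp [stdVec]

lemma abs_coord_le_norm {d : ℕ} (x : Euc d) (i : Fin d) : |x i| ≤ ‖x‖ := by
  simpa using PiLp.norm_apply_le x i

lemma sum_coord_smul_stdVec {d : ℕ} (x : Euc d) : ∑ i, x i • stdVec i = x := by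
  simpa [stdVec] using (EuclideanSpace.basisFun (Fin d) ℝ).sum_repr x

lemma clm_apply_eq_sum {d : ℕ} {F : Type*} [NormedAddCommGroup F] [NormedSpace ℝ F]
    (L : Euc d →L[ℝ] F) (x : Euc d) : L x = ∑ i, x i • L (stdVec i) := by
  conv_lhs => rw [← sum_coord_smul_stdVec x]
  simp

lemma clm_norm_le_of_stdVec {d : ℕ} {F : Type*} [NormedAddCommGroup F] [NormedSpace ℝ F]
    (L : Euc d →L[ℝ] F) {N : ℝ} (hN : 0 ≤ N)
    (h : ∀ i, ‖L (stdVec i)‖ ≤ N) : ‖L‖ ≤ d * N := by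
  refine L.opNorm_le_bound (by positivity) fun x => ?_
  rw [clm_apply_eq_sum]
  calc ‖∑ i, x i • L (stdVec i)‖ ≤ ∑ i : Fin d, ‖x‖ * N := by
        refine norm_sum_le_of_le _ fun i _ => ?_
        rw [norm_smul]
        exact mul_le_mul (abs_coord_le_norm x i) (h i) (norm_nonneg _) (norm_nonneg _)
    _ = d * N * ‖x‖ := by simp; ring

/-- A `C¹` function whose partial derivatives are bounded by `N` on a convex set is Lipschitz
there. -/
lemma abs_sub_le_of_partial_le {d : ℕ} {w : Euc d → ℝ} (hw : Differentiable ℝ w) {N : ℝ}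
    (hN : 0 ≤ N) {s : Set (Euc d)} (hs : Convex ℝ s)
    (h : ∀ z ∈ s, ∀ i, |fderiv ℝ w z (stdVec i)| ≤ N) {x y : Euc d} (hx : x ∈ s) (hy : y ∈ s) :
    |w y - w x| ≤ d * N * ‖y - x‖ :=
  hs.norm_image_sub_le_of_norm_fderiv_le (fun z _ => hw z)
    (fun z hz => clm_norm_le_of_stdVec _ hN (h z hz)) hx hy

lemma integrable_mul_of_hasCompactSupport {d : ℕ} {k w : Euc d → ℝ} (hk : Continuous k)
    (hkc : HasCompactSupport k) (hw : Continuous w) : Integrable fun z => k z * w z :=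
  (hk.mul hw).integrable_of_hasCompactSupport hkc.mul_right

lemma integral_mul_partial {d : ℕ} {η w : Euc d → ℝ} (hη : ContDiff ℝ 1 η)
    (hηc : HasCompactSupport η) (hw : ContDiff ℝ 1 w) (a : Euc d) :
    ∫ z, η z * fderiv ℝ w z a = -∫ z, fderiv ℝ η z a * w z := by
  have h1 : Continuous fun z => fderiv ℝ η z a := (hη.continuous_fderiv (by simp)).clm_apply
    continuous_const
  have h2 : Continuous fun z => fderiv ℝ w z a := (hw.continuous_fderiv (by simp)).clm_apply
    continuous_const
  refine integral_mul_fderiv_eq_neg_fderiv_mul_of_integrable ?_ ?_ ?_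
    (fun x _ => hη.differentiable (by simp) x) (fun x _ => hw.differentiable (by simp) x)
  · exact integrable_mul_of_hasCompactSupport h1 (hηc.fderiv_apply ℝ a) hw.continuous
  · exact integrable_mul_of_hasCompactSupport hη.continuous hηc h2
  · exact integrable_mul_of_hasCompactSupport hη.continuous hηc hw.continuous

lemma fderiv_fderiv_apply {d : ℕ} {η : Euc d → ℝ} (hη : ContDiff ℝ 2 η) (a c z : Euc d) :
    fderiv ℝ (fun y => fderiv ℝ η y a) z c = fderiv ℝ (fderiv ℝ η) z c a := by
  have h1 : Differentiable ℝ (fderiv ℝ η) :=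
    (hη.fderiv_right (m := 1) (by norm_num)).differentiable (by simp)
  rw [fderiv_clm_apply (h1 z) (differentiableAt_const a)]
  simp

lemma fderiv_fderiv_comm {d : ℕ} {η : Euc d → ℝ} (hη : ContDiff ℝ 2 η) (a c z : Euc d) :
    fderiv ℝ (fun y => fderiv ℝ η y a) z c = fderiv ℝ (fun y => fderiv ℝ η y c) z a := by
  rw [fderiv_fderiv_apply hη, fderiv_fderiv_apply hη]
  exact (hη.contDiffAt.isSymmSndFDerivAt (by simp)) c a

/-- Exchanging the two directions of differentiation in the pairing of two gradients. -/
lemma integral_partial_mul_partial_comm {d : ℕ} {η w : Euc d → ℝ} (hη : ContDiff ℝ 2 η)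
    (hηc : HasCompactSupport η) (hw : ContDiff ℝ 1 w) (a c : Euc d) :
    ∫ z, fderiv ℝ η z a * fderiv ℝ w z c = ∫ z, fderiv ℝ η z c * fderiv ℝ w z a := by
  have h : ∀ e : Euc d, ContDiff ℝ 1 fun y => fderiv ℝ η y e := fun e =>
    (hη.fderiv_right (m := 1) (by norm_num)).clm_apply contDiff_const
  rw [integral_mul_partial (h a) (hηc.fderiv_apply ℝ a) hw c,
    integral_mul_partial (h c) (hηc.fderiv_apply ℝ c) hw a]
  simp_rw [fderiv_fderiv_comm hη a c]

lemma integral_partial_eq_zero {d : ℕ} {η : Euc d → ℝ} (hη : ContDiff ℝ 1 η)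
    (hηc : HasCompactSupport η) (a : Euc d) : ∫ z, fderiv ℝ η z a = 0 := by
  have := integral_mul_partial hη hηc (contDiff_const (c := (1 : ℝ))) a
  simpa using this

lemma fderiv_comp_add_smul {d : ℕ} {w : Euc d → ℝ} (hw : Differentiable ℝ w) (x : Euc d) (τ : ℝ)
    (z a : Euc d) : fderiv ℝ (fun z => w (x + τ • z)) z a = τ * fderiv ℝ w (x + τ • z) a := by
  have h1 : HasFDerivAt (fun z : Euc d => x + τ • z) (τ • ContinuousLinearMap.id ℝ (Euc d)) z :=
    ((hasFDerivAt_id z).const_smul τ).const_add x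
  have := ((hw (x + τ • z)).hasFDerivAt.comp z h1).fderiv
  simp only [Function.comp_def] at this
  rw [this]
  simp

lemma continuous_integral_scaled {d : ℕ} {k w : Euc d → ℝ} (hk : Continuous k)
    (hkc : HasCompactSupport k) (hw : Continuous w) (x : Euc d) :
    Continuous fun τ : ℝ => ∫ z, k z * w (x + τ • z) := by
  have h := continuous_parametric_integral_of_continuous (μ := (volume : Measure (Euc d)))
    (f := fun (τ : ℝ) (z : Euc d) => k z * w (x + τ • z)) (s := tsupport k)
    (by simp only [Function.uncurry_def]; fun_prop) hkc
  convert h using 2 with τ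
  rw [setIntegral_eq_integral_of_forall_compl_eq_zero]
  intro z hz
  simp [image_eq_zero_of_notMem_tsupport hz]

lemma hasDerivAt_integral_scaled {d : ℕ} {k w : Euc d → ℝ} (hk : Continuous k)
    (hkc : HasCompactSupport k) (hw : ContDiff ℝ 1 w) (x : Euc d) (τ : ℝ) :
    HasDerivAt (fun τ : ℝ => ∫ z, k z * w (x + τ • z))
      (∫ z, k z * fderiv ℝ w (x + τ • z) z) τ := by
  have hF' : Continuous fun q : ℝ × Euc d => k q.2 * fderiv ℝ w (x + q.1 • q.2) q.2 := by
    have : Continuous (fderiv ℝ w) := hw.continuous_fderiv (by simp)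
    fun_prop
  obtain ⟨M, hM⟩ := ((isCompact_closedBall τ 1).prod hkc).bddAbove_image hF'.norm.continuousOn
  have hM' : ∀ t ∈ closedBall τ 1, ∀ z ∈ tsupport k,
      ‖k z * fderiv ℝ w (x + t • z) z‖ ≤ M := fun t ht z hz =>
    hM ⟨(t, z), ⟨ht, hz⟩, rfl⟩
  have hwc := hw.continuous
  refine (hasDerivAt_integral_of_dominated_loc_of_deriv_le (s := closedBall τ 1)
    (F := fun (τ : ℝ) (z : Euc d) => k z * w (x + τ • z))
    (F' := fun (τ : ℝ) (z : Euc d) => k z * fderiv ℝ w (x + τ • z) z) (μ := volume)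
    (bound := (tsupport k).indicator fun _ => M)
    (closedBall_mem_nhds τ one_pos) ?_ ?_ ?_ ?_ ?_ ?_).2
  · refine Filter.Eventually.of_forall fun t => ?_
    have : Continuous fun z => k z * w (x + t • z) := by fun_prop
    exact this.aestronglyMeasurable
  · exact integrable_mul_of_hasCompactSupport hk hkc (by fun_prop)
  · exact (hF'.comp (Continuous.prodMk_right τ)).aestronglyMeasurable
  · refine Filter.Eventually.of_forall fun z t ht => ?_
    by_cases hz : z ∈ tsupport k
    · simpa [hz] using hM' t ht z hz
    · simp [hz, image_eq_zero_of_notMem_tsupport hz]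
  · rw [integrable_indicator_iff (isClosed_tsupport k).measurableSet]
    exact integrableOn_const (hkc.measure_lt_top.ne)
  · refine Filter.Eventually.of_forall fun z t _ => ?_
    have h1 : HasDerivAt (fun t : ℝ => x + t • z) z t := by
      simpa using ((hasDerivAt_id t).smul_const z).const_add x
    exact ((hw.differentiable (by simp) (x + t • z)).hasFDerivAt.comp_hasDerivAt t h1).const_mul _

/-- A function whose derivative is controlled by a power `τ ^ (β - 1)`. -/
lemma abs_sub_le_of_deriv_le_rpow {J J' : ℝ → ℝ} {C β s t : ℝ} (hβ : β ≠ 0) (hs : 0 < s)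
    (hst : s ≤ t) (hJ : ∀ τ, 0 < τ → HasDerivAt J (J' τ) τ)
    (hJ' : ∀ τ, s ≤ τ → τ ≤ t → |J' τ| ≤ C * τ ^ (β - 1)) :
    |J t - J s| ≤ C / β * (t ^ β - s ^ β) := by
  have hB : ∀ τ, 0 < τ → HasDerivAt (fun τ : ℝ => C / β * (τ ^ β - s ^ β)) (C * τ ^ (β - 1)) τ := by
    intro τ hτ
    have := ((Real.hasDerivAt_rpow_const (x := τ) (p := β) (Or.inl hτ.ne')).sub_const
      (s ^ β)).const_mul (C / β)
    rwa [← mul_assoc, div_mul_cancel₀ _ hβ] at this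
  refine image_norm_le_of_norm_deriv_right_le_deriv_boundary' (f := fun τ => J τ - J s) (f' := J')
    (a := s) (b := t) (B := fun τ => C / β * (τ ^ β - s ^ β)) (B' := fun τ => C * τ ^ (β - 1))
    ?_ ?_ ?_ ?_ ?_ ?_ (Set.right_mem_Icc.2 hst)
  · exact fun τ hτ => ((hJ τ (hs.trans_le hτ.1)).sub_const _).continuousAt.continuousWithinAt
  · exact fun τ hτ => ((hJ τ (hs.trans_le hτ.1)).sub_const _).hasDerivWithinAt
  · simp
  · exact fun τ hτ => (hB τ (hs.trans_le hτ.1)).continuousAt.continuousWithinAt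
  · exact fun τ hτ => (hB τ (hs.trans_le hτ.1)).hasDerivWithinAt
  · exact fun τ hτ => hJ' τ hτ.1 hτ.2.le

/-- A smooth cutoff on `ℝ`: it is `1` on `(-∞, 1]` and `0` on `[2, ∞)`. -/
def cutoff (s : ℝ) : ℝ := Real.smoothTransition (2 - s)

lemma contDiff_cutoff {n : ℕ∞} : ContDiff ℝ n cutoff :=
  Real.smoothTransition.contDiff.comp (contDiff_const.sub contDiff_id)

lemma cutoff_nonneg (s : ℝ) : 0 ≤ cutoff s := Real.smoothTransition.nonneg _

lemma cutoff_eq_one {s : ℝ} (h : s ≤ 1) : cutoff s = 1 :=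
  Real.smoothTransition.one_of_one_le (by linarith)

lemma cutoff_eq_zero {s : ℝ} (h : 2 ≤ s) : cutoff s = 0 :=
  Real.smoothTransition.zero_of_nonpos (by linarith)

lemma deriv_cutoff_eq_zero {s : ℝ} (h : 2 ≤ s) : deriv cutoff s = 0 := by
  have : IsLocalMin cutoff s := Filter.Eventually.of_forall fun t => by
    rw [cutoff_eq_zero h]; exact cutoff_nonneg t
  exact this.deriv_eq_zero

lemma contDiff_deriv_cutoff {n : ℕ} : ContDiff ℝ n (deriv cutoff) :=
  (contDiff_cutoff (n := ((n + 1 : ℕ) : ℕ∞))).deriv'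

/-- The `i`-th coordinate of `P z`. -/
def qLin {d : ℕ} (P : Fin d → Fin d → ℝ) (z : Euc d) (i : Fin d) : ℝ := ∑ j, P i j * z j

/-- The quadratic form `⟨z, P z⟩ / 2`. -/
def qForm {d : ℕ} (P : Fin d → Fin d → ℝ) (z : Euc d) : ℝ := (1 / 2) * ∑ i, z i * qLin P z i

/-- The compactly supported bump adapted to the quadratic form of `P`. -/
def bump {d : ℕ} (P : Fin d → Fin d → ℝ) (z : Euc d) : ℝ := cutoff (qForm P z)

/-- The components of `-bump P z • P z`, the gradient of a radial potential of `P`. -/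
def flux {d : ℕ} (P : Fin d → Fin d → ℝ) (i : Fin d) (z : Euc d) : ℝ := -(bump P z * qLin P z i)

/-- The partial derivatives of `bump P`. -/
def bumpGrad {d : ℕ} (P : Fin d → Fin d → ℝ) (i : Fin d) (z : Euc d) : ℝ :=
  deriv cutoff (qForm P z) * qLin P z i

/-- The partial derivatives of `flux P`. -/
def fluxDeriv {d : ℕ} (P : Fin d → Fin d → ℝ) (i j : Fin d) (z : Euc d) : ℝ :=
  -(deriv cutoff (qForm P z) * qLin P z i * qLin P z j + cutoff (qForm P z) * P i j)

lemma contDiff_qLin {d : ℕ} {n : ℕ∞} (i : Fin d) :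
    ContDiff ℝ n fun q : (Fin d → Fin d → ℝ) × Euc d => qLin q.1 q.2 i := by
  unfold qLin; fun_prop

lemma contDiff_qForm {d : ℕ} {n : ℕ∞} :
    ContDiff ℝ n fun q : (Fin d → Fin d → ℝ) × Euc d => qForm q.1 q.2 := by
  have := fun i : Fin d => contDiff_qLin (n := n) i
  unfold qForm; fun_prop

lemma contDiff_bump {d : ℕ} {n : ℕ∞} :
    ContDiff ℝ n fun q : (Fin d → Fin d → ℝ) × Euc d => bump q.1 q.2 :=
  contDiff_cutoff.comp contDiff_qForm

lemma contDiff_flux {d : ℕ} {n : ℕ∞} (i : Fin d) :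
    ContDiff ℝ n fun q : (Fin d → Fin d → ℝ) × Euc d => flux q.1 i q.2 :=
  (contDiff_bump.mul (contDiff_qLin i)).neg

lemma contDiff_bumpGrad {d : ℕ} {n : ℕ} (i : Fin d) :
    ContDiff ℝ n fun q : (Fin d → Fin d → ℝ) × Euc d => bumpGrad q.1 i q.2 :=
  (contDiff_deriv_cutoff.comp (contDiff_qForm (n := n))).mul (contDiff_qLin (n := n) i)

lemma contDiff_fluxDeriv {d : ℕ} {n : ℕ} (i j : Fin d) :
    ContDiff ℝ n fun q : (Fin d → Fin d → ℝ) × Euc d => fluxDeriv q.1 i j q.2 := by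
  refine ((((contDiff_deriv_cutoff.comp (contDiff_qForm (n := n))).mul
    (contDiff_qLin (n := n) i)).mul (contDiff_qLin (n := n) j)).add
    ((contDiff_cutoff.comp (contDiff_qForm (n := n))).mul ?_)).neg
  fun_prop

/-- Symmetric matrices whose entries are bounded by `Λ` and whose quadratic form is so large that
the bump is supported in the ball of radius `R`. -/
structure KernelMatrix {d : ℕ} (R Λ : ℝ) (P : Fin d → Fin d → ℝ) : Prop where
  symm : ∀ i j, P i j = P j i
  bound : ∀ i j, |P i j| ≤ Λ
  coercive : ∀ z : Euc d, 2 * ‖z‖ ^ 2 ≤ R ^ 2 * qForm P z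

section
variable {d : ℕ} {R Λ : ℝ} {P : Fin d → Fin d → ℝ}

lemma KernelMatrix.two_le_qForm (hP : KernelMatrix R Λ P) (hR : 0 < R) {z : Euc d} (hz : R ≤ ‖z‖) :
    2 ≤ qForm P z := by
  have h := hP.coercive z
  have h2 : R ^ 2 ≤ ‖z‖ ^ 2 := by gcongr
  have h3 : 0 < R ^ 2 := by positivity
  nlinarith

lemma KernelMatrix.bump_eq_zero (hP : KernelMatrix R Λ P) (hR : 0 < R) {z : Euc d}
    (hz : R ≤ ‖z‖) : bump P z = 0 := cutoff_eq_zero (hP.two_le_qForm hR hz)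

lemma KernelMatrix.flux_eq_zero (hP : KernelMatrix R Λ P) (hR : 0 < R) {z : Euc d}
    (hz : R ≤ ‖z‖) (i : Fin d) : flux P i z = 0 := by simp [flux, hP.bump_eq_zero hR hz]

lemma KernelMatrix.bumpGrad_eq_zero (hP : KernelMatrix R Λ P) (hR : 0 < R) {z : Euc d}
    (hz : R ≤ ‖z‖) (i : Fin d) : bumpGrad P i z = 0 := by
  simp [bumpGrad, deriv_cutoff_eq_zero (hP.two_le_qForm hR hz)]

lemma KernelMatrix.fluxDeriv_eq_zero (hP : KernelMatrix R Λ P) (hR : 0 < R) {z : Euc d}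
    (hz : R ≤ ‖z‖) (i j : Fin d) : fluxDeriv P i j z = 0 := by
  simp [fluxDeriv, deriv_cutoff_eq_zero (hP.two_le_qForm hR hz),
    cutoff_eq_zero (hP.two_le_qForm hR hz)]

lemma hasCompactSupport_of_eq_zero {k : Euc d → ℝ} (h : ∀ z, R ≤ ‖z‖ → k z = 0) :
    HasCompactSupport k :=
  HasCompactSupport.intro (isCompact_closedBall 0 R) fun z hz => h z (by
    simp only [mem_closedBall, dist_zero_right, not_le] at hz; exact hz.le)

/-- The `i`-th coordinate as a continuous linear form. -/
def coordCLM {d : ℕ} (i : Fin d) : Euc d →L[ℝ] ℝ := EuclideanSpace.proj i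

lemma coordCLM_apply (i : Fin d) (z : Euc d) : coordCLM i z = z i := rfl

lemma coordCLM_stdVec (i k : Fin d) : coordCLM i (stdVec k) = if i = k then 1 else 0 := by
  simp [coordCLM_apply, stdVec]

lemma hasFDerivAt_coord (i : Fin d) (z : Euc d) :
    HasFDerivAt (fun z : Euc d => z i) (coordCLM i) z := (coordCLM i).hasFDerivAt

lemma hasFDerivAt_qLin (i : Fin d) (z : Euc d) :
    HasFDerivAt (fun z => qLin P z i) (∑ j, P i j • coordCLM j) z := by
  unfold qLin
  refine HasFDerivAt.fun_sum fun j _ => ?_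
  exact (hasFDerivAt_coord j z).const_mul (P i j)

lemma fderiv_qLin (i k : Fin d) (z : Euc d) :
    fderiv ℝ (fun z => qLin P z i) z (stdVec k) = P i k := by
  rw [(hasFDerivAt_qLin i z).fderiv]
  simp [coordCLM_stdVec]

lemma fderiv_qForm (hP : ∀ i j, P i j = P j i) (k : Fin d) (z : Euc d) :
    fderiv ℝ (fun z => qForm P z) z (stdVec k) = qLin P z k := by
  have h : HasFDerivAt (fun z => qForm P z) ((1 / 2 : ℝ) • ∑ i,
      (z i • (∑ j, P i j • coordCLM j)
        + qLin P z i • coordCLM i)) z := by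
    unfold qForm
    refine HasFDerivAt.const_mul (HasFDerivAt.fun_sum fun i _ => ?_) _
    exact (hasFDerivAt_coord i z).mul (hasFDerivAt_qLin i z)
  rw [h.fderiv]
  simp [coordCLM_stdVec, Finset.sum_add_distrib]
  have : ∑ i, z i * P i k = qLin P z k := by
    simp only [qLin]
    exact Finset.sum_congr rfl fun i _ => by rw [hP i k, mul_comm]
  rw [this]; ring

lemma fderiv_bump (hP : ∀ i j, P i j = P j i) (k : Fin d) (z : Euc d) :
    fderiv ℝ (fun z => bump P z) z (stdVec k) = bumpGrad P k z := by
  have h1 : HasDerivAt cutoff (deriv cutoff (qForm P z)) (qForm P z) :=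
    ((contDiff_cutoff (n := 1)).differentiable (by simp) _).hasDerivAt
  have h2 : DifferentiableAt ℝ (fun z => qForm P z) z :=
    ((contDiff_qForm (n := 1)).comp (contDiff_prodMk_right P)).differentiable (by simp) z
  have := (h1.comp_hasFDerivAt z h2.hasFDerivAt).fderiv
  simp only [Function.comp_def] at this
  simp only [bump, this, bumpGrad]
  simp [fderiv_qForm hP]

lemma fderiv_flux (hP : ∀ i j, P i j = P j i) (i j : Fin d) (z : Euc d) :
    fderiv ℝ (fun z => flux P j z) z (stdVec i) = fluxDeriv P i j z := by
  have h1 : DifferentiableAt ℝ (fun z => bump P z) z :=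
    ((contDiff_bump (n := 1)).comp (contDiff_prodMk_right P)).differentiable (by simp) z
  have h2 : DifferentiableAt ℝ (fun z => qLin P z j) z := (hasFDerivAt_qLin j z).differentiableAt
  unfold flux
  rw [fderiv_fun_neg, fderiv_fun_mul h1 h2]
  simp only [neg_apply, add_apply, smul_apply, smul_eq_mul, fderiv_qLin, fderiv_bump hP]
  simp only [fluxDeriv, bumpGrad, bump, hP j i]
  ring

lemma fluxDeriv_comm (hP : ∀ i j, P i j = P j i) (i j : Fin d) (z : Euc d) :
    fluxDeriv P i j z = fluxDeriv P j i z := by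
  simp only [fluxDeriv, hP i j]; ring

/-- The algebraic identity relating the bump and the flux. -/
lemma coord_mul_bumpGrad {A : Fin d → Fin d → ℝ} (hP : ∀ i j, P i j = P j i)
    (hAP : ∀ k j, ∑ l, A k l * P l j = if k = j then 1 else 0) (i k : Fin d) (z : Euc d) :
    z k * bumpGrad P i z
      = -(if k = i then bump P z else 0) - ∑ l, A k l * fluxDeriv P i l z := by
  have h1 : ∑ l, A k l * qLin P z l = z k := by
    simp only [qLin, Finset.mul_sum]
    rw [Finset.sum_comm]
    simp only [← mul_assoc, ← Finset.sum_mul, hAP]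
    simp
  have h2 : ∑ l, A k l * fluxDeriv P i l z
      = -(bumpGrad P i z * ∑ l, A k l * qLin P z l + bump P z * ∑ l, A k l * P l i) := by
    simp only [Finset.mul_sum, ← Finset.sum_add_distrib, ← Finset.sum_neg_distrib]
    refine Finset.sum_congr rfl fun l _ => ?_
    simp only [fluxDeriv, bumpGrad, bump, hP i l]; ring
  rw [h2, h1, hAP]
  split_ifs <;> ring

end

lemma qForm_le {d : ℕ} {Λ : ℝ} {P : Fin d → Fin d → ℝ} (hP : ∀ i j, |P i j| ≤ Λ) (z : Euc d) :
    qForm P z ≤ d ^ 2 * Λ * ‖z‖ ^ 2 := by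
  have h1 : ∀ i, z i * qLin P z i ≤ d * Λ * ‖z‖ ^ 2 := fun i => by
    have h2 : |qLin P z i| ≤ d * (Λ * ‖z‖) := by
      refine (Finset.abs_sum_le_sum_abs _ _).trans ?_
      refine (Finset.sum_le_sum (g := fun _ => Λ * ‖z‖) fun j _ => ?_).trans_eq (by simp)
      rw [abs_mul]
      exact mul_le_mul (hP i j) (abs_coord_le_norm z j) (abs_nonneg _)
        ((abs_nonneg _).trans (hP i j))
    calc z i * qLin P z i ≤ |z i| * |qLin P z i| := by rw [← abs_mul]; exact le_abs_self _
      _ ≤ ‖z‖ * (d * (Λ * ‖z‖)) :=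
        mul_le_mul (abs_coord_le_norm z i) h2 (abs_nonneg _) (norm_nonneg _)
      _ = d * Λ * ‖z‖ ^ 2 := by ring
  have h3 : ∑ i, z i * qLin P z i ≤ d * (d * Λ * ‖z‖ ^ 2) :=
    (Finset.sum_le_sum fun i _ => h1 i).trans_eq (by simp)
  rcases isEmpty_or_nonempty (Fin d) with h | ⟨⟨i⟩⟩
  · have : d = 0 := by rcases d with _ | d <;> [rfl; exact (h.false 0).elim]
    subst this
    simp [qForm]
  · have hΛ : 0 ≤ Λ := (abs_nonneg _).trans (hP i i)
    have : 0 ≤ d ^ 2 * Λ * ‖z‖ ^ 2 := by positivity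
    unfold qForm
    linarith

lemma norm_apply_apply_le_fst {d : ℕ} {F : Type*} [SeminormedAddCommGroup F]
    (q : (Fin d → Fin d → ℝ) × F) (i j : Fin d) : ‖q.1 i j‖ ≤ ‖q‖ :=
  ((norm_le_pi_norm (q.1 i) j).trans (norm_le_pi_norm q.1 i)).trans (norm_fst_le q)

/-- Bounds on the kernels that are uniform over a class of matrices. -/
lemma exists_kernel_bound (d : ℕ) {R Λ : ℝ} (hR : 0 < R) (hΛ : 0 ≤ Λ) :
    ∃ K : ℝ, 1 ≤ K ∧ ∀ P : Fin d → Fin d → ℝ, KernelMatrix R Λ P →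
      (∀ i j z, |fluxDeriv P i j z| ≤ K) ∧
      (∀ i j z ζ, ‖ζ‖ ≤ 1 → |fluxDeriv P i j (z + ζ) - fluxDeriv P i j z| ≤ K * ‖ζ‖) ∧
      (∀ i z, |bumpGrad P i z| ≤ K) ∧
      (∀ P', KernelMatrix R Λ P' → ∀ δ, 0 ≤ δ → (∀ i j, |P i j - P' i j| ≤ δ) →
        ∀ z, |bump P z - bump P' z| ≤ K * δ) ∧
      1 ≤ K * ∫ z, bump P z := by
  set G : (Fin d → Fin d → ℝ) × Euc d → (Fin d → Fin d → ℝ) × (Fin d → ℝ) × ℝ := fun q =>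
    (fun i j => fluxDeriv q.1 i j q.2, fun i => bumpGrad q.1 i q.2, bump q.1 q.2) with hG
  have hGc : ContDiff ℝ 1 G := by
    refine ContDiff.prodMk ?_ (ContDiff.prodMk ?_ contDiff_bump)
    · exact contDiff_pi.2 fun i => contDiff_pi.2 fun j => contDiff_fluxDeriv (n := 1) i j
    · exact contDiff_pi.2 fun i => contDiff_bumpGrad (n := 1) i
  set S : Set ((Fin d → Fin d → ℝ) × Euc d) := closedBall 0 Λ ×ˢ closedBall 0 (R + 2) with hS
  have hSc : IsCompact S := (isCompact_closedBall _ _).prod (isCompact_closedBall _ _)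
  have hSx : Convex ℝ S := (convex_closedBall _ _).prod (convex_closedBall _ _)
  obtain ⟨L, hL⟩ := hGc.contDiffOn.exists_lipschitzOnWith one_ne_zero hSx hSc
  obtain ⟨M, hM⟩ := hSc.bddAbove_image hGc.continuous.norm.continuousOn
  set D : ℝ := d ^ 2 * Λ + 1 with hD
  have hD1 : 1 ≤ D := le_add_of_nonneg_left (by positivity)
  set V : ℝ := (volume : Measure (Euc d)).real (closedBall 0 (1 / D)) with hV
  have hV0 : 0 < V :=
    ENNReal.toReal_pos (measure_closedBall_pos _ _ (by positivity)).ne' measure_closedBall_lt_top.ne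
  set K : ℝ := 1 + |M| + L + 1 / V with hK
  have hL0 : (0 : ℝ) ≤ L := L.2
  have hM0 := abs_nonneg M
  have hV1 : 0 < 1 / V := by positivity
  have hPS : ∀ P : Fin d → Fin d → ℝ, KernelMatrix R Λ P → ∀ z : Euc d, ‖z‖ ≤ R + 2 →
      (P, z) ∈ S := fun P hP z hz => by
    refine ⟨?_, by simpa using hz⟩
    rw [mem_closedBall, dist_zero_right]
    exact (pi_norm_le_iff_of_nonneg hΛ).2 fun i => (pi_norm_le_iff_of_nonneg hΛ).2 (hP.bound i)
  have hGn : ∀ P, KernelMatrix R Λ P → ∀ z : Euc d, ‖z‖ ≤ R + 2 → ‖G (P, z)‖ ≤ K :=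
    fun P hP z hz => by
      have := (hM ⟨_, hPS P hP z hz, rfl⟩).trans (le_abs_self M)
      simp only at this
      linarith
  refine ⟨K, by linarith, fun P hP => ⟨?_, ?_, ?_, ?_, ?_⟩⟩
  · intro i j z
    by_cases hz : R ≤ ‖z‖
    · rw [hP.fluxDeriv_eq_zero hR hz, abs_zero]; linarith
    · exact (norm_apply_apply_le_fst (G (P, z)) i j).trans (hGn P hP z (by linarith))
  · intro i j z ζ hζ
    by_cases hz : R + 1 ≤ ‖z‖
    · have h1 : R ≤ ‖z + ζ‖ := by
        have := norm_sub_le_norm_add z ζ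
        linarith
      rw [hP.fluxDeriv_eq_zero hR h1, hP.fluxDeriv_eq_zero hR (by linarith)]
      simp only [sub_self, abs_zero]; positivity
    · have h1 : ‖z + ζ‖ ≤ R + 2 := (norm_add_le z ζ).trans (by linarith)
      have h2 := hL.norm_sub_le (hPS P hP _ h1) (hPS P hP z (by linarith))
      have h3 : ‖((P, z + ζ) : (Fin d → Fin d → ℝ) × Euc d) - (P, z)‖ = ‖ζ‖ := by
        simp [Prod.norm_def]
      rw [h3] at h2
      have h4 := (norm_apply_apply_le_fst (G (P, z + ζ) - G (P, z)) i j).trans h2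
      refine h4.trans ?_
      gcongr
      linarith
  · intro i z
    by_cases hz : R ≤ ‖z‖
    · rw [hP.bumpGrad_eq_zero hR hz, abs_zero]; linarith
    · exact ((norm_le_pi_norm _ i).trans ((norm_fst_le _).trans (norm_snd_le _))).trans
        (hGn P hP z (by linarith))
  · intro P' hP' δ hδ h z
    by_cases hz : R ≤ ‖z‖
    · rw [hP.bump_eq_zero hR hz, hP'.bump_eq_zero hR hz]
      simp only [sub_self, abs_zero]; positivity
    · have h2 := hL.norm_sub_le (hPS P hP z (by linarith)) (hPS P' hP' z (by linarith))
      have h3 : ‖((P, z) : (Fin d → Fin d → ℝ) × Euc d) - (P', z)‖ ≤ δ := by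
        simp only [Prod.mk_sub_mk, sub_self, Prod.norm_def, norm_zero]
        refine max_le ?_ hδ
        exact (pi_norm_le_iff_of_nonneg hδ).2 fun i => (pi_norm_le_iff_of_nonneg hδ).2 (h i)
      have h4 := ((norm_snd_le _).trans (norm_snd_le _)).trans h2
      refine h4.trans ?_
      gcongr
      linarith
  · have hb : Continuous (bump P) :=
      ((contDiff_bump (n := 1)).comp (contDiff_prodMk_right P)).continuous
    have hbi : Integrable (bump P) := hb.integrable_of_hasCompactSupport
      (hasCompactSupport_of_eq_zero fun z hz => hP.bump_eq_zero hR hz)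
    have h1 : V ≤ ∫ z, bump P z := by
      calc V = ∫ z in closedBall (0 : Euc d) (1 / D), (1 : ℝ) := by simp [hV]
        _ = ∫ z in closedBall (0 : Euc d) (1 / D), bump P z := by
          refine setIntegral_congr_fun measurableSet_closedBall fun z hz => ?_
          refine (cutoff_eq_one ((qForm_le hP.bound z).trans ?_)).symm
          rw [mem_closedBall, dist_zero_right] at hz
          calc d ^ 2 * Λ * ‖z‖ ^ 2 ≤ D * (1 / D) ^ 2 := by
                gcongr
                linarith
            _ = 1 / D := by field_simp
            _ ≤ 1 := by rw [div_le_one (by linarith)]; exact hD1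
        _ ≤ ∫ z, bump P z := setIntegral_le_integral hbi
          (Filter.Eventually.of_forall fun z => cutoff_nonneg _)
    calc (1 : ℝ) = 1 / V * V := by field_simp
      _ ≤ K * ∫ z, bump P z := by
        gcongr
        linarith

section
variable {d : ℕ} {v : Euc d → ℝ}

lemma contDiff_pd1 (hv : ContDiff ℝ 2 v) (j : Fin d) : ContDiff ℝ 1 fun y => pd1 d v y j :=
  (hv.fderiv_right (m := 1) (by norm_num)).clm_apply contDiff_const

lemma fderiv_pd1 (x : Euc d) (i j : Fin d) :
    fderiv ℝ (fun y => pd1 d v y j) x (stdVec i) = pd2 d v x i j := rfl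

lemma pd2_comm (hv : ContDiff ℝ 2 v) (x : Euc d) (i j : Fin d) : pd2 d v x i j = pd2 d v x j i :=
  fderiv_fderiv_comm hv _ _ x

lemma pd2_eq (hv : ContDiff ℝ 2 v) (x : Euc d) (i j : Fin d) :
    pd2 d v x i j = fderiv ℝ (fderiv ℝ v) x (stdVec i) (stdVec j) :=
  fderiv_fderiv_apply hv _ _ x

lemma continuous_pd2 (hv : ContDiff ℝ 2 v) (i j : Fin d) : Continuous fun y => pd2 d v y i j :=
  ((contDiff_pd1 hv j).continuous_fderiv (by simp)).clm_apply continuous_const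

/-- The constant coefficient second order operator with matrix `A`. -/
def secondOrder (A : Fin d → Fin d → ℝ) (v : Euc d → ℝ) (y : Euc d) : ℝ :=
  ∑ k, ∑ l, A k l * pd2 d v y l k

lemma continuous_secondOrder (hv : ContDiff ℝ 2 v) (A : Fin d → Fin d → ℝ) :
    Continuous (secondOrder A v) := by
  have := fun i j => continuous_pd2 hv i j
  unfold secondOrder; fun_prop

/-- The average of a second derivative of `v` against the bump of `P` at scale `τ` around `x`. -/
def hessAvg (P : Fin d → Fin d → ℝ) (v : Euc d → ℝ) (x : Euc d) (i j : Fin d) (τ : ℝ) : ℝ :=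
  ∫ z, bump P z * pd2 d v (x + τ • z) i j

variable {R Λ : ℝ} {P : Fin d → Fin d → ℝ}

lemma continuous_bump : Continuous (bump P) :=
  ((contDiff_bump (n := 1)).comp (contDiff_prodMk_right P)).continuous

lemma continuous_bumpGrad (i : Fin d) : Continuous (bumpGrad P i) :=
  ((contDiff_bumpGrad (n := 1) i).comp (contDiff_prodMk_right P)).continuous

lemma continuous_fluxDeriv (i j : Fin d) : Continuous (fluxDeriv P i j) :=
  ((contDiff_fluxDeriv (n := 1) i j).comp (contDiff_prodMk_right P)).continuous

lemma KernelMatrix.hasCompactSupport_bump (hP : KernelMatrix R Λ P) (hR : 0 < R) :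
    HasCompactSupport (bump P) :=
  hasCompactSupport_of_eq_zero fun _ hz => hP.bump_eq_zero hR hz

lemma KernelMatrix.hasCompactSupport_flux (hP : KernelMatrix R Λ P) (hR : 0 < R) (i : Fin d) :
    HasCompactSupport (flux P i) :=
  hasCompactSupport_of_eq_zero fun _ hz => hP.flux_eq_zero hR hz i

lemma KernelMatrix.hasCompactSupport_bumpGrad (hP : KernelMatrix R Λ P) (hR : 0 < R) (i : Fin d) :
    HasCompactSupport (bumpGrad P i) :=
  hasCompactSupport_of_eq_zero fun _ hz => hP.bumpGrad_eq_zero hR hz i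

lemma KernelMatrix.hasCompactSupport_fluxDeriv (hP : KernelMatrix R Λ P) (hR : 0 < R)
    (i j : Fin d) : HasCompactSupport (fluxDeriv P i j) :=
  hasCompactSupport_of_eq_zero fun _ hz => hP.fluxDeriv_eq_zero hR hz i j

lemma contDiff_bump_right : ContDiff ℝ 1 fun z => bump P z := by
  have := (contDiff_bump (d := d) (n := 1)).comp (contDiff_prodMk_right (𝕜 := ℝ) P)
  exact this.of_le (by norm_num)

lemma contDiff_flux_right (i : Fin d) : ContDiff ℝ 2 fun z => flux P i z := by
  have := (contDiff_flux (d := d) (n := 2) i).comp (contDiff_prodMk_right (𝕜 := ℝ) P)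
  exact this.of_le (by norm_num)

lemma contDiff_comp_add_smul {w : Euc d → ℝ} (hw : ContDiff ℝ 1 w) (x : Euc d) (τ : ℝ) :
    ContDiff ℝ 1 fun z => w (x + τ • z) := by
  have hs : ContDiff ℝ 1 fun z : Euc d => x + τ • z := by fun_prop
  exact ContDiff.comp hw hs

lemma mul_hessAvg (hv : ContDiff ℝ 2 v) (hP : KernelMatrix R Λ P) (hR : 0 < R) (x : Euc d)
    (i j : Fin d) (τ : ℝ) :
    τ * hessAvg P v x i j τ = -∫ z, bumpGrad P i z * pd1 d v (x + τ • z) j := by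
  have hw := contDiff_pd1 hv j
  have hw' : ContDiff ℝ 1 fun z => pd1 d v (x + τ • z) j := contDiff_comp_add_smul hw x τ
  have h1 : ContDiff ℝ 1 fun z => bump P z := contDiff_bump_right
  have h := integral_mul_partial h1 (hP.hasCompactSupport_bump hR) hw' (stdVec i)
  have h2 : ∀ z, fderiv ℝ (fun z => pd1 d v (x + τ • z) j) z (stdVec i)
      = τ * pd2 d v (x + τ • z) i j := fun z => by
    rw [fderiv_comp_add_smul (w := fun y => pd1 d v y j) (hw.differentiable (by simp)), fderiv_pd1]
  have h3 : ∀ z, fderiv ℝ (fun z => bump P z) z (stdVec i) = bumpGrad P i z := fderiv_bump hP.symm i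
  simp only [h2, h3] at h
  rw [← h, hessAvg, ← integral_const_mul]
  congr 1 with z
  ring

lemma integral_fluxDeriv_swap (hv : ContDiff ℝ 2 v) (hP : KernelMatrix R Λ P) (hR : 0 < R)
    (x : Euc d) {τ : ℝ} (hτ : τ ≠ 0) (i j k l : Fin d) :
    ∫ z, fluxDeriv P i l z * pd2 d v (x + τ • z) k j
      = ∫ z, fluxDeriv P i j z * pd2 d v (x + τ • z) l k := by
  have hw := contDiff_pd1 hv k
  have hw' : ContDiff ℝ 1 fun z => pd1 d v (x + τ • z) k := contDiff_comp_add_smul hw x τ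
  have h1 : ContDiff ℝ 2 fun z => flux P i z := contDiff_flux_right i
  have h := integral_partial_mul_partial_comm h1 (hP.hasCompactSupport_flux hR i) hw'
    (stdVec l) (stdVec j)
  have h2 : ∀ m z, fderiv ℝ (fun z => pd1 d v (x + τ • z) k) z (stdVec m)
      = τ * pd2 d v (x + τ • z) m k := fun m z => by
    rw [fderiv_comp_add_smul (w := fun y => pd1 d v y k) (hw.differentiable (by simp)), fderiv_pd1]
  have h3 : ∀ m z, fderiv ℝ (fun z => flux P i z) z (stdVec m) = fluxDeriv P i m z := fun m z =>
    (fderiv_flux hP.symm m i z).trans (fluxDeriv_comm hP.symm m i z)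
  simp only [h2, h3, mul_left_comm _ τ, integral_const_mul] at h
  have h4 := mul_left_cancel₀ hτ h
  simpa only [pd2_comm hv _ j k] using h4

lemma hasDerivAt_hessAvg (hv : ContDiff ℝ 2 v) (hP : KernelMatrix R Λ P) (hR : 0 < R)
    {A : Fin d → Fin d → ℝ} (hAP : ∀ k j, ∑ l, A k l * P l j = if k = j then 1 else 0)
    (x : Euc d) (i j : Fin d) {τ : ℝ} (hτ : 0 < τ) :
    HasDerivAt (hessAvg P v x i j)
      (τ⁻¹ * ∫ z, fluxDeriv P i j z * secondOrder A v (x + τ • z)) τ := by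
  have hpd2 := fun i j => continuous_pd2 hv i j
  set T := ∫ z, fluxDeriv P i j z * secondOrder A v (x + τ • z) with hT
  set I : ℝ → ℝ := fun τ => ∫ z, bumpGrad P i z * pd1 d v (x + τ • z) j with hI
  have h1 := hasDerivAt_integral_scaled (continuous_bumpGrad i)
    (hP.hasCompactSupport_bumpGrad hR i) (contDiff_pd1 hv j) x τ
  have hint : ∀ k l a b, Integrable fun z : Euc d =>
      A k l * (fluxDeriv P i a z * pd2 d v (x + τ • z) b j) := fun k l a b =>
    (integrable_mul_of_hasCompactSupport (continuous_fluxDeriv i a)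
      (hP.hasCompactSupport_fluxDeriv hR i a) (by fun_prop)).const_mul _
  have hint' : ∀ k l, Integrable fun z : Euc d =>
      A k l * (fluxDeriv P i j z * pd2 d v (x + τ • z) l k) := fun k l =>
    (integrable_mul_of_hasCompactSupport (continuous_fluxDeriv i j)
      (hP.hasCompactSupport_fluxDeriv hR i j) (by fun_prop)).const_mul _
  have hI' : ∫ z, bumpGrad P i z * fderiv ℝ (fun y => pd1 d v y j) (x + τ • z) z
      = -hessAvg P v x i j τ - T := by
    have e1 : ∀ z, bumpGrad P i z * fderiv ℝ (fun y => pd1 d v y j) (x + τ • z) z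
        = -(bump P z * pd2 d v (x + τ • z) i j)
          - ∑ k, ∑ l, A k l * (fluxDeriv P i l z * pd2 d v (x + τ • z) k j) := fun z => by
      rw [clm_apply_eq_sum]
      simp only [fderiv_pd1, smul_eq_mul, Finset.mul_sum]
      have : ∀ k, bumpGrad P i z * (z k * pd2 d v (x + τ • z) k j)
          = -(if k = i then bump P z * pd2 d v (x + τ • z) i j else 0)
            - ∑ l, A k l * (fluxDeriv P i l z * pd2 d v (x + τ • z) k j) := fun k => by
        have := congrArg (· * pd2 d v (x + τ • z) k j) (coord_mul_bumpGrad hP.symm hAP i k z)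
        simp only [sub_mul, Finset.sum_mul, mul_assoc] at this
        rw [mul_left_comm, this]
        split_ifs with hki
        · rw [hki]; ring
        · simp
      simp only [this, Finset.sum_sub_distrib, Finset.sum_neg_distrib]
      simp
    have e2 : T = ∑ k, ∑ l, A k l * ∫ z, fluxDeriv P i l z * pd2 d v (x + τ • z) k j := by
      simp only [fun k l => integral_fluxDeriv_swap hv hP hR x hτ.ne' i j k l]
      simp only [hT, secondOrder, Finset.mul_sum, mul_left_comm (fluxDeriv P i j _)]
      rw [integral_finsetSum _ fun k _ => integrable_finsetSum _ fun l _ => hint' k l]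
      simp only [integral_finsetSum _ fun l _ => hint' _ l, integral_const_mul]
    simp only [e1]
    rw [integral_sub, integral_neg, e2,
      integral_finsetSum _ fun k _ => integrable_finsetSum _ fun l _ => hint k l l k]
    · simp only [fun k => integral_finsetSum Finset.univ fun l _ => hint k l l k,
        integral_const_mul]
      rfl
    · exact (integrable_mul_of_hasCompactSupport continuous_bump
        (hP.hasCompactSupport_bump hR) (by fun_prop)).neg
    · exact integrable_finsetSum _ fun k _ => integrable_finsetSum _ fun l _ => hint k l l k
  have hJ : ∀ t, 0 < t → hessAvg P v x i j t = -I t / t := fun t ht => by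
    rw [eq_div_iff ht.ne', mul_comm, mul_hessAvg hv hP hR]
  have h2 := (h1.neg.div (hasDerivAt_id τ) hτ.ne').congr_of_eventuallyEq
    (f₁ := hessAvg P v x i j) (by
      filter_upwards [lt_mem_nhds hτ] with t ht
      exact hJ t ht)
  have hIτ : I τ = -(τ * hessAvg P v x i j τ) := by rw [mul_hessAvg hv hP hR, neg_neg]
  refine h2.congr_deriv ?_
  rw [hI']
  change (-(-hessAvg P v x i j τ - T) * τ - -I τ * 1) / τ ^ 2 = _
  rw [hIτ]
  field_simp
  ring

end

/-- The volume of a ball of radius `R` in `ℝ^d`. -/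
def volBall (d : ℕ) (R : ℝ) : ℝ := volume.real (closedBall (0 : Euc d) R)

lemma volBall_nonneg (d : ℕ) (R : ℝ) : 0 ≤ volBall d R := measureReal_nonneg

lemma abs_integral_mul_le {d : ℕ} {k F : Euc d → ℝ} {R K M : ℝ} (hK : 0 ≤ K)
    (hk0 : ∀ z, R ≤ ‖z‖ → k z = 0) (hk : ∀ z, |k z| ≤ K) (hF : ∀ z, ‖z‖ ≤ R → |F z| ≤ M) :
    |∫ z, k z * F z| ≤ K * M * volBall d R := by
  rw [← setIntegral_eq_integral_of_forall_compl_eq_zero (s := closedBall (0 : Euc d) R)]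
  · rw [← Real.norm_eq_abs, volBall]
    refine norm_setIntegral_le_of_norm_le_const measure_closedBall_lt_top fun z hz => ?_
    rw [norm_mul]
    exact mul_le_mul (hk z) (hF z (by simpa using hz)) (norm_nonneg _) hK
  · intro z hz
    rw [hk0 z (by simp only [mem_closedBall, dist_zero_right, not_le] at hz; exact hz.le), zero_mul]

section
variable {d : ℕ} {v : Euc d → ℝ} {R Λ K : ℝ} {P A : Fin d → Fin d → ℝ}

lemma integral_fluxDeriv (hP : KernelMatrix R Λ P) (hR : 0 < R) (i j : Fin d) :
    ∫ z, fluxDeriv P i j z = 0 := by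
  have := integral_partial_eq_zero (η := fun z => flux P j z)
    ((contDiff_flux_right j).of_le (by norm_num)) (hP.hasCompactSupport_flux hR j) (stdVec i)
  simpa only [fderiv_flux hP.symm] using this

lemma integral_fluxDeriv_mul_sub (hP : KernelMatrix R Λ P) (hR : 0 < R) (i j : Fin d)
    {F : Euc d → ℝ} (hF : Continuous F) (c : ℝ) :
    ∫ z, fluxDeriv P i j z * (F z - c) = ∫ z, fluxDeriv P i j z * F z := by
  have h1 := integrable_mul_of_hasCompactSupport (continuous_fluxDeriv (P := P) i j)
    (hP.hasCompactSupport_fluxDeriv hR i j) hF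
  have h2 := integrable_mul_of_hasCompactSupport (continuous_fluxDeriv (P := P) i j)
    (hP.hasCompactSupport_fluxDeriv hR i j) (continuous_const (y := c))
  simp only [mul_sub]
  rw [integral_sub h1 h2, integral_mul_const, integral_fluxDeriv hP hR, zero_mul, sub_zero]

lemma continuous_hessAvg (hv : ContDiff ℝ 2 v) (hP : KernelMatrix R Λ P) (hR : 0 < R)
    (x : Euc d) (i j : Fin d) : Continuous (hessAvg P v x i j) :=
  continuous_integral_scaled continuous_bump (hP.hasCompactSupport_bump hR)
    (continuous_pd2 hv i j) x

lemma hessAvg_zero (x : Euc d) (i j : Fin d) :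
    hessAvg P v x i j 0 = (∫ z, bump P z) * pd2 d v x i j := by
  simp [hessAvg, integral_mul_const]

/-- The averages of a second derivative converge at a Hölder rate. -/
lemma abs_hessAvg_sub_le (hv : ContDiff ℝ 2 v) (hP : KernelMatrix R Λ P) (hR : 0 < R)
    (hAP : ∀ k j, ∑ l, A k l * P l j = if k = j then 1 else 0)
    (hK : 0 ≤ K) (hPK : ∀ i j z, |fluxDeriv P i j z| ≤ K) {α H c t : ℝ} (hα : 0 < α) (hH : 0 ≤ H)
    (ht : 0 < t) (x : Euc d)
    (h : ∀ y, ‖y - x‖ ≤ R * t → |secondOrder A v y - c| ≤ H * ‖y - x‖ ^ α) (i j : Fin d) :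
    |hessAvg P v x i j t - (∫ z, bump P z) * pd2 d v x i j|
      ≤ K * volBall d R * R ^ α / α * H * t ^ α := by
  have hV := volBall_nonneg d R
  have hs := continuous_secondOrder hv A
  have key : ∀ ε, 0 < ε → ε ≤ t → |hessAvg P v x i j t - hessAvg P v x i j ε|
      ≤ K * volBall d R * R ^ α / α * H * t ^ α := by
    intro ε hε hεt
    have := abs_sub_le_of_deriv_le_rpow (C := K * volBall d R * R ^ α * H) hα.ne' hε hεt
      (fun τ hτ => hasDerivAt_hessAvg hv hP hR hAP x i j hτ) (by
        intro τ h1 h2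
        have hτ : 0 < τ := hε.trans_le h1
        rw [← integral_fluxDeriv_mul_sub hP hR i j (by fun_prop) c, abs_mul,
          abs_of_pos (inv_pos.2 hτ)]
        have h3 := abs_integral_mul_le (F := fun z => secondOrder A v (x + τ • z) - c)
          (M := H * (R * τ) ^ α) hK
          (fun z hz => hP.fluxDeriv_eq_zero hR hz i j) (hPK i j) (fun z hz => by
            have h4 : ‖x + τ • z - x‖ ≤ R * τ := by
              rw [add_sub_cancel_left, norm_smul, Real.norm_of_nonneg hτ.le, mul_comm]
              gcongr
            refine (h _ (h4.trans (by gcongr))).trans ?_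
            gcongr)
        calc _ ≤ τ⁻¹ * (K * (H * (R * τ) ^ α) * volBall d R) := by gcongr
          _ = _ := by
            rw [Real.mul_rpow hR.le hτ.le, Real.rpow_sub_one hτ.ne']
            ring)
    refine this.trans ?_
    calc _ ≤ K * volBall d R * R ^ α * H / α * t ^ α := by
          gcongr
          linarith [Real.rpow_nonneg hε.le α]
      _ = _ := by ring
  rw [← hessAvg_zero]
  have hlim : Filter.Tendsto (fun ε => |hessAvg P v x i j t - hessAvg P v x i j ε|)
      (nhdsWithin 0 (Set.Ioi 0)) (nhds |hessAvg P v x i j t - hessAvg P v x i j 0|) := by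
    have := continuous_hessAvg hv hP hR x i j
    have h2 : Continuous fun ε => |hessAvg P v x i j t - hessAvg P v x i j ε| := by fun_prop
    exact (h2.tendsto 0).mono_left nhdsWithin_le_nhds
  refine le_of_tendsto hlim ?_
  filter_upwards [Ioc_mem_nhdsGT ht] with ε hε
  exact key ε hε.1 hε.2

lemma abs_hessAvg_le (hv : ContDiff ℝ 2 v) (hP : KernelMatrix R Λ P) (hR : 0 < R)
    (hK : 0 ≤ K) (hPK : ∀ i z, |bumpGrad P i z| ≤ K) {t D : ℝ} (ht : 0 < t) (x : Euc d)
    (i j : Fin d) (h : ∀ y, ‖y - x‖ ≤ R * t → |pd1 d v y j| ≤ D) :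
    |hessAvg P v x i j t| ≤ t⁻¹ * (K * D * volBall d R) := by
  have h1 := mul_hessAvg hv hP hR x i j t
  have h2 : hessAvg P v x i j t = t⁻¹ * -∫ z, bumpGrad P i z * pd1 d v (x + t • z) j := by
    rw [← h1]; field_simp
  rw [h2, abs_mul, abs_neg, abs_of_pos (inv_pos.2 ht)]
  gcongr
  refine abs_integral_mul_le hK (fun z hz => hP.bumpGrad_eq_zero hR hz i) (hPK i) fun z hz => ?_
  refine h _ ?_
  rw [add_sub_cancel_left, norm_smul, Real.norm_of_nonneg ht.le, mul_comm]
  gcongr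

/-- Hölder bound on the increments of the averages between the scales `‖x - x₀‖` and `t`. -/
lemma abs_hessAvg_sub_sub_le (hv : ContDiff ℝ 2 v) (hP : KernelMatrix R Λ P) (hR : 0 < R)
    (hAP : ∀ k j, ∑ l, A k l * P l j = if k = j then 1 else 0) (hK : 0 ≤ K)
    (hPK : ∀ i j z ζ, ‖ζ‖ ≤ 1 → |fluxDeriv P i j (z + ζ) - fluxDeriv P i j z| ≤ K * ‖ζ‖)
    {α H c t : ℝ} (hα : 0 < α) (hα1 : α < 1) (hH : 0 ≤ H) {x x₀ : Euc d} (hx : 0 < ‖x - x₀‖)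
    (hxt : ‖x - x₀‖ ≤ t)
    (h : ∀ y, ‖y - x₀‖ ≤ (R + 1) * t → |secondOrder A v y - c| ≤ H * ‖y - x₀‖ ^ α) (i j : Fin d) :
    |(hessAvg P v x i j t - hessAvg P v x₀ i j t)
        - (hessAvg P v x i j ‖x - x₀‖ - hessAvg P v x₀ i j ‖x - x₀‖)|
      ≤ K * volBall d (R + 1) * (R + 1) ^ α / (1 - α) * H * ‖x - x₀‖ ^ α := by
  set s := ‖x - x₀‖ with hs_def
  have hV := volBall_nonneg d (R + 1)
  have hs := continuous_secondOrder hv A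
  have := abs_sub_le_of_deriv_le_rpow (β := α - 1)
    (C := K * volBall d (R + 1) * (R + 1) ^ α * H * s) (by linarith) hx hxt
    (J := fun τ => hessAvg P v x i j τ - hessAvg P v x₀ i j τ)
    (fun τ hτ => (hasDerivAt_hessAvg hv hP hR hAP x i j hτ).sub
      (hasDerivAt_hessAvg hv hP hR hAP x₀ i j hτ)) (by
      intro τ h1 h2
      have hτ : 0 < τ := hx.trans_le h1
      set ζ : Euc d := τ⁻¹ • (x - x₀) with hζ_def
      have hζ : ‖ζ‖ = s / τ := by
        rw [norm_smul, norm_inv, Real.norm_of_nonneg hτ.le, inv_mul_eq_div]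
      have hζ1 : ‖ζ‖ ≤ 1 := by rw [hζ]; exact (div_le_one hτ).2 h1
      have hshift : ∫ z, fluxDeriv P i j z * (secondOrder A v (x + τ • z) - c)
          = ∫ z, fluxDeriv P i j (z + -ζ) * (secondOrder A v (x₀ + τ • z) - c) := by
        rw [← integral_add_right_eq_self (fun z => fluxDeriv P i j (z + -ζ) *
          (secondOrder A v (x₀ + τ • z) - c)) ζ]
        congr 1 with z
        have : x₀ + τ • (z + ζ) = x + τ • z := by
          rw [smul_add, hζ_def, smul_inv_smul₀ hτ.ne']; abel
        rw [this, add_neg_cancel_right]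
      have i1 : Integrable fun z =>
          fluxDeriv P i j (z + -ζ) * (secondOrder A v (x₀ + τ • z) - c) := by
        refine integrable_mul_of_hasCompactSupport
          ((continuous_fluxDeriv i j).comp (continuous_add_const _)) ?_ (by fun_prop)
        exact (hP.hasCompactSupport_fluxDeriv hR i j).comp_homeomorph (Homeomorph.addRight (-ζ))
      have i2 : Integrable fun z =>
          fluxDeriv P i j z * (secondOrder A v (x₀ + τ • z) - c) :=
        integrable_mul_of_hasCompactSupport (continuous_fluxDeriv i j)
          (hP.hasCompactSupport_fluxDeriv hR i j) (by fun_prop)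
      rw [← mul_sub, ← integral_fluxDeriv_mul_sub hP hR i j (by fun_prop) c,
        ← integral_fluxDeriv_mul_sub hP hR i j (F := fun z => secondOrder A v (x₀ + τ • z))
          (by fun_prop) c, hshift, ← integral_sub i1 i2, abs_mul, abs_of_pos (inv_pos.2 hτ)]
      simp only [← sub_mul]
      have h3 := abs_integral_mul_le (R := R + 1)
        (k := fun z => fluxDeriv P i j (z + -ζ) - fluxDeriv P i j z)
        (F := fun z => secondOrder A v (x₀ + τ • z) - c)
        (M := H * ((R + 1) * τ) ^ α) (K := K * ‖ζ‖) (by positivity)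
        (fun z hz => by
          have h5 : R ≤ ‖z + -ζ‖ := by
            have := norm_sub_norm_le z ζ
            rw [← sub_eq_add_neg]; linarith
          rw [hP.fluxDeriv_eq_zero hR h5, hP.fluxDeriv_eq_zero hR (by linarith), sub_zero])
        (fun z => by simpa using hPK i j z (-ζ) (by simpa using hζ1)) (fun z hz => by
          have h4 : ‖x₀ + τ • z - x₀‖ ≤ (R + 1) * τ := by
            rw [add_sub_cancel_left, norm_smul, Real.norm_of_nonneg hτ.le, mul_comm]
            gcongr
          refine (h _ (h4.trans (by gcongr))).trans ?_
          gcongr)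
      calc _ ≤ τ⁻¹ * (K * ‖ζ‖ * (H * ((R + 1) * τ) ^ α) * volBall d (R + 1)) := by gcongr
        _ = _ := by
          rw [Real.mul_rpow (by positivity) hτ.le, Real.rpow_sub_one hτ.ne',
            Real.rpow_sub_one hτ.ne', hζ]
          ring)
  refine this.trans ?_
  have ht : 0 < t := hx.trans_le hxt
  have e1 : K * volBall d (R + 1) * (R + 1) ^ α * H * s / (α - 1) * (t ^ (α - 1) - s ^ (α - 1))
      = K * volBall d (R + 1) * (R + 1) ^ α / (1 - α) * H * s * (s ^ (α - 1) - t ^ (α - 1)) := by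
    have : α - 1 ≠ 0 := by linarith
    have : 1 - α ≠ 0 := by linarith
    rw [← neg_sub 1 α, div_neg]
    ring
  rw [e1]
  have h1α : 0 < 1 - α := by linarith
  calc _ ≤ K * volBall d (R + 1) * (R + 1) ^ α / (1 - α) * H * s * s ^ (α - 1) := by
        gcongr
        linarith [Real.rpow_nonneg ht.le (α - 1)]
    _ = _ := by rw [Real.rpow_sub_one hx.ne']; field_simp

lemma abs_hessAvg_sub_hessAvg_le (hv : ContDiff ℝ 2 v) (hP : KernelMatrix R Λ P) (hR : 0 < R)
    (hK : 0 ≤ K) (hPK : ∀ i z, |bumpGrad P i z| ≤ K) {t N : ℝ} (ht : 0 < t) (hN : 0 ≤ N)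
    {x x₀ : Euc d} (hxt : ‖x - x₀‖ ≤ t) (i j : Fin d)
    (h : ∀ y, ‖y - x₀‖ ≤ (R + 1) * t → ∀ i j, |pd2 d v y i j| ≤ N) :
    |hessAvg P v x i j t - hessAvg P v x₀ i j t|
      ≤ t⁻¹ * (K * (d * N * ‖x - x₀‖) * volBall d R) := by
  have h0 : ∀ x, hessAvg P v x i j t = t⁻¹ * -∫ z, bumpGrad P i z * pd1 d v (x + t • z) j := by
    intro x
    rw [← mul_hessAvg hv hP hR x i j t]; field_simp
  have hc := (contDiff_pd1 hv j).continuous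
  have int : ∀ x, Integrable fun z => bumpGrad P i z * pd1 d v (x + t • z) j := fun x =>
    integrable_mul_of_hasCompactSupport (continuous_bumpGrad i)
      (hP.hasCompactSupport_bumpGrad hR i) (by fun_prop)
  rw [h0, h0, ← mul_sub, ← neg_sub', ← integral_sub (int _) (int _), abs_mul, abs_neg,
    abs_of_pos (inv_pos.2 ht)]
  simp only [← mul_sub]
  gcongr
  refine abs_integral_mul_le hK (fun z hz => hP.bumpGrad_eq_zero hR hz i) (hPK i) fun z hz => ?_
  have hz' : ‖t • z‖ ≤ R * t := by
    rw [norm_smul, Real.norm_of_nonneg ht.le, mul_comm]; gcongr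
  have := abs_sub_le_of_partial_le ((contDiff_pd1 hv j).differentiable (by simp)) hN
    (convex_closedBall x₀ ((R + 1) * t)) (x := x₀ + t • z) (y := x + t • z) (fun y hy i => by
      rw [fderiv_pd1]; exact h y (by simpa [dist_eq_norm] using hy) i j)
    (by rw [mem_closedBall, dist_eq_norm, add_sub_cancel_left]; nlinarith)
    (by
      rw [mem_closedBall, dist_eq_norm, add_sub_right_comm]
      exact (norm_add_le _ _).trans (by linarith))
  simpa using this

lemma abs_hessAvg_sub_hessAvg_of_kernel_le {P' : Fin d → Fin d → ℝ} (hv : ContDiff ℝ 2 v)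
    (hP : KernelMatrix R Λ P) (hP' : KernelMatrix R Λ P') (hR : 0 < R) {κ t N : ℝ} (hκ : 0 ≤ κ)
    (ht : 0 < t) (x : Euc d) (h' : ∀ z, |bump P z - bump P' z| ≤ κ) (i j : Fin d)
    (h : ∀ y, ‖y - x‖ ≤ R * t → |pd2 d v y i j| ≤ N) :
    |hessAvg P v x i j t - hessAvg P' v x i j t| ≤ κ * N * volBall d R := by
  have hc := continuous_pd2 hv i j
  rw [hessAvg, hessAvg, ← integral_sub]
  · simp only [← sub_mul]
    refine abs_integral_mul_le hκ (fun z hz => ?_) h' fun z hz => h _ ?_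
    · rw [hP.bump_eq_zero hR hz, hP'.bump_eq_zero hR hz, sub_zero]
    · rw [add_sub_cancel_left, norm_smul, Real.norm_of_nonneg ht.le, mul_comm]
      gcongr
  · exact integrable_mul_of_hasCompactSupport continuous_bump
      (hP.hasCompactSupport_bump hR) (by fun_prop)
  · exact integrable_mul_of_hasCompactSupport continuous_bump
      (hP'.hasCompactSupport_bump hR) (by fun_prop)

lemma abs_integral_bump_sub_le {P' : Fin d → Fin d → ℝ}
    (hP : KernelMatrix R Λ P) (hP' : KernelMatrix R Λ P') (hR : 0 < R) {κ : ℝ} (hκ : 0 ≤ κ)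
    (h' : ∀ z, |bump P z - bump P' z| ≤ κ) :
    |(∫ z, bump P z) - ∫ z, bump P' z| ≤ κ * volBall d R := by
  rw [← integral_sub (continuous_bump.integrable_of_hasCompactSupport
    (hP.hasCompactSupport_bump hR)) (continuous_bump.integrable_of_hasCompactSupport
    (hP'.hasCompactSupport_bump hR))]
  have := abs_integral_mul_le (R := R) (F := fun _ : Euc d => 1) (M := 1) hκ (fun z hz => by
    rw [hP.bump_eq_zero hR hz, hP'.bump_eq_zero hR hz, sub_zero]) h' (by simp)
  simpa using this

end

/-- Interior sup bound for the Hessian in terms of the gradient, for a constant coefficient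
operator whose value is Hölder continuous at the centre. -/
lemma exists_abs_pd2_le (d : ℕ) {R Λ α : ℝ} (hR : 0 < R) (hΛ : 0 ≤ Λ) (hα : 0 < α) :
    ∃ C : ℝ, 1 ≤ C ∧ ∀ (v : Euc d → ℝ) (A P : Fin d → Fin d → ℝ) (x : Euc d) (t H D c : ℝ),
      ContDiff ℝ 2 v → KernelMatrix R Λ P →
      (∀ k j, ∑ l, A k l * P l j = if k = j then 1 else 0) → 0 < t → 0 ≤ H →
      (∀ y, ‖y - x‖ ≤ R * t → |secondOrder A v y - c| ≤ H * ‖y - x‖ ^ α) →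
      (∀ y, ‖y - x‖ ≤ R * t → ∀ j, |pd1 d v y j| ≤ D) →
      ∀ i j, |pd2 d v x i j| ≤ C * (H * t ^ α + t⁻¹ * D) := by
  obtain ⟨K, hK1, hK⟩ := exists_kernel_bound d hR hΛ
  have hK0 : 0 ≤ K := by linarith
  have hV := volBall_nonneg d R
  set C := 1 + K * (K * volBall d R * R ^ α / α) + K * (K * volBall d R) with hC
  have hp1 : 0 ≤ K * (K * volBall d R * R ^ α / α) := by positivity
  have hp2 : 0 ≤ K * (K * volBall d R) := by positivity
  refine ⟨C, by linarith, fun v A P x t H D c hv hP hAP ht hH h hD i j => ?_⟩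
  obtain ⟨k1, k2, k3, k4, k5⟩ := hK P hP
  have e1 := abs_hessAvg_sub_le hv hP hR hAP hK0 k1 hα hH ht x h i j
  have e2 := abs_hessAvg_le hv hP hR hK0 k3 ht x i j fun y hy => hD y hy j
  have hD0 : 0 ≤ D := (abs_nonneg _).trans (hD x (by simp; positivity) j)
  set m := ∫ z, bump P z
  have hm : 0 ≤ m := by nlinarith
  have e3 : m * |pd2 d v x i j| ≤ K * volBall d R * R ^ α / α * H * t ^ α
      + t⁻¹ * (K * D * volBall d R) := by
    have hmul : m * |pd2 d v x i j| = |m * pd2 d v x i j| := by rw [abs_mul, abs_of_nonneg hm]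
    rw [hmul]
    have := abs_sub_abs_le_abs_sub (m * pd2 d v x i j) (hessAvg P v x i j t)
    rw [abs_sub_comm] at this
    linarith
  have q1 : 0 ≤ H * t ^ α := by positivity
  have q2 : 0 ≤ t⁻¹ * D := by positivity
  calc |pd2 d v x i j| ≤ K * m * |pd2 d v x i j| := le_mul_of_one_le_left (abs_nonneg _) k5
    _ = K * (m * |pd2 d v x i j|) := by ring
    _ ≤ K * (K * volBall d R * R ^ α / α * H * t ^ α + t⁻¹ * (K * D * volBall d R)) := by gcongr
    _ = K * (K * volBall d R * R ^ α / α) * (H * t ^ α) + K * (K * volBall d R) * (t⁻¹ * D) := by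
        ring
    _ ≤ C * (H * t ^ α) + C * (t⁻¹ * D) := by
        gcongr <;> linarith
    _ = _ := by ring

/-- Interior Hölder bound for the Hessian in terms of its supremum. -/
lemma exists_abs_pd2_sub_le (d : ℕ) {R Λ α : ℝ} (hR : 0 < R) (hΛ : 0 ≤ Λ) (hα : 0 < α)
    (hα1 : α < 1) :
    ∃ C : ℝ, 1 ≤ C ∧ ∀ (v : Euc d → ℝ) (A P A' P' : Fin d → Fin d → ℝ) (x x₀ : Euc d)
      (t H N δ c c' : ℝ), ContDiff ℝ 2 v → KernelMatrix R Λ P → KernelMatrix R Λ P' →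
      (∀ k j, ∑ l, A k l * P l j = if k = j then 1 else 0) →
      (∀ k j, ∑ l, A' k l * P' l j = if k = j then 1 else 0) →
      0 < ‖x - x₀‖ → ‖x - x₀‖ ≤ t → 0 ≤ H → 0 ≤ N → 0 ≤ δ →
      (∀ i j, |P i j - P' i j| ≤ δ * ‖x - x₀‖ ^ α) →
      (∀ y, ‖y - x₀‖ ≤ (R + 1) * t → |secondOrder A v y - c| ≤ H * ‖y - x₀‖ ^ α) →
      (∀ y, ‖y - x‖ ≤ R * ‖x - x₀‖ → |secondOrder A' v y - c'| ≤ H * ‖y - x‖ ^ α) →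
      (∀ y, ‖y - x₀‖ ≤ (R + 1) * t → ∀ i j, |pd2 d v y i j| ≤ N) →
      ∀ i j, |pd2 d v x i j - pd2 d v x₀ i j|
        ≤ C * (H + δ * N + t ^ (-α) * N) * ‖x - x₀‖ ^ α := by
  obtain ⟨K, hK1, hK⟩ := exists_kernel_bound d hR hΛ
  have hK0 : 0 ≤ K := by linarith
  have hV := volBall_nonneg d R
  have hV1 := volBall_nonneg d (R + 1)
  have h1α : 0 < 1 - α := by linarith
  set a := K * volBall d R * R ^ α / α with ha
  set b := K * volBall d (R + 1) * (R + 1) ^ α / (1 - α) with hb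
  set e := K * volBall d R with he
  have ha0 : 0 ≤ a := by positivity
  have hb0 : 0 ≤ b := by positivity
  have he0 : 0 ≤ e := by positivity
  set C := 1 + K * (2 * a + b) + K * (2 * e) + K * (d * e) with hC
  have hp1 : 0 ≤ K * (2 * a + b) := by positivity
  have hp2 : 0 ≤ K * (2 * e) := by positivity
  have hp3 : 0 ≤ K * (d * e) := by positivity
  refine ⟨C, by linarith, ?_⟩
  intro v A P A' P' x x₀ t H N δ c c' hv hP hP' hAP hAP' hs hst hH hN hδ hPP h h' hN' i j
  obtain ⟨k1, k2, k3, k4, k5⟩ := hK P hP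
  obtain ⟨k1', -, -, -, -⟩ := hK P' hP'
  set s := ‖x - x₀‖ with hs_def
  have ht : 0 < t := hs.trans_le hst
  have hδs : 0 ≤ K * (δ * s ^ α) := by positivity
  have kk := k4 P' hP' (δ * s ^ α) (by positivity) hPP
  have hRs : R * s ≤ (R + 1) * t := by nlinarith
  have f1 := abs_hessAvg_sub_le hv hP' hR hAP' hK0 k1' hα hH hs x h' i j
  have f2 := abs_hessAvg_sub_le hv hP hR hAP hK0 k1 hα hH hs x₀
    (fun y hy => h y (hy.trans hRs)) i j
  have f3 := abs_hessAvg_sub_sub_le hv hP hR hAP hK0 k2 hα hα1 hH hs hst h i j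
  have f4 := abs_hessAvg_sub_hessAvg_le hv hP hR hK0 k3 ht hN hst i j hN'
  have hball : ∀ y, ‖y - x‖ ≤ R * s → ‖y - x₀‖ ≤ (R + 1) * t := fun y hy => by
    have := norm_add_le (y - x) (x - x₀)
    rw [sub_add_sub_cancel] at this
    nlinarith
  have f5 := abs_hessAvg_sub_hessAvg_of_kernel_le hv hP hP' hR hδs hs x kk i j
    fun y hy => hN' y (hball y hy) i j
  have f6 := abs_integral_bump_sub_le hP hP' hR hδs kk
  have f7 := hN' x (hball x (by simp; positivity)) i j
  rw [← hs_def] at f3 f4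
  set m := ∫ z, bump P z
  set m' := ∫ z, bump P' z
  have f8 : |(m - m') * pd2 d v x i j| ≤ K * (δ * s ^ α) * volBall d R * N := by
    rw [abs_mul]; gcongr
  have hm : 0 ≤ m := by nlinarith
  have f4' : t⁻¹ * (K * (d * N * s) * volBall d R) ≤ d * e * (t ^ (-α) * N * s ^ α) := by
    have : t⁻¹ * s ≤ t ^ (-α) * s ^ α := by
      calc t⁻¹ * s = t⁻¹ * (s ^ (1 - α) * s ^ α) := by
            rw [← Real.rpow_add hs]; simp
        _ ≤ t⁻¹ * (t ^ (1 - α) * s ^ α) := by gcongr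
        _ = (t⁻¹ * t ^ (1 - α)) * s ^ α := by ring
        _ = _ := by
          rw [← Real.rpow_neg_one t, ← Real.rpow_add ht]
          congr 2; ring
    calc _ = d * e * N * (t⁻¹ * s) := by rw [he]; ring
      _ ≤ d * e * N * (t ^ (-α) * s ^ α) := by gcongr
      _ = _ := by ring
  have tot : m * |pd2 d v x i j - pd2 d v x₀ i j| ≤
      (2 * a + b) * (H * s ^ α) + 2 * e * (δ * N * s ^ α) + d * e * (t ^ (-α) * N * s ^ α) := by
    have hid : m * (pd2 d v x i j - pd2 d v x₀ i j) =
        (m - m') * pd2 d v x i j - (hessAvg P' v x i j s - m' * pd2 d v x i j)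
        - (hessAvg P v x i j s - hessAvg P' v x i j s)
        + (hessAvg P v x₀ i j s - m * pd2 d v x₀ i j)
        - ((hessAvg P v x i j t - hessAvg P v x₀ i j t)
          - (hessAvg P v x i j s - hessAvg P v x₀ i j s))
        + (hessAvg P v x i j t - hessAvg P v x₀ i j t) := by ring
    have hkN : K * (δ * s ^ α) * volBall d R * N = e * (δ * N * s ^ α) := by rw [he]; ring
    have hkN' : K * (δ * s ^ α) * N * volBall d R = e * (δ * N * s ^ α) := by rw [he]; ring
    rw [hkN] at f8
    rw [hkN'] at f5
    have hmul : m * |pd2 d v x i j - pd2 d v x₀ i j|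
        = |m * (pd2 d v x i j - pd2 d v x₀ i j)| := by rw [abs_mul, abs_of_nonneg hm]
    rw [hmul, hid]
    rw [abs_le] at *
    constructor <;> linarith [f1.1, f1.2, f2.1, f2.2, f3.1, f3.2, f4.1, f4.2, f5.1, f5.2, f8.1, f8.2]
  calc |pd2 d v x i j - pd2 d v x₀ i j| ≤ K * m * |pd2 d v x i j - pd2 d v x₀ i j| :=
        le_mul_of_one_le_left (abs_nonneg _) k5
    _ = K * (m * |pd2 d v x i j - pd2 d v x₀ i j|) := by ring
    _ ≤ K * ((2 * a + b) * (H * s ^ α) + 2 * e * (δ * N * s ^ α)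
          + d * e * (t ^ (-α) * N * s ^ α)) := by gcongr
    _ = K * (2 * a + b) * (H * s ^ α) + K * (2 * e) * (δ * N * s ^ α)
          + K * (d * e) * (t ^ (-α) * N * s ^ α) := by ring
    _ ≤ C * (H * s ^ α) + C * (δ * N * s ^ α) + C * (t ^ (-α) * N * s ^ α) := by
        gcongr <;> linarith
    _ = _ := by ring

/-- Interpolation of the gradient between the function and its Hessian. -/
lemma abs_pd1_le {d : ℕ} {v : Euc d → ℝ} (hv : ContDiff ℝ 2 v) {V N σ : ℝ} (hσ : 0 < σ)
    (hN : 0 ≤ N) (y : Euc d) (hV : ∀ z, ‖z - y‖ ≤ σ → |v z| ≤ V)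
    (h : ∀ z, ‖z - y‖ ≤ σ → ∀ i j, |pd2 d v z i j| ≤ N) (j : Fin d) :
    |pd1 d v y j| ≤ 2 * V / σ + d * σ * N := by
  have hd : Differentiable ℝ v := hv.differentiable (by simp)
  have hg : ∀ τ : ℝ, HasDerivAt (fun τ : ℝ => v (y + τ • stdVec j))
      (pd1 d v (y + τ • stdVec j) j) τ := fun τ => by
    have h1 : HasDerivAt (fun τ : ℝ => y + τ • (stdVec j : Euc d)) (stdVec j) τ := by
      simpa using ((hasDerivAt_id τ).smul_const (stdVec j : Euc d)).const_add y
    exact (hd _).hasFDerivAt.comp_hasDerivAt τ h1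
  obtain ⟨τ, hτ, he⟩ := exists_hasDerivAt_eq_slope (fun τ : ℝ => v (y + τ • stdVec j))
    (fun τ => pd1 d v (y + τ • stdVec j) j) hσ
    (fun τ _ => (hg τ).continuousAt.continuousWithinAt) (fun τ _ => hg τ)
  have hn : ∀ τ : ℝ, 0 ≤ τ → ‖y + τ • (stdVec j : Euc d) - y‖ = τ := fun τ hτ => by
    rw [add_sub_cancel_left, norm_smul, norm_stdVec, mul_one, Real.norm_of_nonneg hτ]
  have h2 := abs_sub_le_of_partial_le ((contDiff_pd1 hv j).differentiable (by simp)) hN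
    (convex_closedBall y σ) (x := y + τ • stdVec j) (y := y) (fun z hz i => by
      rw [fderiv_pd1]; exact h z (by simpa [dist_eq_norm] using hz) i j)
    (by rw [mem_closedBall, dist_eq_norm, hn τ hτ.1.le]; exact hτ.2.le)
    (mem_closedBall_self hσ.le)
  rw [norm_sub_rev, hn τ hτ.1.le] at h2
  have h3 : |pd1 d v (y + τ • stdVec j) j| ≤ 2 * V / σ := by
    rw [he, sub_zero, abs_div, abs_of_pos hσ]
    gcongr
    have a1 := hV (y + σ • stdVec j) (hn σ hσ.le).le
    have a2 := hV (y + (0 : ℝ) • stdVec j) (by simpa using hσ.le)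
    exact (abs_sub _ _).trans (by linarith)
  have h4 : d * N * τ ≤ d * σ * N := by
    rw [mul_right_comm]
    have := hτ.2.le
    gcongr
  have h5 := abs_sub_abs_le_abs_sub (pd1 d v y j) (pd1 d v (y + τ • stdVec j) j)
  linarith

/-- Half of the symmetric part of `a`. -/
def halfSymm {d : ℕ} (a : Fin d → Fin d → ℝ) : Matrix (Fin d) (Fin d) ℝ :=
  Matrix.of fun k l => (a k l + a l k) / 4

/-- The kernel matrix of the operator with coefficients `a`. -/
def kernelOf {d : ℕ} (a : Fin d → Fin d → ℝ) : Fin d → Fin d → ℝ := fun i j => (halfSymm a)⁻¹ i j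

/-- Boundedness and uniform ellipticity of a (not necessarily symmetric) matrix. -/
structure IsElliptic {d : ℕ} (c : ℝ) (a : Fin d → Fin d → ℝ) : Prop where
  bound : ∀ i j, |a i j| ≤ c
  elliptic : ∀ ξ : Fin d → ℝ, (1 / c) * ∑ i, ξ i ^ 2 ≤ ∑ i, ∑ j, ξ i * a i j * ξ j

section
variable {d : ℕ} {c : ℝ} {a : Fin d → Fin d → ℝ}

lemma halfSymm_dotProduct (a : Fin d → Fin d → ℝ) (ξ : Fin d → ℝ) :
    dotProduct ξ ((halfSymm a).mulVec ξ) = (1 / 2) * ∑ i, ∑ j, ξ i * a i j * ξ j := by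
  simp only [dotProduct, Matrix.mulVec, halfSymm, Matrix.of_apply, Finset.mul_sum]
  have h : ∑ i, ∑ j, ξ i * a j i * ξ j = ∑ i, ∑ j, ξ i * a i j * ξ j := by
    rw [Finset.sum_comm]
    exact Finset.sum_congr rfl fun i _ => Finset.sum_congr rfl fun j _ => by ring
  have e : ∀ i j, ξ i * ((a i j + a j i) / 4 * ξ j)
      = (1 / 4) * (ξ i * a i j * ξ j) + (1 / 4) * (ξ i * a j i * ξ j) := fun i j => by ring
  simp only [e, Finset.sum_add_distrib, ← Finset.mul_sum, h]
  ring

lemma IsElliptic.dotProduct_ge (ha : IsElliptic c a) (ξ : Fin d → ℝ) :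
    (1 / (2 * c)) * dotProduct ξ ξ ≤ dotProduct ξ ((halfSymm a).mulVec ξ) := by
  rw [halfSymm_dotProduct]
  have := ha.elliptic ξ
  have e : dotProduct ξ ξ = ∑ i, ξ i ^ 2 := by simp only [dotProduct, sq]
  calc (1 / (2 * c)) * dotProduct ξ ξ = (1 / 2) * ((1 / c) * ∑ i, ξ i ^ 2) := by rw [e]; ring
    _ ≤ _ := by gcongr

lemma IsElliptic.isUnit_det (ha : IsElliptic c a) (hc : 0 < c) : IsUnit (halfSymm a).det := by
  rw [isUnit_iff_ne_zero]
  intro h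
  obtain ⟨w, hw, hw0⟩ := Matrix.exists_mulVec_eq_zero_iff.2 h
  have h1 := ha.dotProduct_ge w
  rw [hw0, dotProduct_zero] at h1
  have h2 : 0 < dotProduct w w := by
    refine lt_of_le_of_ne (Finset.sum_nonneg fun i _ => mul_self_nonneg (w i)) ?_
    exact fun h => hw (dotProduct_self_eq_zero.1 h.symm)
  have : 0 < (1 / (2 * c)) * dotProduct w w := by positivity
  linarith

lemma IsElliptic.halfSymm_mul_inv (ha : IsElliptic c a) (hc : 0 < c) (k j : Fin d) :
    ∑ l, halfSymm a k l * kernelOf a l j = if k = j then 1 else 0 := by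
  have := congrFun (congrFun (Matrix.mul_nonsing_inv _ (ha.isUnit_det hc)) k) j
  rw [Matrix.mul_apply, Matrix.one_apply] at this
  exact this

lemma halfSymm_transpose (a : Fin d → Fin d → ℝ) : (halfSymm a).transpose = halfSymm a := by
  ext i j
  simp [halfSymm, add_comm]

lemma kernelOf_comm (a : Fin d → Fin d → ℝ) (i j : Fin d) : kernelOf a i j = kernelOf a j i := by
  have := congrFun (congrFun (Matrix.transpose_nonsing_inv (halfSymm a)) i) j
  rw [halfSymm_transpose] at this
  exact this.symm

lemma IsElliptic.abs_halfSymm_le (ha : IsElliptic c a) (i j : Fin d) : |halfSymm a i j| ≤ c / 2 := by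
  have h1 := abs_le.1 (ha.bound i j)
  have h2 := abs_le.1 (ha.bound j i)
  rw [halfSymm, Matrix.of_apply, abs_le]
  constructor <;> linarith [h1.1, h1.2, h2.1, h2.2]

lemma IsElliptic.abs_kernelOf_le (ha : IsElliptic c a) (hc : 0 < c) (i j : Fin d) :
    |kernelOf a i j| ≤ 2 * c := by
  set w : Fin d → ℝ := fun i => kernelOf a i j with hw
  have hw1 : (halfSymm a).mulVec w = fun k => if k = j then 1 else 0 := by
    ext k
    exact ha.halfSymm_mul_inv hc k j
  have h1 := ha.dotProduct_ge w
  rw [hw1] at h1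
  have h2 : dotProduct w (fun k => if k = j then (1 : ℝ) else 0) = w j := by simp [dotProduct]
  rw [h2] at h1
  have h3 : ∀ k, w k ^ 2 ≤ dotProduct w w := fun k => by
    simp only [dotProduct, ← sq]
    exact Finset.single_le_sum (f := fun k => w k ^ 2) (fun _ _ => sq_nonneg _) (Finset.mem_univ k)
  have h4 : dotProduct w w ≤ 2 * c * w j := by
    rw [one_div_mul_eq_div, div_le_iff₀ (by positivity)] at h1
    linarith
  have hj : |w j| ≤ 2 * c := by
    rw [abs_le]
    constructor <;> nlinarith [h3 j]
  refine abs_le_of_sq_le_sq ?_ (by positivity)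
  calc kernelOf a i j ^ 2 ≤ 2 * c * w j := (h3 i).trans h4
    _ ≤ 2 * c * (2 * c) := by gcongr; exact (abs_le.1 hj).2
    _ = (2 * c) ^ 2 := by ring

lemma IsElliptic.kernelMatrix (ha : IsElliptic c a) (hc : 1 ≤ c) :
    KernelMatrix (1 + 2 * d ^ 3 * c ^ 3) (2 * c) (kernelOf a) := by
  have hc0 : 0 < c := by linarith
  refine ⟨kernelOf_comm a, ha.abs_kernelOf_le hc0, fun z => ?_⟩
  set w : Fin d → ℝ := qLin (kernelOf a) z with hw
  have hz : ∀ k, z k = ∑ l, halfSymm a k l * w l := fun k => by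
    have : ∑ l, halfSymm a k l * w l = ∑ j, (∑ l, halfSymm a k l * kernelOf a l j) * z j := by
      simp only [hw, qLin, Finset.mul_sum, Finset.sum_mul]
      rw [Finset.sum_comm]
      exact Finset.sum_congr rfl fun i _ => Finset.sum_congr rfl fun j _ => by ring
    rw [this]
    simp [ha.halfSymm_mul_inv hc0]
  have hq : qForm (kernelOf a) z = (1 / 2) * dotProduct w ((halfSymm a).mulVec w) := by
    rw [qForm]
    congr 1
    refine Finset.sum_congr rfl fun i _ => ?_
    rw [hz i, mul_comm]
    rfl
  have h1 := ha.dotProduct_ge w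
  rw [one_div_mul_eq_div, div_le_iff₀ (by positivity)] at h1
  set W := dotProduct w w with hW
  have hW0 : 0 ≤ W := Finset.sum_nonneg fun i _ => mul_self_nonneg (w i)
  have h2 : ∀ k, z k ^ 2 ≤ d ^ 2 * c ^ 2 / 4 * W := fun k => by
    have h3 : |z k| ≤ d * (c / 2 * √W) := by
      rw [hz k]
      refine (Finset.abs_sum_le_sum_abs _ _).trans ?_
      refine (Finset.sum_le_sum (g := fun _ => c / 2 * √W) fun l _ => ?_).trans_eq (by simp)
      rw [abs_mul]
      have : |w l| ≤ √W := Real.abs_le_sqrt (by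
        simp only [hW, dotProduct, ← sq]
        exact Finset.single_le_sum (f := fun k => w k ^ 2) (fun _ _ => sq_nonneg _)
          (Finset.mem_univ l))
      have := ha.abs_halfSymm_le k l
      gcongr
    calc z k ^ 2 = |z k| ^ 2 := (sq_abs _).symm
      _ ≤ (d * (c / 2 * √W)) ^ 2 := by gcongr
      _ = _ := by rw [mul_pow, mul_pow, Real.sq_sqrt hW0]; ring
  have h4 : ‖z‖ ^ 2 ≤ d * (d ^ 2 * c ^ 2 / 4 * W) := by
    rw [EuclideanSpace.real_norm_sq_eq]
    exact (Finset.sum_le_sum fun i _ => h2 i).trans_eq (by simp)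
  have h5 : W ≤ 4 * c * qForm (kernelOf a) z := by rw [hq]; linarith
  have hQ : 0 ≤ qForm (kernelOf a) z := by
    by_contra hneg
    have : c * qForm (kernelOf a) z < 0 := mul_neg_of_pos_of_neg hc0 (by linarith)
    linarith
  have hd3 : 0 ≤ 2 * (d : ℝ) ^ 3 * c ^ 3 := by positivity
  calc 2 * ‖z‖ ^ 2 ≤ 2 * (d * (d ^ 2 * c ^ 2 / 4 * (4 * c * qForm (kernelOf a) z))) := by
        gcongr
        exact h4.trans (by gcongr)
    _ = 2 * d ^ 3 * c ^ 3 * qForm (kernelOf a) z := by ring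
    _ ≤ _ := by
        gcongr
        nlinarith

lemma IsElliptic.abs_kernelOf_sub_le {a' : Fin d → Fin d → ℝ} (ha : IsElliptic c a)
    (ha' : IsElliptic c a') (hc : 0 < c) {δ : ℝ} (h : ∀ i j, |a i j - a' i j| ≤ δ) (i j : Fin d) :
    |kernelOf a i j - kernelOf a' i j| ≤ 2 * d ^ 2 * c ^ 2 * δ := by
  have h1 : (halfSymm a)⁻¹ - (halfSymm a')⁻¹
      = (halfSymm a)⁻¹ * ((halfSymm a' - halfSymm a) * (halfSymm a')⁻¹) := by
    rw [sub_mul, mul_sub, Matrix.mul_nonsing_inv _ (ha'.isUnit_det hc), ← mul_assoc,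
      Matrix.nonsing_inv_mul _ (ha.isUnit_det hc), mul_one, one_mul]
  have h2 : kernelOf a i j - kernelOf a' i j = ∑ k, ∑ l, kernelOf a i k *
      ((halfSymm a' k l - halfSymm a k l) * kernelOf a' l j) := by
    have := congrFun (congrFun h1 i) j
    simp only [Matrix.sub_apply, Matrix.mul_apply, Finset.mul_sum] at this
    exact this
  rw [h2]
  have h3 : ∀ k l, |kernelOf a i k * ((halfSymm a' k l - halfSymm a k l) * kernelOf a' l j)|
      ≤ 2 * c * (δ / 2 * (2 * c)) := fun k l => by
    have h4 : |halfSymm a' k l - halfSymm a k l| ≤ δ / 2 := by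
      have h1 := abs_le.1 (h k l)
      have h2 := abs_le.1 (h l k)
      rw [halfSymm, halfSymm, Matrix.of_apply, Matrix.of_apply, abs_le]
      constructor <;> linarith [h1.1, h1.2, h2.1, h2.2]
    have h5 := ha.abs_kernelOf_le hc i k
    have h6 := ha'.abs_kernelOf_le hc l j
    have : 0 ≤ δ := (abs_nonneg _).trans (h k l)
    rw [abs_mul, abs_mul]
    gcongr
  calc _ ≤ ∑ k : Fin d, ∑ l : Fin d, 2 * c * (δ / 2 * (2 * c)) := by
        refine (Finset.abs_sum_le_sum_abs _ _).trans (Finset.sum_le_sum fun k _ => ?_)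
        exact (Finset.abs_sum_le_sum_abs _ _).trans (Finset.sum_le_sum fun l _ => h3 k l)
    _ = _ := by simp; ring

lemma secondOrder_halfSymm {v : Euc d → ℝ} (hv : ContDiff ℝ 2 v) (a : Fin d → Fin d → ℝ)
    (y : Euc d) :
    secondOrder (fun k l => halfSymm a k l) v y = (1 / 2) * ∑ i, ∑ j, a i j * pd2 d v y j i := by
  have h : ∑ i, ∑ j, a j i * pd2 d v y j i = ∑ i, ∑ j, a i j * pd2 d v y j i := by
    rw [Finset.sum_comm]
    exact Finset.sum_congr rfl fun i _ => Finset.sum_congr rfl fun j _ => by rw [pd2_comm hv]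
  have e : ∀ i j, halfSymm a i j * pd2 d v y j i
      = (1 / 4) * (a i j * pd2 d v y j i) + (1 / 4) * (a j i * pd2 d v y j i) := fun i j => by
    simp only [halfSymm, Matrix.of_apply]; ring
  simp only [secondOrder, e, Finset.sum_add_distrib, ← Finset.mul_sum, h]
  ring

end

/-- A solution `v` of the linear equation `ρ v - f - b · Dv - tr (a D²v) / 2 = 0` with coefficients
that are controlled by `M` at scales below `ρ ^ (-1/2)`. -/
structure LinearSolution {d : ℕ} (α M ρ : ℝ) (v f : Euc d → ℝ) (b : Euc d → Fin d → ℝ)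
    (a : Euc d → Fin d → Fin d → ℝ) : Prop where
  contDiff : ContDiff ℝ 2 v
  abs_le : ∀ x, |v x| ≤ M / ρ
  elliptic : ∀ x, IsElliptic M (a x)
  abs_drift : ∀ x i, |b x i| ≤ M
  holder_source : ∀ x y, ‖y - x‖ ≤ ρ ^ (-1 / 2 : ℝ) → |f y - f x| ≤ M * ‖y - x‖ ^ α
  holder_drift : ∀ x y, ‖y - x‖ ≤ ρ ^ (-1 / 2 : ℝ) → ∀ i, |b y i - b x i| ≤ M * ‖y - x‖ ^ α
  holder_matrix : ∀ x y, ‖y - x‖ ≤ ρ ^ (-1 / 2 : ℝ) →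
    ∀ i j, |a y i j - a x i j| ≤ M * ‖y - x‖ ^ α
  equation : ∀ x, ρ * v x - f x - ∑ i, b x i * pd1 d v x i
    - (1 / 2) * ∑ i, ∑ j, a x i j * pd2 d v x j i = 0

section
variable {d : ℕ} {α M ρ : ℝ} {v f : Euc d → ℝ} {b : Euc d → Fin d → ℝ}
  {a : Euc d → Fin d → Fin d → ℝ}

lemma abs_sum_le_mul {F : Fin d → ℝ} {B : ℝ} (h : ∀ i, |F i| ≤ B) : |∑ i, F i| ≤ d * B :=
  (Finset.abs_sum_le_sum_abs _ _).trans ((Finset.sum_le_sum fun i _ => h i).trans_eq (by simp))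

lemma abs_sum_sum_le_mul {F : Fin d → Fin d → ℝ} {B : ℝ} (h : ∀ i j, |F i j| ≤ B) :
    |∑ i, ∑ j, F i j| ≤ d ^ 2 * B :=
  (abs_sum_le_mul fun i => abs_sum_le_mul (h i)).trans_eq (by ring)

/-- Hölder bound for the operator frozen at `x`. -/
lemma LinearSolution.abs_secondOrder_sub_le (S : LinearSolution α M ρ v f b a) (hα : 0 < α)
    (hα1 : α < 1) (hM : 1 ≤ M) (hρ : 1 ≤ ρ) {κ D N : ℝ} (hκ : κ ≤ ρ ^ (-1 / 2 : ℝ))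
    (hN : 0 ≤ N) {x y : Euc d} (hy : ‖y - x‖ ≤ κ)
    (hDx : ∀ z, ‖z - x‖ ≤ κ → ∀ i, |pd1 d v z i| ≤ D)
    (hNx : ∀ z, ‖z - x‖ ≤ κ → ∀ i j, |pd2 d v z i j| ≤ N) :
    |secondOrder (fun k l => halfSymm (a x) k l) v y
        - secondOrder (fun k l => halfSymm (a x) k l) v x|
      ≤ (M + d * (1 + M) * (ρ ^ ((1 + α) / 2) * D) + 2 * d ^ 2 * M * N) * ‖y - x‖ ^ α := by
  set s := ‖y - x‖ with hs
  have hs0 : 0 ≤ s := norm_nonneg _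
  have hκ0 : 0 ≤ κ := hs0.trans hy
  have hsρ := hy.trans hκ
  have hρ0 : 0 < ρ := by linarith
  have hx : ‖x - x‖ ≤ κ := by simpa using hκ0
  have hs1 : s ≤ 1 := hsρ.trans (Real.rpow_le_one_of_one_le_of_nonpos hρ (by norm_num))
  have hsα : s ≤ s ^ α := by
    calc s = s ^ (1 : ℝ) := (Real.rpow_one s).symm
      _ ≤ s ^ α := Real.rpow_le_rpow_of_exponent_ge' hs0 hs1 hα.le hα1.le
  have hsα0 : 0 ≤ s ^ α := by positivity
  have hsρα : ρ * s ≤ ρ ^ ((1 + α) / 2) * s ^ α := by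
    calc ρ * s = ρ * (s ^ (1 - α) * s ^ α) := by
          rw [← Real.rpow_add' hs0 (by simp)]; simp
      _ ≤ ρ * ((ρ ^ (-1 / 2 : ℝ)) ^ (1 - α) * s ^ α) := by
          have : 0 ≤ 1 - α := by linarith
          gcongr
      _ = (ρ ^ (1 : ℝ) * ρ ^ (-1 / 2 * (1 - α) : ℝ)) * s ^ α := by
          rw [← Real.rpow_mul hρ0.le, Real.rpow_one]; ring
      _ = _ := by
          rw [← Real.rpow_add hρ0]
          congr 2; ring
  have hball : closedBall x κ ⊆ {z | ‖z - x‖ ≤ κ} := fun z hz => by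
    simpa [dist_eq_norm] using hz
  have hxm : x ∈ closedBall x κ := mem_closedBall_self hκ0
  have hym : y ∈ closedBall x κ := by rw [mem_closedBall, dist_eq_norm]; exact hy
  rcases Nat.eq_zero_or_pos d with rfl | hd
  · have : y = x := Subsingleton.elim _ _
    rw [this]; simp only [sub_self, abs_zero]
    have : 0 ≤ M := by linarith
    simp only [CharP.cast_eq_zero, ne_eq, OfNat.ofNat_ne_zero, not_false_eq_true, zero_pow,
      zero_mul, add_zero]
    positivity
  have hD : 0 ≤ D := (abs_nonneg _).trans (hDx x hx ⟨0, hd⟩)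
  have e1 : |v y - v x| ≤ d * D * s := abs_sub_le_of_partial_le
    (S.contDiff.differentiable (by simp)) hD (convex_closedBall x κ)
    (fun z hz i => hDx z (hball hz) i) hxm hym
  have e2 : ∀ i, |pd1 d v y i - pd1 d v x i| ≤ d * N * s := fun i => abs_sub_le_of_partial_le
    ((contDiff_pd1 S.contDiff i).differentiable (by simp)) hN (convex_closedBall x κ)
    (fun z hz j => hNx z (hball hz) j i) hxm hym
  have e3 : |∑ i, (b y i * pd1 d v y i - b x i * pd1 d v x i)|
      ≤ d * (M * (d * N * s) + M * s ^ α * D) := by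
    refine abs_sum_le_mul fun i => ?_
    have : b y i * pd1 d v y i - b x i * pd1 d v x i
        = b y i * (pd1 d v y i - pd1 d v x i) + (b y i - b x i) * pd1 d v x i := by ring
    rw [this]
    refine (abs_add_le _ _).trans ?_
    rw [abs_mul, abs_mul]
    have h1 := S.abs_drift y i
    have h2 := S.holder_drift x y hsρ i
    have h3 := hDx x hx i
    have h4 := e2 i
    gcongr
  have e4 : |∑ i, ∑ j, (a y i j - a x i j) * pd2 d v y j i| ≤ d ^ 2 * (M * s ^ α * N) := by
    refine abs_sum_sum_le_mul fun i j => ?_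
    rw [abs_mul]
    have h2 := S.holder_matrix x y hsρ i j
    have h3 := hNx y hy j i
    gcongr
  have e5 := S.holder_source x y hsρ
  have hid : secondOrder (fun k l => halfSymm (a x) k l) v y
        - secondOrder (fun k l => halfSymm (a x) k l) v x
      = ρ * (v y - v x) - (f y - f x) - (∑ i, (b y i * pd1 d v y i - b x i * pd1 d v x i))
        - (1 / 2) * ∑ i, ∑ j, (a y i j - a x i j) * pd2 d v y j i := by
    rw [secondOrder_halfSymm S.contDiff, secondOrder_halfSymm S.contDiff]
    have h1 := S.equation x
    have h2 := S.equation y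
    simp only [sub_mul, Finset.sum_sub_distrib]
    linarith
  rw [hid]
  have e1' : |ρ * (v y - v x)| ≤ d * (ρ ^ ((1 + α) / 2) * D) * s ^ α := by
    rw [abs_mul, abs_of_pos hρ0]
    calc ρ * |v y - v x| ≤ ρ * (d * D * s) := by gcongr
      _ = d * D * (ρ * s) := by ring
      _ ≤ d * D * (ρ ^ ((1 + α) / 2) * s ^ α) := by gcongr
      _ = _ := by ring
  have hM0 : 0 ≤ M := by linarith
  have e3' : d * (M * (d * N * s) + M * s ^ α * D)
      ≤ (d * M * (ρ ^ ((1 + α) / 2) * D) + d ^ 2 * M * N) * s ^ α := by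
    calc d * (M * (d * N * s) + M * s ^ α * D)
        ≤ d * (M * (d * N * s ^ α) + M * s ^ α * (ρ ^ ((1 + α) / 2) * D)) := by
          gcongr
          exact le_mul_of_one_le_left hD (Real.one_le_rpow hρ (by linarith))
      _ = _ := by ring
  have e4' : 0 ≤ d ^ 2 * (M * s ^ α * N) := by positivity
  rw [_root_.abs_le] at *
  constructor <;> nlinarith [e1'.1, e1'.2, e3.1, e3.2, e4.1, e4.2, e5.1, e5.2]

end

/-- A nonnegative function with a self-improving bound at all scales is bounded. -/
lemma le_of_forall_scale_le {E : Type*} [NormedAddCommGroup E] [CompleteSpace E] {g : E → ℝ}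
    (hg : Continuous g) {G c r₀ : ℝ} (hG : 0 ≤ G) (hr₀ : 0 < r₀)
    (h : ∀ x r N, 0 < r → r ≤ r₀ → (∀ y, ‖y - x‖ ≤ c * r → g y ≤ N) → g x ≤ G / r ^ 2 + N / 8)
    (x : E) : g x ≤ 2 * G / r₀ ^ 2 := by
  by_contra! hx
  have step : ∀ (k : ℕ) (x : E), 2 * G / (r₀ / 2 ^ k) ^ 2 < g x →
      ∃ y, ‖y - x‖ ≤ c * (r₀ / 2 ^ k) ∧ 4 * g x < g y := by
    intro k x hx
    by_contra! hcon
    have := h x (r₀ / 2 ^ k) (4 * g x) (by positivity)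
      (div_le_self hr₀.le (one_le_pow₀ (by norm_num))) hcon
    rw [mul_div_assoc] at hx
    linarith
  let T := fun k : ℕ => {x : E // 2 * G / (r₀ / 2 ^ k) ^ 2 < g x}
  have step' : ∀ (k : ℕ) (x : T k), ∃ y : T (k + 1),
      ‖(y : E) - x‖ ≤ c * (r₀ / 2 ^ k) ∧ 4 * g x < g y := by
    rintro k ⟨x, hx⟩
    obtain ⟨y, hy1, hy2⟩ := step k x hx
    refine ⟨⟨y, lt_of_eq_of_lt ?_ ((mul_lt_mul_of_pos_left hx (by norm_num)).trans hy2)⟩, hy1, hy2⟩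
    field_simp
    ring
  choose F hF1 hF2 using step'
  let X : ∀ k, T k := fun k => Nat.rec ⟨x, by simpa using hx⟩ (fun k y => F k y) k
  have hX1 : ∀ k, ‖(X (k + 1)).1 - (X k).1‖ ≤ c * (r₀ / 2 ^ k) := fun k => hF1 k (X k)
  have hX2 : ∀ k, 4 * g (X k).1 < g (X (k + 1)).1 := fun k => hF2 k (X k)
  have hpos : 0 < g x := lt_of_le_of_lt (by positivity) hx
  have hX3 : ∀ k : ℕ, 4 ^ k * g x ≤ g (X k).1 := by
    intro k
    induction k with
    | zero => simp [X]
    | succ k ih => rw [pow_succ]; linarith [hX2 k]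
  have hcs : CauchySeq fun k => (X k).1 := by
    refine cauchySeq_of_le_geometric (1 / 2) (c * r₀) (by norm_num) fun k => ?_
    rw [dist_comm, dist_eq_norm]
    refine (hX1 k).trans_eq ?_
    rw [one_div, inv_pow]; ring
  obtain ⟨y, hy⟩ := cauchySeq_tendsto_of_complete hcs
  have h1 := (hg.tendsto y).comp hy
  have h2 : Filter.Tendsto (fun k : ℕ => (4 : ℝ) ^ k * g x) Filter.atTop Filter.atTop :=
    (tendsto_pow_atTop_atTop_of_one_lt (by norm_num)).atTop_mul_const hpos
  exact not_tendsto_nhds_of_tendsto_atTop (Filter.tendsto_atTop_mono hX3 h2) _ h1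

/-- The radius of the kernels attached to elliptic matrices. -/
def kernelRadius (d : ℕ) (M : ℝ) : ℝ := 1 + 2 * d ^ 3 * M ^ 3

lemma one_le_kernelRadius (d : ℕ) {M : ℝ} (hM : 1 ≤ M) : 1 ≤ kernelRadius d M := by
  have : 0 ≤ 2 * (d : ℝ) ^ 3 * M ^ 3 := by positivity
  rw [kernelRadius]; linarith

lemma rpow_neg_half_sq {ρ : ℝ} (hρ : 0 < ρ) : (ρ ^ (-1 / 2 : ℝ)) ^ 2 = ρ⁻¹ := by
  rw [← Real.rpow_natCast, ← Real.rpow_mul hρ.le, ← Real.rpow_neg_one]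
  norm_num

/-- The Hessian of a solution at a point in terms of its supremum nearby, at all small scales. -/
lemma exists_abs_pd2_le_scale (d : ℕ) {α M : ℝ} (hα : 0 < α) (hα1 : α < 1) (hM : 1 ≤ M) :
    ∃ C : ℝ, 1 ≤ C ∧ ∀ (ρ : ℝ) (v f : Euc d → ℝ) (b : Euc d → Fin d → ℝ)
      (a : Euc d → Fin d → Fin d → ℝ), 1 ≤ ρ → LinearSolution α M ρ v f b a →
      ∀ (x : Euc d) (t η N : ℝ), 0 < t → t ≤ ρ ^ (-1 / 2 : ℝ) / (kernelRadius d M + 1) → 0 < η →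
      η ≤ 1 → 0 ≤ N →
      (∀ y, ‖y - x‖ ≤ (kernelRadius d M + 1) * t → ∀ i j, |pd2 d v y i j| ≤ N) →
      ∀ i j, |pd2 d v x i j| ≤ C * ((1 + 1 / η) / (ρ * t ^ 2) + (η + ρ ^ (-α / 2)) * N) := by
  have hR1 := one_le_kernelRadius d hM
  set R := kernelRadius d M with hR
  have hR0 : 0 < R := by linarith
  obtain ⟨C, hC1, hC⟩ := exists_abs_pd2_le d (Λ := 2 * M) hR0 (by positivity) hα
  have hM0 : 0 ≤ M := by linarith
  set k := d * (1 + M) + 1 with hk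
  have hk0 : 0 ≤ k := by positivity
  set T := C * (1 + M + k * (2 * M) + k * d + 2 * d ^ 2 * M) with hT
  have hT1 : C * M ≤ T := by
    rw [hT]; gcongr
    have : 0 ≤ 1 + k * (2 * M) + k * d + 2 * d ^ 2 * M := by positivity
    linarith
  have hT2 : C * (k * (2 * M)) ≤ T := by
    rw [hT]; gcongr
    have : 0 ≤ 1 + M + k * d + 2 * d ^ 2 * M := by positivity
    linarith
  have hT3 : C * (k * d) ≤ T := by
    rw [hT]; gcongr
    have : 0 ≤ 1 + M + k * (2 * M) + 2 * d ^ 2 * M := by positivity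
    linarith
  have hT4 : C * (2 * d ^ 2 * M) ≤ T := by
    rw [hT]; gcongr
    have : 0 ≤ 1 + M + k * (2 * M) + k * d := by positivity
    linarith
  refine ⟨T, ?_, ?_⟩
  · have : 0 ≤ M + k * (2 * M) + k * d + 2 * d ^ 2 * M := by positivity
    nlinarith
  intro ρ v f b a hρ S x t η N ht ht0 hη hη1 hN hNx i j
  have hρ0 : 0 < ρ := by linarith
  set q := ρ ^ (-1 / 2 : ℝ) with hq
  have hq0 : 0 < q := by positivity
  rw [le_div_iff₀ (by linarith)] at ht0
  have hRt : R * t ≤ q := by nlinarith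
  have htq : t ≤ q := by nlinarith
  have hRt' : R * t ≤ (R + 1) * t := by nlinarith
  set D := 2 * (M / ρ) / (η * t) + d * (η * t) * N with hD_def
  have hD0 : 0 ≤ D := by positivity
  have hD : ∀ y, ‖y - x‖ ≤ R * t → ∀ j, |pd1 d v y j| ≤ D := fun y hy j => by
    refine abs_pd1_le S.contDiff (mul_pos hη ht) hN y (fun z _ => S.abs_le z) (fun z hz => ?_) j
    refine hNx z ?_
    have h1 := norm_add_le (z - y) (y - x)
    rw [sub_add_sub_cancel] at h1
    nlinarith
  have hH := fun y (hy : ‖y - x‖ ≤ R * t) => S.abs_secondOrder_sub_le hα hα1 hM hρ hRt hN hy hD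
    (fun z hz => hNx z (hz.trans hRt'))
  set p := ρ ^ ((1 + α) / 2) with hp
  have hmain := hC v _ _ x t (M + d * (1 + M) * (p * D) + 2 * d ^ 2 * M * N) D _ S.contDiff
    ((S.elliptic x).kernelMatrix hM) ((S.elliptic x).halfSymm_mul_inv (by linarith)) ht
    (by positivity) hH hD i j
  have htα : t ^ α ≤ ρ ^ (-α / 2) := by
    calc t ^ α ≤ q ^ α := by gcongr
      _ = _ := by rw [hq, ← Real.rpow_mul hρ0.le]; congr 1; ring
  have htα1 : t ^ α ≤ 1 := htα.trans (Real.rpow_le_one_of_one_le_of_nonpos hρ (by linarith))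
  have hpt : p * t ^ α ≤ t⁻¹ := by
    calc p * t ^ α ≤ p * ρ ^ (-α / 2) := by gcongr
      _ = q⁻¹ := by
        rw [hp, ← Real.rpow_add hρ0, hq, ← Real.rpow_neg hρ0.le]; congr 1; ring
      _ ≤ t⁻¹ := by gcongr
  have hρt : ρ * t ^ 2 ≤ 1 := by
    calc ρ * t ^ 2 ≤ ρ * q ^ 2 := by gcongr
      _ = 1 := by rw [hq, rpow_neg_half_sq hρ0]; field_simp
  have hρt0 : 0 < ρ * t ^ 2 := by positivity
  have htD : t⁻¹ * D = 2 * M * (1 / η / (ρ * t ^ 2)) + d * (η * N) := by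
    rw [hD_def]; field_simp
  have h1 : (M + d * (1 + M) * (p * D) + 2 * d ^ 2 * M * N) * t ^ α
      ≤ M * (1 / (ρ * t ^ 2)) + d * (1 + M) * (t⁻¹ * D)
        + 2 * d ^ 2 * M * (ρ ^ (-α / 2) * N) := by
    have : (1 : ℝ) ≤ 1 / (ρ * t ^ 2) := (one_le_div hρt0).2 hρt
    calc _ = M * t ^ α + d * (1 + M) * (p * t ^ α * D) + 2 * d ^ 2 * M * (t ^ α * N) := by ring
      _ ≤ _ := by
        gcongr
        linarith
  have hX0 : 0 ≤ 1 / (ρ * t ^ 2) := by positivity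
  have hY0 : 0 ≤ 1 / η / (ρ * t ^ 2) := by positivity
  calc |pd2 d v x i j| ≤ _ := hmain
    _ ≤ C * (M * (1 / (ρ * t ^ 2)) + d * (1 + M) * (t⁻¹ * D)
        + 2 * d ^ 2 * M * (ρ ^ (-α / 2) * N) + t⁻¹ * D) := by gcongr
    _ = C * M * (1 / (ρ * t ^ 2)) + C * (k * (2 * M)) * (1 / η / (ρ * t ^ 2))
        + C * (k * d) * (η * N) + C * (2 * d ^ 2 * M) * (ρ ^ (-α / 2) * N) := by
      rw [htD, hk]; ring
    _ ≤ T * (1 / (ρ * t ^ 2)) + T * (1 / η / (ρ * t ^ 2)) + T * (η * N)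
        + T * (ρ ^ (-α / 2) * N) := by gcongr
    _ = _ := by ring

/-- Global bound for the Hessian of a solution. -/
lemma exists_abs_pd2_le_const (d : ℕ) {α M : ℝ} (hα : 0 < α) (hα1 : α < 1) (hM : 1 ≤ M) :
    ∃ C : ℝ, 1 ≤ C ∧ ∀ (ρ : ℝ) (v f : Euc d → ℝ) (b : Euc d → Fin d → ℝ)
      (a : Euc d → Fin d → Fin d → ℝ), C ≤ ρ → LinearSolution α M ρ v f b a →
      ∀ x i j, |pd2 d v x i j| ≤ C := by
  obtain ⟨C₁, hC₁, h⟩ := exists_abs_pd2_le_scale d hα hα1 hM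
  have hR1 := one_le_kernelRadius d hM
  set R := kernelRadius d M with hR
  set Q := 16 * (d ^ 2 * C₁) + 1 with hQ
  have hdC : 0 ≤ d ^ 2 * C₁ := by positivity
  have hQ1 : 1 ≤ Q := by linarith
  have hQ0 : 0 < Q := by linarith
  set G := d ^ 2 * C₁ * (1 + Q) with hG
  have hG0 : 0 ≤ G := by positivity
  refine ⟨max (Q ^ (2 / α)) (2 * G * (R + 1) ^ 2), le_max_of_le_left
    (Real.one_le_rpow hQ1 (by positivity)), ?_⟩
  intro ρ v f b a hCρ S x i j
  refine le_max_of_le_right ?_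
  have hQρ : Q ^ (2 / α) ≤ ρ := (le_max_left _ _).trans hCρ
  have hρ : 1 ≤ ρ := (Real.one_le_rpow hQ1 (by positivity)).trans hQρ
  have hρ0 : 0 < ρ := by linarith
  have hqQ : ρ ^ (-α / 2) ≤ 1 / Q := by
    have h1 : (Q ^ (2 / α)) ^ (-α / 2) = 1 / Q := by
      rw [← Real.rpow_mul hQ0.le, one_div, ← Real.rpow_neg_one]
      congr 1; field_simp
    rw [← h1]
    exact Real.rpow_le_rpow_of_nonpos (by positivity) hQρ (by linarith)
  set g : Euc d → ℝ := fun y => ∑ i, ∑ j, |pd2 d v y i j| with hg_def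
  have hcont : Continuous g := by
    have := fun i j => continuous_pd2 S.contDiff i j
    fun_prop
  have hle : ∀ y i j, |pd2 d v y i j| ≤ g y := fun y i j =>
    (Finset.single_le_sum (f := fun j => |pd2 d v y i j|) (fun _ _ => abs_nonneg _)
      (Finset.mem_univ j)).trans (Finset.single_le_sum (f := fun i => ∑ j, |pd2 d v y i j|)
        (fun _ _ => Finset.sum_nonneg fun _ _ => abs_nonneg _) (Finset.mem_univ i))
  have hscale := le_of_forall_scale_le hcont (G := G / ρ) (c := R + 1)
    (r₀ := ρ ^ (-1 / 2 : ℝ) / (R + 1)) (by positivity) (by positivity) (by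
      intro x r N hr hr0 hN
      have hN0 : 0 ≤ N := le_trans (Finset.sum_nonneg fun _ _ => Finset.sum_nonneg
        fun _ _ => abs_nonneg _) (hN x (by simp; positivity))
      have h1 := h ρ v f b a hρ S x r (1 / Q) N hr hr0 (by positivity)
        ((div_le_one hQ0).2 hQ1) hN0 fun y hy i j => (hle y i j).trans (hN y hy)
      have h2 : g x ≤ d ^ 2 * (C₁ * ((1 + 1 / (1 / Q)) / (ρ * r ^ 2)
          + (1 / Q + ρ ^ (-α / 2)) * N)) := by
        refine (le_abs_self _).trans (abs_sum_sum_le_mul fun i j => ?_)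
        rw [abs_abs]; exact h1 i j
      have h3 : d ^ 2 * C₁ * (1 / Q + 1 / Q) ≤ 1 / 8 := by
        rw [← add_div, mul_div_assoc', div_le_div_iff₀ hQ0 (by norm_num)]
        linarith
      calc g x ≤ _ := h2
        _ ≤ d ^ 2 * (C₁ * ((1 + 1 / (1 / Q)) / (ρ * r ^ 2) + (1 / Q + 1 / Q) * N)) := by gcongr
        _ = G / ρ / r ^ 2 + d ^ 2 * C₁ * (1 / Q + 1 / Q) * N := by
          rw [hG, one_div_one_div]; field_simp
        _ ≤ G / ρ / r ^ 2 + 1 / 8 * N := by gcongr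
        _ = _ := by ring) x
  refine (hle x i j).trans (hscale.trans_eq ?_)
  rw [div_pow, rpow_neg_half_sq hρ0]
  field_simp

/-- The global Schauder estimate for solutions. -/
theorem exists_schauder (d : ℕ) {α M : ℝ} (hα : 0 < α) (hα1 : α < 1) (hM : 1 ≤ M) :
    ∃ C : ℝ, 1 ≤ C ∧ ∀ (ρ : ℝ) (v f : Euc d → ℝ) (b : Euc d → Fin d → ℝ)
      (a : Euc d → Fin d → Fin d → ℝ), C ≤ ρ → LinearSolution α M ρ v f b a →
      (∀ x i, |pd1 d v x i| ≤ C * ρ ^ (-1 / 2 : ℝ)) ∧ (∀ x i j, |pd2 d v x i j| ≤ C) ∧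
      ∀ x y i j, |pd2 d v y i j - pd2 d v x i j| ≤ C * ρ ^ (α / 2) * ‖y - x‖ ^ α := by
  obtain ⟨N, hN1, hN⟩ := exists_abs_pd2_le_const d hα hα1 hM
  have hR1 := one_le_kernelRadius d hM
  set R := kernelRadius d M with hR
  have hR0 : 0 < R := by linarith
  have hM0 : 0 ≤ M := by linarith
  have hN0 : 0 ≤ N := by linarith
  obtain ⟨C, hC1, hC⟩ := exists_abs_pd2_sub_le d (Λ := 2 * M) hR0 (by positivity) hα hα1
  set D := 2 * M + d * N with hD_def
  set h₀ := M + d * (1 + M) * D + 2 * d ^ 2 * M * N with hh₀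
  set δ := 2 * d ^ 2 * M ^ 2 * M with hδ
  set T := C * (h₀ + δ * N + (R + 1) ^ α * N) with hT
  have hD0 : 0 ≤ D := by positivity
  have hh₀0 : 0 ≤ h₀ := by positivity
  have hT0 : 0 ≤ T := by positivity
  have hRα : 0 ≤ 2 * N * (R + 1) ^ α := by positivity
  refine ⟨N + D + T + 2 * N * (R + 1) ^ α, by linarith, ?_⟩
  intro ρ v f b a hρC S
  have hρN : N ≤ ρ := by linarith
  have hρ : 1 ≤ ρ := by linarith
  have hρ0 : 0 < ρ := by linarith
  have hpd2 := hN ρ v f b a hρN S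
  set q := ρ ^ (-1 / 2 : ℝ) with hq
  have hq0 : 0 < q := by positivity
  have hpd1 : ∀ x i, |pd1 d v x i| ≤ D * q := fun x i => by
    refine (abs_pd1_le S.contDiff hq0 hN0 x (fun z _ => S.abs_le z) (fun z _ => hpd2 z) i).trans_eq ?_
    have : 2 * (M / ρ) / q = 2 * M * q := by
      have h1 := rpow_neg_half_sq hρ0
      rw [← hq] at h1
      rw [div_eq_iff hq0.ne', mul_assoc, ← sq, h1]
      ring
    rw [this, hD_def]; ring
  refine ⟨fun x i => (hpd1 x i).trans (by gcongr; linarith), fun x i j => (hpd2 x i j).trans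
    (by linarith), fun x y i j => ?_⟩
  have hp0 : 0 < ρ ^ (α / 2) := by positivity
  set t := q / (R + 1) with ht
  have ht0 : 0 < t := by positivity
  have htα : t ^ (-α) = (R + 1) ^ α * ρ ^ (α / 2) := by
    rw [ht, Real.div_rpow hq0.le (by positivity), Real.rpow_neg (by positivity : 0 ≤ R + 1),
      div_inv_eq_mul, hq, ← Real.rpow_mul hρ0.le, mul_comm]
    congr 2; ring
  have hRt : (R + 1) * t = q := by rw [ht]; field_simp
  rcases lt_or_ge t ‖y - x‖ with hs | hs
  · have h1 : 1 ≤ t ^ (-α) * ‖y - x‖ ^ α := by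
      rw [Real.rpow_neg ht0.le, ← div_eq_inv_mul, ← Real.div_rpow (norm_nonneg _) ht0.le]
      exact Real.one_le_rpow ((one_le_div ht0).2 hs.le) hα.le
    calc |pd2 d v y i j - pd2 d v x i j| ≤ 2 * N := by
          have h2 := hpd2 x i j
          have h3 := hpd2 y i j
          exact (abs_sub _ _).trans (by linarith)
      _ ≤ 2 * N * (t ^ (-α) * ‖y - x‖ ^ α) := le_mul_of_one_le_right (by positivity) h1
      _ = 2 * N * (R + 1) ^ α * ρ ^ (α / 2) * ‖y - x‖ ^ α := by rw [htα]; ring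
      _ ≤ _ := by gcongr; linarith
  · rcases (norm_nonneg (y - x)).eq_or_lt with h0 | h0
    · have : y = x := by rwa [eq_comm, norm_sub_eq_zero_iff] at h0
      rw [this, sub_self, abs_zero]
      positivity
    have hp1 : 1 ≤ ρ ^ (α / 2) := Real.one_le_rpow hρ (by positivity)
    have hH : ∀ x z, ‖z - x‖ ≤ q → |secondOrder (fun k l => halfSymm (a x) k l) v z
        - secondOrder (fun k l => halfSymm (a x) k l) v x|
          ≤ h₀ * ρ ^ (α / 2) * ‖z - x‖ ^ α := fun x z hz => by
      refine (S.abs_secondOrder_sub_le hα hα1 hM hρ le_rfl hN0 hz (fun z _ => hpd1 z)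
        (fun z _ => hpd2 z)).trans ?_
      have e1 : ρ ^ ((1 + α) / 2) * (D * q) = D * ρ ^ (α / 2) := by
        rw [mul_left_comm, hq, ← Real.rpow_add hρ0]
        congr 2; ring
      rw [e1]
      gcongr
      calc M + d * (1 + M) * (D * ρ ^ (α / 2)) + 2 * d ^ 2 * M * N
          ≤ M * ρ ^ (α / 2) + d * (1 + M) * (D * ρ ^ (α / 2))
            + 2 * d ^ 2 * M * N * ρ ^ (α / 2) := by
            have u1 : M ≤ M * ρ ^ (α / 2) := le_mul_of_one_le_right hM0 hp1
            have u2 : 2 * d ^ 2 * M * N ≤ 2 * d ^ 2 * M * N * ρ ^ (α / 2) :=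
              le_mul_of_one_le_right (by positivity) hp1
            linarith
        _ = _ := by rw [hh₀]; ring
    have hsq : ‖y - x‖ ≤ q := by nlinarith
    have hfin := hC v _ _ _ _ y x t (h₀ * ρ ^ (α / 2)) N δ _ _ S.contDiff
      ((S.elliptic x).kernelMatrix hM) ((S.elliptic y).kernelMatrix hM)
      ((S.elliptic x).halfSymm_mul_inv (by linarith))
      ((S.elliptic y).halfSymm_mul_inv (by linarith)) h0 hs (by positivity) hN0 (by positivity)
      (fun i j => by
        have := (S.elliptic x).abs_kernelOf_sub_le (S.elliptic y) (by linarith)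
          (δ := M * ‖y - x‖ ^ α) (fun i j => by
            rw [abs_sub_comm]; exact S.holder_matrix x y hsq i j) i j
        exact this.trans_eq (by rw [hδ]; ring))
      (fun z hz => hH x z (hz.trans hRt.le))
      (fun z hz => hH y z (hz.trans (by rw [← hRt]; gcongr; linarith)))
      (fun z _ => hpd2 z) i j
    refine hfin.trans ?_
    rw [htα]
    refine mul_le_mul_of_nonneg_right ?_ (by positivity)
    have u1 : δ * N ≤ δ * N * ρ ^ (α / 2) := le_mul_of_one_le_right (by positivity) hp1
    calc C * (h₀ * ρ ^ (α / 2) + δ * N + (R + 1) ^ α * ρ ^ (α / 2) * N)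
        ≤ C * (h₀ * ρ ^ (α / 2) + δ * N * ρ ^ (α / 2) + (R + 1) ^ α * ρ ^ (α / 2) * N) := by
          refine mul_le_mul_of_nonneg_left ?_ (by linarith)
          linarith
      _ = T * ρ ^ (α / 2) := by rw [hT]; ring
      _ ≤ _ := by gcongr; linarith

section
variable {d : ℕ}

lemma fderiv_fderiv_nonpos_of_isLocalMax {w : Euc d → ℝ} (hw : ContDiff ℝ 2 w) {x : Euc d}
    (h : IsLocalMax w x) (ξ : Euc d) : fderiv ℝ (fderiv ℝ w) x ξ ξ ≤ 0 := by
  by_contra! hpos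
  have hd := hw.differentiable (by simp)
  have hd2 : Differentiable ℝ (fderiv ℝ w) :=
    (hw.fderiv_right (m := 1) (by norm_num)).differentiable (by simp)
  have hline : ∀ t : ℝ, HasDerivAt (fun t : ℝ => x + t • ξ) ξ t := fun t => by
    simpa using ((hasDerivAt_id t).smul_const ξ).const_add x
  have h1 : ∀ t : ℝ, HasDerivAt (fun t : ℝ => w (x + t • ξ)) (fderiv ℝ w (x + t • ξ) ξ) t :=
    fun t => (hd _).hasFDerivAt.comp_hasDerivAt t (hline t)
  have h2 : HasDerivAt (fun t : ℝ => fderiv ℝ w (x + t • ξ) ξ) (fderiv ℝ (fderiv ℝ w) x ξ ξ) 0 := by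
    have h3 := (hd2 (x + (0 : ℝ) • ξ)).hasFDerivAt.comp_hasDerivAt 0 (hline 0)
    simp only [zero_smul, add_zero] at h3
    simpa using h3.clm_apply (hasDerivAt_const (0 : ℝ) ξ)
  have e1 : deriv (fun t : ℝ => w (x + t • ξ)) = fun t => fderiv ℝ w (x + t • ξ) ξ :=
    funext fun t => (h1 t).deriv
  have hmax : IsLocalMax (fun t : ℝ => w (x + t • ξ)) 0 := by
    have : Filter.Tendsto (fun t : ℝ => x + t • ξ) (nhds 0) (nhds x) := by
      simpa using (hline 0).continuousAt.tendsto
    simpa [IsLocalMax, IsMaxFilter] using this.eventually h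
  have hmin : IsLocalMin (fun t : ℝ => w (x + t • ξ)) 0 :=
    isLocalMin_of_deriv_deriv_pos (by rw [e1, h2.deriv]; exact hpos) hmax.deriv_eq_zero
      (h1 0).continuousAt
  have hconst : (fun t : ℝ => w (x + t • ξ)) =ᶠ[nhds 0] fun _ => w x := by
    filter_upwards [hmax, hmin] with t ht ht'
    simp only [zero_smul, add_zero] at ht ht'
    exact le_antisymm ht ht'
  have h4 := hconst.deriv.deriv_eq
  rw [e1, h2.deriv] at h4
  simp at h4
  linarith

lemma fderiv_fderiv_self_eq_sum {v : Euc d → ℝ} (hv : ContDiff ℝ 2 v) (x ξ : Euc d) :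
    fderiv ℝ (fderiv ℝ v) x ξ ξ = ∑ i, ∑ j, ξ i * pd2 d v x i j * ξ j := by
  rw [clm_apply_eq_sum (fderiv ℝ (fderiv ℝ v) x) ξ, sum_apply]
  refine Finset.sum_congr rfl fun i _ => ?_
  rw [smul_apply, clm_apply_eq_sum _ ξ, Finset.smul_sum]
  refine Finset.sum_congr rfl fun j _ => ?_
  rw [pd2_eq hv, smul_eq_mul, smul_eq_mul]
  ring

lemma IsElliptic.posSemidef {c : ℝ} {a : Fin d → Fin d → ℝ} (ha : IsElliptic c a) (hc : 0 < c) :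
    (halfSymm a).PosSemidef := by
  refine Matrix.PosSemidef.of_dotProduct_mulVec_nonneg ?_ fun ξ => ?_
  · rw [Matrix.IsHermitian, Matrix.conjTranspose_eq_transpose_of_trivial, halfSymm_transpose]
  · have h := ha.dotProduct_ge ξ
    have h0 : 0 ≤ dotProduct ξ ξ := Finset.sum_nonneg fun i _ => mul_self_nonneg (ξ i)
    rw [star_trivial]
    exact le_trans (by positivity) h

lemma sum_mul_le_of_posSemidef {A : Matrix (Fin d) (Fin d) ℝ} (hA : A.PosSemidef)
    {H : Fin d → Fin d → ℝ} {K : ℝ}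
    (hH : ∀ ξ : Fin d → ℝ, ∑ i, ∑ j, ξ i * H i j * ξ j ≤ K * ∑ i, ξ i ^ 2) :
    ∑ i, ∑ j, A i j * H i j ≤ K * ∑ i, A i i := by
  obtain ⟨m, q, rfl⟩ := Matrix.posSemidef_iff_eq_sum_vecMulVec.1 hA
  have e : ∀ i j, (∑ k, Matrix.vecMulVec (q k) (star (q k))) i j = ∑ k, q k i * q k j := fun i j => by
    simp [Matrix.sum_apply, Matrix.vecMulVec_apply]
  simp only [e]
  calc ∑ i, ∑ j, (∑ k, q k i * q k j) * H i j = ∑ k, ∑ i, ∑ j, q k i * H i j * q k j := by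
        simp only [Finset.sum_mul]
        rw [Finset.sum_comm (s := Finset.univ (α := Fin m))]
        refine Finset.sum_congr rfl fun i _ => ?_
        rw [Finset.sum_comm]
        exact Finset.sum_congr rfl fun k _ => Finset.sum_congr rfl fun j _ => by ring
    _ ≤ ∑ k, K * ∑ i, q k i ^ 2 := Finset.sum_le_sum fun k _ => hH fun i => q k i
    _ = K * ∑ i, ∑ k, q k i * q k i := by
        rw [← Finset.mul_sum, Finset.sum_comm]
        simp only [sq]

lemma abs_le_of_sub_sq_bound {v : Euc d → ℝ} (hv : ContDiff ℝ 2 v) {K η : ℝ} (hη : 0 < η)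
    (hK : ∀ x, |v x| ≤ K) (y : Euc d) : ∃ x, v y ≤ v x + η ^ 2 * ‖y‖ ^ 2 ∧
      (∀ i, |pd1 d v x i| ≤ 2 * η * (1 + 2 * K)) ∧
      ∀ ξ : Fin d → ℝ, ∑ i, ∑ j, ξ i * pd2 d v x i j * ξ j ≤ 2 * η ^ 2 * ∑ i, ξ i ^ 2 := by
  set w : Euc d → ℝ := fun x => v x - η ^ 2 * ‖x‖ ^ 2 with hw
  have hwc : ContDiff ℝ 2 w := hv.sub (contDiff_const.mul (contDiff_norm_sq ℝ))
  have hK0 : 0 ≤ K := (abs_nonneg _).trans (hK 0)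
  obtain ⟨x, hx⟩ := hwc.continuous.exists_forall_ge' 0 (by
    filter_upwards [(tendsto_norm_cocompact_atTop (E := Euc d)).eventually_ge_atTop
      ((1 + 2 * K) / η)] with x hx
    rw [div_le_iff₀ hη] at hx
    have h1 := abs_le.1 (hK x)
    have h2 := abs_le.1 (hK 0)
    simp only [hw, norm_zero]
    nlinarith)
  have hx0 := hx 0
  have hxy := hx y
  simp only [hw, norm_zero] at hx0 hxy
  have hηx : η * ‖x‖ ≤ 1 + 2 * K := by
    have h1 := abs_le.1 (hK x)
    have h2 := abs_le.1 (hK 0)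
    have h3 : 0 ≤ η * ‖x‖ := by positivity
    nlinarith
  have hmax : IsLocalMax w x := Filter.Eventually.of_forall hx
  have hd := hv.differentiable (by simp)
  have hd2 : Differentiable ℝ (fderiv ℝ v) :=
    (hv.fderiv_right (m := 1) (by norm_num)).differentiable (by simp)
  have hn : ∀ z : Euc d, HasFDerivAt (fun z : Euc d => η ^ 2 * ‖z‖ ^ 2)
      (η ^ 2 • (2 • innerSL ℝ z)) z := fun z =>
    (hasStrictFDerivAt_norm_sq z).hasFDerivAt.const_mul (η ^ 2)
  have hfd : fderiv ℝ w = fun z => fderiv ℝ v z - η ^ 2 • (2 • innerSL ℝ z) :=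
    funext fun z => ((hd z).hasFDerivAt.sub (hn z)).fderiv
  refine ⟨x, by nlinarith, fun i => ?_, fun ξ => ?_⟩
  · have h1 := congrArg (fun L => L (stdVec i)) hmax.fderiv_eq_zero
    rw [hfd] at h1
    have h2 : pd1 d v x i = 2 * η ^ 2 * x i := by
      simp only [pd1]
      simp [stdVec, EuclideanSpace.inner_single_right] at h1
      linarith
    rw [h2, abs_mul, abs_of_nonneg (by positivity)]
    have h3 := abs_coord_le_norm x i
    calc 2 * η ^ 2 * |x i| ≤ 2 * η ^ 2 * ‖x‖ := by gcongr
      _ = 2 * η * (η * ‖x‖) := by ring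
      _ ≤ _ := by gcongr
  · have h1 := fderiv_fderiv_nonpos_of_isLocalMax hwc hmax (WithLp.toLp 2 ξ)
    have h2 : fderiv ℝ (fderiv ℝ w) x = fderiv ℝ (fderiv ℝ v) x - η ^ 2 • (2 • innerSL ℝ) := by
      rw [hfd]
      exact ((hd2 x).hasFDerivAt.sub
        ((((innerSL ℝ (E := Euc d)).hasFDerivAt).const_smul (2 : ℕ)).const_smul (η ^ 2))).fderiv
    rw [h2] at h1
    have h3 := fderiv_fderiv_self_eq_sum hv x (WithLp.toLp 2 ξ)
    simp only at h3
    rw [← h3]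
    have h4 : ‖WithLp.toLp 2 ξ‖ ^ 2 = ∑ i, ξ i ^ 2 := by
      rw [EuclideanSpace.norm_sq_eq]; simp
    simp only [sub_apply, smul_apply, smul_eq_mul, nsmul_eq_mul, Nat.cast_ofNat] at h1
    replace h1 : fderiv ℝ (fderiv ℝ v) x (WithLp.toLp 2 ξ) (WithLp.toLp 2 ξ)
        - η ^ 2 * (2 * ‖WithLp.toLp 2 ξ‖ ^ 2) ≤ 0 := by
      rw [← real_inner_self_eq_norm_sq]
      exact h1
    rw [← h4]
    linarith

/-- One-sided maximum principle for bounded solutions on the whole space. -/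
lemma mul_le_of_bounded_solution {v f : Euc d → ℝ} {b : Euc d → Fin d → ℝ}
    {a : Euc d → Fin d → Fin d → ℝ} {K M F ρ : ℝ} (hv : ContDiff ℝ 2 v) (hK : ∀ x, |v x| ≤ K)
    (hM : 0 < M) (hρ : 0 < ρ)
    (hf : ∀ x, f x ≤ F) (hb : ∀ x i, |b x i| ≤ M) (ha : ∀ x, IsElliptic M (a x))
    (heq : ∀ x, ρ * v x - f x - ∑ i, b x i * pd1 d v x i
      - (1 / 2) * ∑ i, ∑ j, a x i j * pd2 d v x j i = 0) (y : Euc d) : ρ * v y ≤ F := by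
  have hK0 : 0 ≤ K := (abs_nonneg _).trans (hK 0)
  have key : ∀ η : ℝ, 0 < η → ρ * v y ≤ F + d * (M * (2 * η * (1 + 2 * K)))
      + 2 * η ^ 2 * (d * (M / 2)) + ρ * (η ^ 2 * ‖y‖ ^ 2) := fun η hη => by
    obtain ⟨x, hxy, h1, h2⟩ := abs_le_of_sub_sq_bound hv hη hK y
    have h3 : ∑ i, b x i * pd1 d v x i ≤ d * (M * (2 * η * (1 + 2 * K))) :=
      (le_abs_self _).trans (abs_sum_le_mul fun i => by
        rw [abs_mul]
        exact mul_le_mul (hb x i) (h1 i) (abs_nonneg _) hM.le)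
    have h4 : (1 / 2) * ∑ i, ∑ j, a x i j * pd2 d v x j i ≤ 2 * η ^ 2 * (d * (M / 2)) := by
      rw [← secondOrder_halfSymm hv]
      have h5 := sum_mul_le_of_posSemidef ((ha x).posSemidef hM) h2
      have h6 : ∑ i, halfSymm (a x) i i ≤ d * (M / 2) :=
        (le_abs_self _).trans (abs_sum_le_mul fun i => (ha x).abs_halfSymm_le i i)
      have h7 : secondOrder (fun k l => halfSymm (a x) k l) v x
          = ∑ i, ∑ j, halfSymm (a x) i j * pd2 d v x i j := by
        simp only [secondOrder, pd2_comm hv]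
      rw [h7]
      exact h5.trans (by gcongr)
    have h8 := heq x
    have h9 := hf x
    have h10 : ρ * v y ≤ ρ * (v x + η ^ 2 * ‖y‖ ^ 2) := by gcongr
    linarith
  have hlim : Filter.Tendsto (fun η : ℝ => F + d * (M * (2 * η * (1 + 2 * K)))
      + 2 * η ^ 2 * (d * (M / 2)) + ρ * (η ^ 2 * ‖y‖ ^ 2)) (nhdsWithin 0 (Set.Ioi 0))
      (nhds F) := by
    have : Continuous (fun η : ℝ => F + d * (M * (2 * η * (1 + 2 * K)))
      + 2 * η ^ 2 * (d * (M / 2)) + ρ * (η ^ 2 * ‖y‖ ^ 2)) := by fun_prop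
    have h := (this.tendsto 0).mono_left (nhdsWithin_le_nhds (s := Set.Ioi 0))
    simpa using h
  exact ge_of_tendsto hlim (by filter_upwards [self_mem_nhdsWithin] with η hη using key η hη)

/-- Maximum principle for bounded solutions on the whole space. -/
lemma abs_le_of_bounded_solution {v f : Euc d → ℝ} {b : Euc d → Fin d → ℝ}
    {a : Euc d → Fin d → Fin d → ℝ} {K M F ρ : ℝ} (hv : ContDiff ℝ 2 v) (hK : ∀ x, |v x| ≤ K)
    (hM : 0 < M) (hρ : 0 < ρ)
    (hf : ∀ x, |f x| ≤ F) (hb : ∀ x i, |b x i| ≤ M) (ha : ∀ x, IsElliptic M (a x))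
    (heq : ∀ x, ρ * v x - f x - ∑ i, b x i * pd1 d v x i
      - (1 / 2) * ∑ i, ∑ j, a x i j * pd2 d v x j i = 0) (y : Euc d) : |v y| ≤ F / ρ := by
  have e1 : ∀ x i, pd1 d (fun x => -v x) x i = -pd1 d v x i := fun x i => by
    simp [pd1]
  have e2 : ∀ x i j, pd2 d (fun x => -v x) x i j = -pd2 d v x i j := fun x i j => by
    simp [pd2]
  have h1 := mul_le_of_bounded_solution hv hK hM hρ (fun x => (abs_le.1 (hf x)).2) hb ha heq y
  have h2 := mul_le_of_bounded_solution (v := fun x => -v x) (f := fun x => -f x) hv.neg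
    (fun x => by rw [abs_neg]; exact hK x) hM hρ
    (fun x => show -f x ≤ F by linarith [(abs_le.1 (hf x)).1]) hb ha (fun x => by
      simp only [e1, e2, mul_neg, Finset.sum_neg_distrib]
      linarith [heq x]) y
  rw [le_div_iff₀ hρ, mul_comm, ← abs_of_pos hρ, ← abs_mul, abs_le]
  exact ⟨by linarith, h1⟩

end

/-- The probability density proportional to `exp e`. -/
def normalizedExp {Ω : Type*} [MeasurableSpace Ω] (μ : Measure Ω) (e : Ω → ℝ) (u : Ω) : ℝ :=
  Real.exp (e u) / ∫ u', Real.exp (e u') ∂μ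

section
variable {Ω : Type*} [MeasurableSpace Ω] {μ : Measure Ω}
  {e e' g g' : Ω → ℝ} {K δ G γ : ℝ}

lemma normalizedExp_add_const (e : Ω → ℝ) (c : ℝ) :
    normalizedExp μ (fun u => e u + c) = normalizedExp μ e := by
  funext u
  simp only [normalizedExp, Real.exp_add, integral_mul_const]
  exact mul_div_mul_right _ _ (Real.exp_pos c).ne'

lemma measurable_normalizedExp (he : Measurable e) : Measurable (normalizedExp μ e) :=
  he.exp.div_const _

variable [IsProbabilityMeasure μ]

lemma integrable_of_abs_le (hg : Measurable g) (h : ∀ᵐ u ∂μ, |g u| ≤ G) : Integrable g μ :=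
  Integrable.of_bound hg.aestronglyMeasurable G h

lemma integrable_exp (he : Measurable e) (h : ∀ᵐ u ∂μ, |e u| ≤ K) :
    Integrable (fun u => Real.exp (e u)) μ :=
  integrable_of_abs_le (G := Real.exp K) he.exp (h.mono fun u hu => by
    rw [abs_of_pos (Real.exp_pos _)]
    exact Real.exp_le_exp.2 (le_of_abs_le hu))

lemma le_integral_exp (he : Measurable e) (h : ∀ᵐ u ∂μ, |e u| ≤ K) :
    Real.exp (-K) ≤ ∫ u, Real.exp (e u) ∂μ := by
  have := integral_mono_ae (integrable_const (Real.exp (-K))) (integrable_exp he h)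
    (h.mono fun u hu => Real.exp_le_exp.2 (neg_le_of_abs_le hu))
  simpa using this

lemma integral_exp_le (he : Measurable e) (h : ∀ᵐ u ∂μ, |e u| ≤ K) :
    ∫ u, Real.exp (e u) ∂μ ≤ Real.exp K := by
  have := integral_mono_ae (integrable_exp he h) (integrable_const (Real.exp K))
    (h.mono fun u hu => Real.exp_le_exp.2 (le_of_abs_le hu))
  simpa using this

lemma integral_exp_pos (he : Measurable e) (h : ∀ᵐ u ∂μ, |e u| ≤ K) :
    0 < ∫ u, Real.exp (e u) ∂μ := (Real.exp_pos _).trans_le (le_integral_exp he h)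

lemma normalizedExp_pos (he : Measurable e) (h : ∀ᵐ u ∂μ, |e u| ≤ K) (u : Ω) :
    0 < normalizedExp μ e u := div_pos (Real.exp_pos _) (integral_exp_pos he h)

lemma integral_normalizedExp (he : Measurable e) (h : ∀ᵐ u ∂μ, |e u| ≤ K) :
    ∫ u, normalizedExp μ e u ∂μ = 1 := by
  simp only [normalizedExp, integral_div]
  exact div_self (integral_exp_pos he h).ne'

lemma log_normalizedExp (he : Measurable e) (h : ∀ᵐ u ∂μ, |e u| ≤ K) (u : Ω) :
    Real.log (normalizedExp μ e u) = e u - Real.log (∫ u, Real.exp (e u) ∂μ) := by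
  rw [normalizedExp, Real.log_div (Real.exp_pos _).ne' (integral_exp_pos he h).ne', Real.log_exp]

lemma abs_log_normalizedExp_le (he : Measurable e) (h : ∀ᵐ u ∂μ, |e u| ≤ K) :
    ∀ᵐ u ∂μ, |Real.log (normalizedExp μ e u)| ≤ 2 * K := by
  have h1 := Real.log_le_log (Real.exp_pos _) (le_integral_exp he h)
  have h2 := Real.log_le_log (integral_exp_pos he h) (integral_exp_le he h)
  rw [Real.log_exp] at h1 h2
  filter_upwards [h] with u hu
  have h3 := abs_le.1 hu
  rw [log_normalizedExp he h, abs_le]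
  constructor <;> linarith

lemma normalizedExp_le (he : Measurable e) (h : ∀ᵐ u ∂μ, |e u| ≤ K) :
    ∀ᵐ u ∂μ, normalizedExp μ e u ≤ Real.exp (2 * K) := by
  filter_upwards [abs_log_normalizedExp_le he h] with u hu
  rw [← Real.log_le_iff_le_exp (normalizedExp_pos he h u)]
  exact le_of_abs_le hu

lemma log_integral_exp_le (he : Measurable e) (h : ∀ᵐ u ∂μ, |e u| ≤ K) (he' : Measurable e')
    (h' : ∀ᵐ u ∂μ, |e' u| ≤ K) (hδ : ∀ᵐ u ∂μ, |e' u - e u| ≤ δ) :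
    Real.log (∫ u, Real.exp (e' u) ∂μ) ≤ δ + Real.log (∫ u, Real.exp (e u) ∂μ) := by
  have h1 : ∫ u, Real.exp (e' u) ∂μ ≤ Real.exp δ * ∫ u, Real.exp (e u) ∂μ := by
    rw [← integral_const_mul]
    refine integral_mono_ae (integrable_exp he' h') ((integrable_exp he h).const_mul _)
      (hδ.mono fun u hu => ?_)
    simp only
    rw [← Real.exp_add]
    exact Real.exp_le_exp.2 (by linarith [le_of_abs_le hu])
  have h2 := Real.log_le_log (integral_exp_pos he' h') h1
  rwa [Real.log_mul (Real.exp_pos _).ne' (integral_exp_pos he h).ne', Real.log_exp] at h2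

lemma abs_log_normalizedExp_sub_le (he : Measurable e) (h : ∀ᵐ u ∂μ, |e u| ≤ K)
    (he' : Measurable e') (h' : ∀ᵐ u ∂μ, |e' u| ≤ K) (hδ : ∀ᵐ u ∂μ, |e' u - e u| ≤ δ) :
    ∀ᵐ u ∂μ, |Real.log (normalizedExp μ e' u) - Real.log (normalizedExp μ e u)| ≤ 2 * δ := by
  have h1 := log_integral_exp_le he h he' h' hδ
  have h2 := log_integral_exp_le he' h' he h (hδ.mono fun u hu => by rwa [abs_sub_comm])
  filter_upwards [hδ] with u hu
  have h3 := abs_le.1 hu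
  rw [log_normalizedExp he h, log_normalizedExp he' h', abs_le]
  constructor <;> linarith

lemma abs_exp_sub_exp_le {s t k : ℝ} (hs : s ≤ k) (ht : t ≤ k) :
    |Real.exp s - Real.exp t| ≤ Real.exp k * |s - t| := by
  wlog hst : t ≤ s generalizing s t
  · rw [abs_sub_comm, abs_sub_comm s]
    exact this ht hs (le_of_not_ge hst)
  rw [abs_of_nonneg (sub_nonneg.2 (Real.exp_le_exp.2 hst)), abs_of_nonneg (sub_nonneg.2 hst)]
  have h1 := Real.add_one_le_exp (t - s)
  have h2 : Real.exp t = Real.exp s * Real.exp (t - s) := by rw [← Real.exp_add]; congr 1; ring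
  have h3 := Real.exp_le_exp.2 hs
  have h4 : 0 ≤ s - t := sub_nonneg.2 hst
  calc Real.exp s - Real.exp t = Real.exp s * (1 - Real.exp (t - s)) := by rw [h2]; ring
    _ ≤ Real.exp s * (s - t) := mul_le_mul_of_nonneg_left (by linarith) (Real.exp_pos s).le
    _ ≤ _ := by gcongr

lemma abs_normalizedExp_sub_le (he : Measurable e) (h : ∀ᵐ u ∂μ, |e u| ≤ K)
    (he' : Measurable e') (h' : ∀ᵐ u ∂μ, |e' u| ≤ K) (hδ : ∀ᵐ u ∂μ, |e' u - e u| ≤ δ) :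
    ∀ᵐ u ∂μ, |normalizedExp μ e' u - normalizedExp μ e u| ≤ Real.exp (2 * K) * (2 * δ) := by
  filter_upwards [abs_log_normalizedExp_sub_le he h he' h' hδ, abs_log_normalizedExp_le he h,
    abs_log_normalizedExp_le he' h'] with u h1 h2 h3
  have h4 := abs_exp_sub_exp_le (le_of_abs_le h3) (le_of_abs_le h2)
  rw [Real.exp_log (normalizedExp_pos he h u), Real.exp_log (normalizedExp_pos he' h' u)] at h4
  exact h4.trans (by gcongr)

lemma integrable_mul_normalizedExp (he : Measurable e) (h : ∀ᵐ u ∂μ, |e u| ≤ K)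
    (hg : Measurable g) (hG : ∀ᵐ u ∂μ, |g u| ≤ G) :
    Integrable (fun u => g u * normalizedExp μ e u) μ := by
  refine integrable_of_abs_le (G := G * Real.exp (2 * K)) (hg.mul (measurable_normalizedExp he)) ?_
  filter_upwards [hG, normalizedExp_le he h] with u h1 h2
  have h3 := normalizedExp_pos he h u
  rw [abs_mul, abs_of_pos h3]
  exact mul_le_mul h1 h2 h3.le ((abs_nonneg _).trans h1)

lemma abs_integral_mul_normalizedExp_le (he : Measurable e) (h : ∀ᵐ u ∂μ, |e u| ≤ K)
    (hg : Measurable g) (hG : ∀ᵐ u ∂μ, |g u| ≤ G) :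
    |∫ u, g u * normalizedExp μ e u ∂μ| ≤ G := by
  have hi : Integrable (normalizedExp μ e) μ := (integrable_exp he h).div_const _
  calc |∫ u, g u * normalizedExp μ e u ∂μ| ≤ ∫ u, |g u * normalizedExp μ e u| ∂μ :=
        abs_integral_le_integral_abs
    _ ≤ ∫ u, G * normalizedExp μ e u ∂μ := by
        refine integral_mono_ae (integrable_mul_normalizedExp he h hg hG).abs (hi.const_mul _) ?_
        filter_upwards [hG] with u h1
        have h3 := normalizedExp_pos he h u
        rw [abs_mul, abs_of_pos h3]
        gcongr
    _ = G := by rw [integral_const_mul, integral_normalizedExp he h, mul_one]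

lemma abs_integral_mul_normalizedExp_sub_le (he : Measurable e) (h : ∀ᵐ u ∂μ, |e u| ≤ K)
    (he' : Measurable e') (h' : ∀ᵐ u ∂μ, |e' u| ≤ K) (hδ : ∀ᵐ u ∂μ, |e' u - e u| ≤ δ)
    (hg : Measurable g) (hG : ∀ᵐ u ∂μ, |g u| ≤ G) (hg' : Measurable g')
    (hG' : ∀ᵐ u ∂μ, |g' u| ≤ G) (hγ : ∀ᵐ u ∂μ, |g' u - g u| ≤ γ) :
    |(∫ u, g' u * normalizedExp μ e' u ∂μ) - ∫ u, g u * normalizedExp μ e u ∂μ|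
      ≤ γ + G * (Real.exp (2 * K) * (2 * δ)) := by
  have h1 := integrable_mul_normalizedExp he h hg hG
  have h1' := integrable_mul_normalizedExp he' h' hg' hG'
  have h2 := integrable_mul_normalizedExp he h hg' hG'
  have e1 : (∫ u, g' u * normalizedExp μ e' u ∂μ) - ∫ u, g u * normalizedExp μ e u ∂μ
      = (∫ u, (g' u - g u) * normalizedExp μ e u ∂μ)
        + ∫ u, g' u * (normalizedExp μ e' u - normalizedExp μ e u) ∂μ := by
    simp only [sub_mul, mul_sub]
    rw [integral_sub h2 h1, integral_sub h1' h2]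
    ring
  rw [e1]
  refine (abs_add_le _ _).trans (add_le_add
    (abs_integral_mul_normalizedExp_le he h (hg'.sub hg) hγ) ?_)
  have h5 : ∀ᵐ u ∂μ, ‖g' u * (normalizedExp μ e' u - normalizedExp μ e u)‖
      ≤ G * (Real.exp (2 * K) * (2 * δ)) := by
    filter_upwards [hG', abs_normalizedExp_sub_le he h he' h' hδ] with u h3 h4
    rw [Real.norm_eq_abs, abs_mul]
    exact mul_le_mul h3 h4 (abs_nonneg _) ((abs_nonneg _).trans h3)
  simpa using norm_integral_le_of_norm_le_const h5

end

/-- The hypotheses on the coefficients of the control problem. -/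
structure ControlData {d l : ℕ} (α C₀ ε₀ ε₁ : ℝ) (U : Set (Euc l)) (r : Euc d → Euc l → ℝ)
    (b : Euc d → Euc l → Fin d → ℝ) (S : Euc d → Euc l → Matrix (Fin d) (Fin d) ℝ)
    (S0 : Euc d → Matrix (Fin d) (Fin d) ℝ) : Prop where
  measurableSet : MeasurableSet U
  volume_eq : volume U = 1
  measurable_reward : ∀ x, Measurable fun u => r x u
  measurable_drift : ∀ x i, Measurable fun u => b x u i
  measurable_diffusion : ∀ x i j, Measurable fun u => S x u i j
  elliptic : ∀ u ∈ U, ∀ x (ξ : Fin d → ℝ),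
    (1 / C₀) * ∑ i, ξ i ^ 2 ≤ ∑ i, ∑ j, ξ i * S x u i j * ξ j
  abs_reward : ∀ u ∈ U, ∀ x, |r x u| ≤ C₀
  holder_reward : ∀ u ∈ U, ∀ x y, ‖y - x‖ ≤ 1 → |r y u - r x u| ≤ C₀ * ‖y - x‖ ^ α
  abs_drift : ∀ u ∈ U, ∀ x i, |b x u i| ≤ C₀
  holder_drift : ∀ u ∈ U, ∀ x y, ‖y - x‖ ≤ 1 → ∀ i, |b y u i - b x u i| ≤ C₀ * ‖y - x‖ ^ α
  abs_diffusion : ∀ u ∈ U, ∀ x i j, |S x u i j| ≤ C₀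
  holder_diffusion : ∀ u ∈ U, ∀ x y, ‖y - x‖ ≤ 1 →
    ∀ i j, |S y u i j - S x u i j| ≤ C₀ * ‖y - x‖ ^ α
  abs_oscillation : ∀ u ∈ U, ∀ x i j, |S x u i j - S0 x i j| ≤ ε₀
  holder_oscillation : ∀ u ∈ U, ∀ x y, ‖y - x‖ ≤ 1 → ∀ i j,
    |(S y u i j - S0 y i j) - (S x u i j - S0 x i j)| ≤ ε₁ * ‖y - x‖ ^ α

/-- Bounds on the derivatives of an iterate that are propagated by the policy iteration. -/
structure IterateBound {d : ℕ} (α A B ρ : ℝ) (w : Euc d → ℝ) : Prop where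
  contDiff : ContDiff ℝ 2 w
  abs_pd1 : ∀ x i, |pd1 d w x i| ≤ B
  abs_pd2 : ∀ x i j, |pd2 d w x i j| ≤ A
  holder_pd2 : ∀ x y, ‖y - x‖ ≤ 1 →
    ∀ i j, |pd2 d w y i j - pd2 d w x i j| ≤ A * ρ ^ (α / 2) * ‖y - x‖ ^ α

/-- The part of the Gibbs exponent that depends on the control. -/
def reducedExponent {d l : ℕ} (lam : ℝ) (r : Euc d → Euc l → ℝ) (b : Euc d → Euc l → Fin d → ℝ)
    (S : Euc d → Euc l → Matrix (Fin d) (Fin d) ℝ) (S0 : Euc d → Matrix (Fin d) (Fin d) ℝ)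
    (w : Euc d → ℝ) (x : Euc d) (u : Euc l) : ℝ :=
  gibbsExponent d l lam r b (fun x u => S x u - S0 x) x (fun i => pd1 d w x i) (hessian d w x) u

/-- A bound for the reduced exponent and for its Hölder constant. -/
def exponentBound (d : ℕ) (lam C₀ B : ℝ) : ℝ := (1 / lam) * (C₀ + d * (C₀ * B + C₀ * d) + d ^ 2)

section
variable {d l : ℕ} {lam α C₀ ε₀ ε₁ A B ρ : ℝ} {U : Set (Euc l)} {r : Euc d → Euc l → ℝ}
  {b : Euc d → Euc l → Fin d → ℝ} {S : Euc d → Euc l → Matrix (Fin d) (Fin d) ℝ}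
  {S0 : Euc d → Matrix (Fin d) (Fin d) ℝ} {w : Euc d → ℝ}

lemma gibbsPolicy_eq_normalizedExp (x : Euc d) : gibbsPolicy d l lam U r b S w x
    = normalizedExp (volume.restrict U) (reducedExponent lam r b S S0 w x) := by
  rw [← normalizedExp_add_const _ ((1 / lam) * ((1 / 2) * ∑ i, ∑ j, S0 x i j * hessian d w x j i))]
  have h : (fun u => reducedExponent lam r b S S0 w x u
      + (1 / lam) * ((1 / 2) * ∑ i, ∑ j, S0 x i j * hessian d w x j i))
      = gibbsExponent d l lam r b S x (fun i => pd1 d w x i) (hessian d w x) := by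
    funext u
    simp only [reducedExponent, gibbsExponent, Matrix.sub_apply, sub_mul, Finset.sum_sub_distrib]
    ring
  rw [h]
  rfl

lemma ControlData.measurable_reducedExponent (D : ControlData α C₀ ε₀ ε₁ U r b S S0) (x : Euc d) :
    Measurable (reducedExponent lam r b S S0 w x) := by
  have h1 := D.measurable_reward x
  have h2 := D.measurable_drift x
  have h3 := D.measurable_diffusion x
  unfold reducedExponent gibbsExponent
  refine ((h1.add (Finset.measurable_fun_sum _ fun i _ => (h2 i).mul_const _)).add
    ((Finset.measurable_fun_sum _ fun i _ => Finset.measurable_fun_sum _ fun j _ =>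
      ?_).const_mul _)).const_mul _
  exact ((h3 i j).sub_const _).mul_const _

lemma exponentBound_nonneg (hlam : 0 < lam) (hC₀ : 1 ≤ C₀) (hB : 1 ≤ B) :
    0 ≤ exponentBound d lam C₀ B := by
  unfold exponentBound; positivity

lemma ControlData.abs_reducedExponent_le (D : ControlData α C₀ ε₀ ε₁ U r b S S0)
    (W : IterateBound α A B ρ w) (hlam : 0 < lam) (hC₀ : 1 ≤ C₀) (hε₀ : 0 ≤ ε₀)
    (hA : ε₀ * A ≤ 1) (x : Euc d) {u : Euc l} (hu : u ∈ U) :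
    |reducedExponent lam r b S S0 w x u| ≤ exponentBound d lam C₀ B := by
  have h1 := D.abs_reward u hu x
  have h2 : |∑ i, b x u i * pd1 d w x i| ≤ d * (C₀ * B) := abs_sum_le_mul fun i => by
    rw [abs_mul]
    exact mul_le_mul (D.abs_drift u hu x i) (W.abs_pd1 x i) (abs_nonneg _) (by linarith)
  have h3 : |∑ i, ∑ j, (S x u - S0 x) i j * hessian d w x j i| ≤ d ^ 2 * 1 :=
    abs_sum_sum_le_mul fun i j => by
      rw [abs_mul, Matrix.sub_apply]
      exact (mul_le_mul (D.abs_oscillation u hu x i j) (W.abs_pd2 x j i) (abs_nonneg _) hε₀).trans hA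
  unfold reducedExponent gibbsExponent exponentBound
  rw [abs_mul, abs_of_pos (by positivity)]
  refine mul_le_mul_of_nonneg_left ?_ (by positivity)
  have h4 : 0 ≤ (d : ℝ) * (C₀ * d) := by positivity
  have h5 : 0 ≤ (d : ℝ) ^ 2 := by positivity
  rw [abs_le] at h1 h2 h3 ⊢
  constructor <;> nlinarith

lemma ControlData.abs_reducedExponent_sub_le (D : ControlData α C₀ ε₀ ε₁ U r b S S0)
    (W : IterateBound α A B ρ w) (hα : 0 < α) (hα1 : α < 1) (hlam : 0 < lam) (hC₀ : 1 ≤ C₀)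
    (hε₀ : 0 ≤ ε₀) (hε₁ : 0 ≤ ε₁) (hA0 : 0 ≤ A) (hρ : 1 ≤ ρ)
    (hA : ε₀ * A * ρ ^ (α / 2) ≤ 1) (hA1 : ε₁ * A ≤ 1) (hAρ : A ≤ ρ ^ ((1 - α) / 2))
    {x y : Euc d} (hxy : ‖y - x‖ ≤ ρ ^ (-1 / 2 : ℝ)) {u : Euc l} (hu : u ∈ U) :
    |reducedExponent lam r b S S0 w y u - reducedExponent lam r b S S0 w x u|
      ≤ exponentBound d lam C₀ B * ‖y - x‖ ^ α := by
  have hρ0 : 0 < ρ := by linarith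
  have hs1 : ‖y - x‖ ≤ 1 :=
    hxy.trans (Real.rpow_le_one_of_one_le_of_nonpos hρ (by norm_num))
  set s := ‖y - x‖ with hs
  have hs0 : 0 ≤ s := norm_nonneg _
  have hsα : 0 ≤ s ^ α := by positivity
  have hAs : A * s ≤ s ^ α := by
    calc A * s ≤ ρ ^ ((1 - α) / 2) * (s ^ (1 - α) * s ^ α) := by
          rw [← Real.rpow_add' hs0 (by simp)]
          simp only [sub_add_cancel, Real.rpow_one]
          gcongr
      _ ≤ ρ ^ ((1 - α) / 2) * ((ρ ^ (-1 / 2 : ℝ)) ^ (1 - α) * s ^ α) := by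
          have : 0 ≤ 1 - α := by linarith
          gcongr
      _ = (ρ ^ ((1 - α) / 2) * ρ ^ (-1 / 2 * (1 - α) : ℝ)) * s ^ α := by
          rw [← Real.rpow_mul hρ0.le]; ring
      _ = s ^ α := by
          rw [← Real.rpow_add hρ0]
          have : (1 - α) / 2 + -1 / 2 * (1 - α) = 0 := by ring
          rw [this, Real.rpow_zero, one_mul]
  have hp : ∀ i, |pd1 d w y i - pd1 d w x i| ≤ d * s ^ α := fun i => by
    refine (abs_sub_le_of_partial_le ((contDiff_pd1 W.contDiff i).differentiable (by simp)) hA0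
      convex_univ (fun z _ j => W.abs_pd2 z j i) (Set.mem_univ x) (Set.mem_univ y)).trans ?_
    rw [mul_assoc]
    gcongr
  have h1 := D.holder_reward u hu x y hs1
  have h2 : |∑ i, (b y u i * pd1 d w y i - b x u i * pd1 d w x i)|
      ≤ d * ((C₀ * B + C₀ * d) * s ^ α) := abs_sum_le_mul fun i => by
    have e1 : b y u i * pd1 d w y i - b x u i * pd1 d w x i
        = (b y u i - b x u i) * pd1 d w y i + b x u i * (pd1 d w y i - pd1 d w x i) := by ring
    rw [e1]
    refine (abs_add_le _ _).trans ?_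
    rw [abs_mul, abs_mul]
    have := D.holder_drift u hu x y hs1 i
    have := D.abs_drift u hu x i
    have := W.abs_pd1 y i
    have := hp i
    calc |b y u i - b x u i| * |pd1 d w y i| + |b x u i| * |pd1 d w y i - pd1 d w x i|
        ≤ C₀ * s ^ α * B + C₀ * (d * s ^ α) := by gcongr
      _ = _ := by ring
  have h3 : |∑ i, ∑ j, ((S y u - S0 y) i j * hessian d w y j i
      - (S x u - S0 x) i j * hessian d w x j i)| ≤ d ^ 2 * (2 * s ^ α) :=
    abs_sum_sum_le_mul fun i j => by
      have e1 : (S y u - S0 y) i j * hessian d w y j i - (S x u - S0 x) i j * hessian d w x j i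
          = ((S y u i j - S0 y i j) - (S x u i j - S0 x i j)) * pd2 d w y j i
            + (S x u i j - S0 x i j) * (pd2 d w y j i - pd2 d w x j i) := by
        simp only [Matrix.sub_apply, hessian, Matrix.of_apply]; ring
      rw [e1]
      refine (abs_add_le _ _).trans ?_
      rw [abs_mul, abs_mul]
      have := D.holder_oscillation u hu x y hs1 i j
      have := D.abs_oscillation u hu x i j
      have := W.abs_pd2 y j i
      have := W.holder_pd2 x y hs1 j i
      calc |(S y u i j - S0 y i j) - (S x u i j - S0 x i j)| * |pd2 d w y j i|
            + |S x u i j - S0 x i j| * |pd2 d w y j i - pd2 d w x j i|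
          ≤ ε₁ * s ^ α * A + ε₀ * (A * ρ ^ (α / 2) * s ^ α) := by gcongr
        _ = (ε₁ * A) * s ^ α + (ε₀ * A * ρ ^ (α / 2)) * s ^ α := by ring
        _ ≤ 1 * s ^ α + 1 * s ^ α := by gcongr
        _ = _ := by ring
  have e2 : reducedExponent lam r b S S0 w y u - reducedExponent lam r b S S0 w x u
      = (1 / lam) * ((r y u - r x u) + (∑ i, (b y u i * pd1 d w y i - b x u i * pd1 d w x i))
        + (1 / 2) * ∑ i, ∑ j, ((S y u - S0 y) i j * hessian d w y j i
      - (S x u - S0 x) i j * hessian d w x j i)) := by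
    simp only [reducedExponent, gibbsExponent, Finset.sum_sub_distrib]
    ring
  rw [e2, exponentBound, abs_mul, abs_of_pos (by positivity : 0 < 1 / lam), mul_assoc]
  refine mul_le_mul_of_nonneg_left ?_ (by positivity)
  rw [abs_le] at h1 h2 h3 ⊢
  constructor <;> nlinarith

/-- The constant controlling the averaged coefficients. -/
def averageBound (lam C₀ L : ℝ) : ℝ := (C₀ + lam * (2 * L)) * (1 + Real.exp (2 * L) * (2 * L))

/-- Averaging against the Gibbs policy produces coefficients as in `LinearSolution`. -/
lemma ControlData.linearSolution (D : ControlData α C₀ ε₀ ε₁ U r b S S0)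
    (W : IterateBound α A B ρ w) (hα : 0 < α) (hα1 : α < 1) (hlam : 0 < lam) (hC₀ : 1 ≤ C₀)
    (hε₀ : 0 ≤ ε₀) (hε₁ : 0 ≤ ε₁) (hA0 : 0 ≤ A) (hB : 1 ≤ B) (hρ : 1 ≤ ρ)
    (hA : ε₀ * A * ρ ^ (α / 2) ≤ 1) (hA1 : ε₁ * A ≤ 1) (hAρ : A ≤ ρ ^ ((1 - α) / 2))
    {v : Euc d → ℝ} {K : ℝ} (hv : ContDiff ℝ 2 v) (hK : ∀ x, |v x| ≤ K)
    (heq : ∀ x, ρ * v x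
      - (∫ u in U, r x u * gibbsPolicy d l lam U r b S w x u)
      - (∑ i, (∫ u in U, b x u i * gibbsPolicy d l lam U r b S w x u) * pd1 d v x i)
      - (1/2) * (∑ i, ∑ j, (∫ u in U, S x u i j * gibbsPolicy d l lam U r b S w x u) *
            pd2 d v x j i)
      + lam * (∫ u in U, Real.log (gibbsPolicy d l lam U r b S w x u) *
          gibbsPolicy d l lam U r b S w x u) = 0) :
    LinearSolution α (averageBound lam C₀ (exponentBound d lam C₀ B)) ρ v
      (fun x => ∫ u in U, (r x u - lam * Real.log (gibbsPolicy d l lam U r b S w x u))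
        * gibbsPolicy d l lam U r b S w x u)
      (fun x i => ∫ u in U, b x u i * gibbsPolicy d l lam U r b S w x u)
      (fun x i j => ∫ u in U, S x u i j * gibbsPolicy d l lam U r b S w x u) := by
  simp only [gibbsPolicy_eq_normalizedExp (S0 := S0)] at heq ⊢
  set μ : Measure (Euc l) := volume.restrict U with hμ
  have : IsProbabilityMeasure μ := ⟨by rw [hμ, Measure.restrict_apply_univ, D.volume_eq]⟩
  set E := reducedExponent lam r b S S0 w with hE
  set L := exponentBound d lam C₀ B with hL
  have hL0 : 0 ≤ L := exponentBound_nonneg hlam hC₀ hB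
  have hU : ∀ᵐ u ∂μ, u ∈ U := ae_restrict_mem D.measurableSet
  have hρ0 : 0 < ρ := by linarith
  have hε₀A : ε₀ * A ≤ 1 := by
    have : 1 ≤ ρ ^ (α / 2) := Real.one_le_rpow hρ (by positivity)
    exact (le_mul_of_one_le_right (by positivity) this).trans hA
  have hEm : ∀ x, Measurable (E x) := fun x => D.measurable_reducedExponent x
  have hEb : ∀ x, ∀ᵐ u ∂μ, |E x u| ≤ L := fun x =>
    hU.mono fun u hu => D.abs_reducedExponent_le W hlam hC₀ hε₀ hε₀A x hu
  have hEd : ∀ x y, ‖y - x‖ ≤ ρ ^ (-1 / 2 : ℝ) → ∀ᵐ u ∂μ, |E y u - E x u| ≤ L * ‖y - x‖ ^ α :=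
    fun x y hxy => hU.mono fun u hu => D.abs_reducedExponent_sub_le W hα hα1 hlam hC₀ hε₀ hε₁ hA0
      hρ hA hA1 hAρ hxy hu
  set G := C₀ + lam * (2 * L) with hG
  have hCG : C₀ ≤ G := by rw [hG]; linarith [mul_nonneg hlam.le (mul_nonneg zero_le_two hL0)]
  set M := averageBound lam C₀ L with hM
  have hMe : M = G + G * (Real.exp (2 * L) * (2 * L)) := by rw [hM, averageBound]; ring
  have hG0 : 0 ≤ G := by linarith
  have hGM : G ≤ M := by
    rw [hMe]
    have : 0 ≤ G * (Real.exp (2 * L) * (2 * L)) := by positivity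
    linarith
  have hone : ∀ x y : Euc d, ‖y - x‖ ≤ ρ ^ (-1 / 2 : ℝ) → ‖y - x‖ ≤ 1 := fun x y h =>
    h.trans (Real.rpow_le_one_of_one_le_of_nonpos hρ (by norm_num))
  have hholder : ∀ (g : Euc d → Euc l → ℝ), (∀ x, Measurable (g x)) →
      (∀ x, ∀ᵐ u ∂μ, |g x u| ≤ G) → (∀ x y, ‖y - x‖ ≤ ρ ^ (-1 / 2 : ℝ) →
        ∀ᵐ u ∂μ, |g y u - g x u| ≤ G * ‖y - x‖ ^ α) →
      ∀ x y, ‖y - x‖ ≤ ρ ^ (-1 / 2 : ℝ) →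
        |(∫ u, g y u * normalizedExp μ (E y) u ∂μ) - ∫ u, g x u * normalizedExp μ (E x) u ∂μ|
          ≤ M * ‖y - x‖ ^ α := fun g hgm hgb hgd x y hxy => by
    refine (abs_integral_mul_normalizedExp_sub_le (hEm x) (hEb x) (hEm y) (hEb y) (hEd x y hxy)
      (hgm x) (hgb x) (hgm y) (hgb y) (hgd x y hxy)).trans_eq ?_
    rw [hMe]; ring
  have hlm : ∀ x, Measurable fun u => Real.log (normalizedExp μ (E x) u) := fun x =>
    (measurable_normalizedExp (hEm x)).log
  have hfm : ∀ x, Measurable fun u => r x u - lam * Real.log (normalizedExp μ (E x) u) := fun x =>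
    (D.measurable_reward x).sub ((hlm x).const_mul lam)
  have hfb : ∀ x, ∀ᵐ u ∂μ, |r x u - lam * Real.log (normalizedExp μ (E x) u)| ≤ G := fun x => by
    filter_upwards [hU, abs_log_normalizedExp_le (hEm x) (hEb x)] with u h1 h2
    refine (abs_sub _ _).trans (add_le_add (D.abs_reward u h1 x) ?_)
    rw [abs_mul, abs_of_pos hlam]
    gcongr
  have hbb : ∀ x i, ∀ᵐ u ∂μ, |b x u i| ≤ C₀ := fun x i => hU.mono fun u hu => D.abs_drift u hu x i
  have hSb : ∀ x i j, ∀ᵐ u ∂μ, |S x u i j| ≤ C₀ := fun x i j =>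
    hU.mono fun u hu => D.abs_diffusion u hu x i j
  have habsf : ∀ x, |∫ u, (r x u - lam * Real.log (normalizedExp μ (E x) u))
      * normalizedExp μ (E x) u ∂μ| ≤ M := fun x =>
    (abs_integral_mul_normalizedExp_le (hEm x) (hEb x) (hfm x) (hfb x)).trans hGM
  have habsb : ∀ x i, |∫ u, b x u i * normalizedExp μ (E x) u ∂μ| ≤ M := fun x i =>
    (abs_integral_mul_normalizedExp_le (hEm x) (hEb x) (D.measurable_drift x i)
      (hbb x i)).trans (hCG.trans hGM)
  have hell : ∀ x, IsElliptic M (fun i j => ∫ u, S x u i j * normalizedExp μ (E x) u ∂μ) := fun x =>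
    ⟨fun i j => (abs_integral_mul_normalizedExp_le (hEm x) (hEb x) (D.measurable_diffusion x i j)
      (hSb x i j)).trans (hCG.trans hGM), fun ξ => by
      have hi : ∀ i j, Integrable (fun u => S x u i j * normalizedExp μ (E x) u) μ := fun i j =>
        integrable_mul_normalizedExp (hEm x) (hEb x) (D.measurable_diffusion x i j) (hSb x i j)
      have hi' : ∀ i j, Integrable (fun u => ξ i * (S x u i j * normalizedExp μ (E x) u) * ξ j) μ :=
        fun i j => ((hi i j).const_mul _).mul_const _
      have e1 : ∑ i, ∑ j, ξ i * (∫ u, S x u i j * normalizedExp μ (E x) u ∂μ) * ξ j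
          = ∫ u, ∑ i, ∑ j, ξ i * (S x u i j * normalizedExp μ (E x) u) * ξ j ∂μ := by
        rw [integral_finsetSum _ fun i _ => integrable_finsetSum _ fun j _ => hi' i j]
        refine Finset.sum_congr rfl fun i _ => ?_
        rw [integral_finsetSum _ fun j _ => hi' i j]
        refine Finset.sum_congr rfl fun j _ => ?_
        rw [integral_mul_const, integral_const_mul]
      rw [e1]
      have hq : Integrable (fun u => ((1 / C₀) * ∑ i, ξ i ^ 2) * normalizedExp μ (E x) u) μ :=
        ((integrable_exp (hEm x) (hEb x)).div_const _).const_mul _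
      calc (1 / M) * ∑ i, ξ i ^ 2 ≤ (1 / C₀) * ∑ i, ξ i ^ 2 := by
            have := hCG.trans hGM
            gcongr
        _ = ∫ u, ((1 / C₀) * ∑ i, ξ i ^ 2) * normalizedExp μ (E x) u ∂μ := by
            rw [integral_const_mul, integral_normalizedExp (hEm x) (hEb x), mul_one]
        _ ≤ _ := by
            refine integral_mono_ae hq (integrable_finsetSum _ fun i _ =>
              integrable_finsetSum _ fun j _ => hi' i j) (hU.mono fun u hu => ?_)
            have h1 := normalizedExp_pos (hEm x) (hEb x) u
            have h2 := mul_le_mul_of_nonneg_right (D.elliptic u hu x ξ) h1.le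
            refine h2.trans_eq ?_
            simp only [Finset.sum_mul]
            exact Finset.sum_congr rfl fun i _ => Finset.sum_congr rfl fun j _ => by ring⟩
  have heqn : ∀ x, ρ * v x - (∫ u, (r x u - lam * Real.log (normalizedExp μ (E x) u))
      * normalizedExp μ (E x) u ∂μ) - ∑ i, (∫ u, b x u i * normalizedExp μ (E x) u ∂μ) * pd1 d v x i
      - (1 / 2) * ∑ i, ∑ j, (∫ u, S x u i j * normalizedExp μ (E x) u ∂μ) * pd2 d v x j i = 0 :=
    fun x => by
      have h1 := integrable_mul_normalizedExp (hEm x) (hEb x) (D.measurable_reward x)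
        (hU.mono fun u hu => D.abs_reward u hu x)
      have h2 := integrable_mul_normalizedExp (hEm x) (hEb x) (hlm x)
        (abs_log_normalizedExp_le (hEm x) (hEb x))
      have e1 : ∫ u, (r x u - lam * Real.log (normalizedExp μ (E x) u)) * normalizedExp μ (E x) u ∂μ
          = (∫ u, r x u * normalizedExp μ (E x) u ∂μ)
            - lam * ∫ u, Real.log (normalizedExp μ (E x) u) * normalizedExp μ (E x) u ∂μ := by
        rw [← integral_const_mul, ← integral_sub h1 (h2.const_mul _)]
        congr 1; funext u; ring
      rw [e1]
      linarith [heq x]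
  have hM0 : 0 < M := by linarith
  refine ⟨hv, abs_le_of_bounded_solution hv hK hM0 hρ0 habsf habsb hell heqn, hell, habsb,
    hholder _ hfm hfb ?_, fun x y hxy i => ?_, fun x y hxy i j => ?_, heqn⟩
  · intro x y hxy
    filter_upwards [hU, abs_log_normalizedExp_sub_le (hEm x) (hEb x) (hEm y) (hEb y)
      (hEd x y hxy)] with u h1 h2
    have h3 := D.holder_reward u h1 x y (hone x y hxy)
    have e1 : r y u - lam * Real.log (normalizedExp μ (E y) u)
          - (r x u - lam * Real.log (normalizedExp μ (E x) u))
        = (r y u - r x u) - lam * (Real.log (normalizedExp μ (E y) u)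
          - Real.log (normalizedExp μ (E x) u)) := by ring
    rw [e1]
    refine (abs_sub _ _).trans ?_
    rw [abs_mul, abs_of_pos hlam]
    calc |r y u - r x u| + lam * |Real.log (normalizedExp μ (E y) u)
          - Real.log (normalizedExp μ (E x) u)|
        ≤ C₀ * ‖y - x‖ ^ α + lam * (2 * (L * ‖y - x‖ ^ α)) := by gcongr
      _ = _ := by rw [hG]; ring
  · refine hholder (fun x u => b x u i) (fun x => D.measurable_drift x i)
      (fun x => (hbb x i).mono fun u hu => hu.trans hCG) (fun x y hxy => hU.mono fun u hu =>
        (D.holder_drift u hu x y (hone x y hxy) i).trans (by gcongr)) x y hxy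
  · refine hholder (fun x u => S x u i j) (fun x => D.measurable_diffusion x i j)
      (fun x => (hSb x i j).mono fun u hu => hu.trans hCG) (fun x y hxy => hU.mono fun u hu =>
        (D.holder_diffusion u hu x y (hone x y hxy) i j).trans (by gcongr)) x y hxy

end

section
variable {d : ℕ} {v : Euc d → ℝ}

lemma pd2_eq_iteratedFDeriv (hv : ContDiff ℝ 2 v) (x : Euc d) (i j : Fin d) :
    pd2 d v x i j = iteratedFDeriv ℝ 2 v x ![stdVec i, stdVec j] := by
  rw [pd2_eq hv, iteratedFDeriv_two_apply]
  rfl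

lemma abs_apply_stdVec_le (T : ContinuousMultilinearMap ℝ (fun _ : Fin 2 => Euc d) ℝ) (i j : Fin d) :
    |T ![stdVec i, stdVec j]| ≤ ‖T‖ := by
  have := T.le_opNorm ![stdVec i, stdVec j]
  simpa [Fin.prod_univ_two, norm_stdVec] using this

lemma clm_norm_le_of_stdVec_stdVec {L : Euc d →L[ℝ] Euc d →L[ℝ] ℝ} {N : ℝ} (hN : 0 ≤ N)
    (h : ∀ i j, |L (stdVec i) (stdVec j)| ≤ N) : ‖L‖ ≤ d ^ 2 * N := by
  have := clm_norm_le_of_stdVec L (N := d * N) (by positivity)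
    fun i => clm_norm_le_of_stdVec (L (stdVec i)) hN (h i)
  exact this.trans_eq (by ring)

lemma norm_iteratedFDeriv_two_le (hv : ContDiff ℝ 2 v) {N : ℝ} (hN : 0 ≤ N) (x : Euc d)
    (h : ∀ i j, |pd2 d v x i j| ≤ N) : ‖iteratedFDeriv ℝ 2 v x‖ ≤ d ^ 2 * N := by
  have h1 := clm_norm_le_of_stdVec_stdVec (L := fderiv ℝ (fderiv ℝ v) x) hN fun i j => by
    rw [← pd2_eq hv]; exact h i j
  refine ContinuousMultilinearMap.opNorm_le_bound (by positivity) fun m => ?_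
  rw [iteratedFDeriv_two_apply, Fin.prod_univ_two, ← mul_assoc]
  refine ((fderiv ℝ (fderiv ℝ v) x).le_opNorm₂ (m 0) (m 1)).trans ?_
  gcongr

lemma norm_iteratedFDeriv_two_sub_le (hv : ContDiff ℝ 2 v) {N : ℝ} (hN : 0 ≤ N) (x y : Euc d)
    (h : ∀ i j, |pd2 d v x i j - pd2 d v y i j| ≤ N) :
    ‖iteratedFDeriv ℝ 2 v x - iteratedFDeriv ℝ 2 v y‖ ≤ d ^ 2 * N := by
  have h1 := clm_norm_le_of_stdVec_stdVec
    (L := fderiv ℝ (fderiv ℝ v) x - fderiv ℝ (fderiv ℝ v) y) hN fun i j => by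
      rw [sub_apply, sub_apply, ← pd2_eq hv, ← pd2_eq hv]; exact h i j
  refine ContinuousMultilinearMap.opNorm_le_bound (by positivity) fun m => ?_
  rw [sub_apply, iteratedFDeriv_two_apply, iteratedFDeriv_two_apply,
    Fin.prod_univ_two, ← mul_assoc]
  refine ((fderiv ℝ (fderiv ℝ v) x - fderiv ℝ (fderiv ℝ v) y).le_opNorm₂ (m 0) (m 1)).trans ?_
  gcongr

lemma norm_fderiv_le (x : Euc d) {N : ℝ} (hN : 0 ≤ N) (h : ∀ i, |pd1 d v x i| ≤ N) :
    ‖fderiv ℝ v x‖ ≤ d * N :=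
  clm_norm_le_of_stdVec _ hN h

lemma iterateBound_of_norm_le {α A B ρ : ℝ} (hv : ContDiff ℝ 2 v) (hα : 0 < α) (hB : 0 ≤ B)
    (hBA : B ≤ A) (hρ : 1 ≤ ρ)
    (h : ∀ x, |v x| + ‖fderiv ℝ v x‖ + ‖iteratedFDeriv ℝ 2 v x‖ ≤ B)
    (h' : ∀ x y, dist x y ≤ 1 → |v x - v y| + ‖fderiv ℝ v x - fderiv ℝ v y‖
      + ‖iteratedFDeriv ℝ 2 v x - iteratedFDeriv ℝ 2 v y‖ ≤ B * dist x y ^ α) :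
    IterateBound α A B ρ v := by
  refine ⟨hv, fun x i => ?_, fun x i j => ?_, fun x y hxy i j => ?_⟩
  · have h1 := (fderiv ℝ v x).le_opNorm (stdVec i)
    rw [norm_stdVec, mul_one] at h1
    have := h x
    have : |pd1 d v x i| ≤ ‖fderiv ℝ v x‖ := h1
    linarith [abs_nonneg (v x), norm_nonneg (iteratedFDeriv ℝ 2 v x)]
  · rw [pd2_eq_iteratedFDeriv hv]
    refine (abs_apply_stdVec_le _ i j).trans ?_
    linarith [h x, abs_nonneg (v x), norm_nonneg (fderiv ℝ v x)]
  · rw [pd2_eq_iteratedFDeriv hv, pd2_eq_iteratedFDeriv hv, ← sub_apply]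
    refine (abs_apply_stdVec_le _ i j).trans ?_
    have h1 := h' y x (by rwa [dist_eq_norm])
    rw [dist_eq_norm] at h1
    have h2 : 1 ≤ ρ ^ (α / 2) := Real.one_le_rpow hρ (by positivity)
    have h3 : B ≤ A * ρ ^ (α / 2) := hBA.trans (le_mul_of_one_le_right (hB.trans hBA) h2)
    calc ‖iteratedFDeriv ℝ 2 v y - iteratedFDeriv ℝ 2 v x‖ ≤ B * ‖y - x‖ ^ α := by
          linarith [abs_nonneg (v y - v x), norm_nonneg (fderiv ℝ v y - fderiv ℝ v x)]
      _ ≤ _ := by gcongr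

end

lemma le_averageBound {lam C₀ L : ℝ} (hlam : 0 < lam) (hC₀ : 1 ≤ C₀) (hL : 0 ≤ L) :
    1 ≤ averageBound lam C₀ L := by
  have h1 : 0 ≤ lam * (2 * L) := by positivity
  have h2 : 0 ≤ Real.exp (2 * L) * (2 * L) := by positivity
  unfold averageBound
  nlinarith

/-- Theorem 2.4: uniform `C²` and `C^{2,α}` estimates for the policy iteration sequence
with bounded coefficients under (cond1), (cond2), `|U| = 1`, and the smallness/largeness
condition (cond3) on `ρ`, `ε₀`, `ε₁`. The constant `A₁` depends only on `‖v⁰‖_{2,α}` (bounded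
by `B`), `C₀`, `λ` (and `d`, `α`). -/
theorem stmt4 (d l : ℕ) (α lam C₀ B : ℝ)
    (hα0 : 0 < α) (hα1 : α < 1) (hlam : 0 < lam) (hC₀ : 1 ≤ C₀) (hB : 1 ≤ B) :
    ∃ A₁ : ℝ, 1 ≤ A₁ ∧
    ∀ (U : Set (EuclideanSpace ℝ (Fin l)))
      (r : EuclideanSpace ℝ (Fin d) → EuclideanSpace ℝ (Fin l) → ℝ)
      (b : EuclideanSpace ℝ (Fin d) → EuclideanSpace ℝ (Fin l) → Fin d → ℝ)
      (S : EuclideanSpace ℝ (Fin d) → EuclideanSpace ℝ (Fin l) → Matrix (Fin d) (Fin d) ℝ)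
      (S0 : EuclideanSpace ℝ (Fin d) → Matrix (Fin d) (Fin d) ℝ)
      (ε₀ ε₁ ρ : ℝ)
      (v : ℕ → EuclideanSpace ℝ (Fin d) → ℝ),
      MeasurableSet U → Bornology.IsBounded U → volume U = 1 →
      -- measurability in the control variable
      (∀ x, Measurable fun u => r x u) →
      (∀ x i, Measurable fun u => b x u i) →
      (∀ x i j, Measurable fun u => S x u i j) →
      -- (cond1)
      (∀ u ∈ U, ∀ x (ξ : Fin d → ℝ),
        (1 / C₀) * ∑ i, ξ i ^ 2 ≤ ∑ i, ∑ j, ξ i * S x u i j * ξ j) →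
      (∀ u ∈ U, ∀ x, |r x u| ≤ C₀) →
      (∀ u ∈ U, ∀ x y, dist x y ≤ 1 → |r x u - r y u| ≤ C₀ * dist x y ^ α) →
      (∀ u ∈ U, ∀ x i, |b x u i| ≤ C₀) →
      (∀ u ∈ U, ∀ x y, dist x y ≤ 1 → ∀ i, |b x u i - b y u i| ≤ C₀ * dist x y ^ α) →
      (∀ u ∈ U, ∀ x i j, |S x u i j| ≤ C₀) →
      (∀ u ∈ U, ∀ x y, dist x y ≤ 1 → ∀ i j, |S x u i j - S y u i j| ≤ C₀ * dist x y ^ α) →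
      -- (cond2)
      0 < ε₀ → ε₀ < 1 → 0 < ε₁ → ε₁ < 1 →
      (∀ u ∈ U, ∀ x i j, |S x u i j - S0 x i j| ≤ ε₀) →
      (∀ u ∈ U, ∀ x y, dist x y ≤ 1 → ∀ i j,
        |(S x u i j - S0 x i j) - (S y u i j - S0 y i j)| ≤ ε₁ * dist x y ^ α) →
      -- v⁰ ∈ C^{2,α}(ℝ^d) with ‖v⁰‖_{2,α} ≤ B
      ContDiff ℝ 2 (v 0) →
      (∀ x, |v 0 x| + ‖fderiv ℝ (v 0) x‖ + ‖iteratedFDeriv ℝ 2 (v 0) x‖ ≤ B) →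
      (∀ x y, dist x y ≤ 1 →
        |v 0 x - v 0 y| + ‖fderiv ℝ (v 0) x - fderiv ℝ (v 0) y‖ +
          ‖iteratedFDeriv ℝ 2 (v 0) x - iteratedFDeriv ℝ 2 (v 0) y‖ ≤ B * dist x y ^ α) →
      -- the iterates are bounded classical solutions of the linearized equations
      (∀ n : ℕ, 1 ≤ n → ContDiff ℝ 2 (v n) ∧ ∃ M, ∀ x, |v n x| ≤ M) →
      (∀ n : ℕ, 1 ≤ n → ∀ x,
        ρ * v n x
          - (∫ u in U, r x u * gibbsPolicy d l lam U r b S (v (n - 1)) x u)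
          - (∑ i, (∫ u in U, b x u i * gibbsPolicy d l lam U r b S (v (n - 1)) x u) *
              pd1 d (v n) x i)
          - (1/2) * (∑ i, ∑ j,
              (∫ u in U, S x u i j * gibbsPolicy d l lam U r b S (v (n - 1)) x u) *
                pd2 d (v n) x j i)
          + lam * (∫ u in U, Real.log (gibbsPolicy d l lam U r b S (v (n - 1)) x u) *
              gibbsPolicy d l lam U r b S (v (n - 1)) x u) = 0) →
      -- (cond3)
      A₁ ^ (2 / (1 - α)) ≤ ρ → ε₀ * A₁ * ρ ^ (α/2) ≤ 1 → ε₁ * A₁ ≤ 1 →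
      -- conclusions: ‖v^n‖₂ ≤ A₁ and ρ^{-α/2}[v^n]_{2,α} ≤ A₁ for all n ≥ 1
      ∀ n : ℕ, 1 ≤ n →
        (∀ x, |v n x| + ‖fderiv ℝ (v n) x‖ + ‖iteratedFDeriv ℝ 2 (v n) x‖ ≤ A₁) ∧
        (∀ x y, dist x y ≤ 1 →
          ρ ^ (-α/2) * ‖iteratedFDeriv ℝ 2 (v n) x - iteratedFDeriv ℝ 2 (v n) y‖ ≤
            A₁ * dist x y ^ α) := by
  set M := averageBound lam C₀ (exponentBound d lam C₀ B) with hM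
  have hM1 : 1 ≤ M := le_averageBound hlam hC₀ (exponentBound_nonneg hlam hC₀ hB)
  obtain ⟨C, hC1, hC⟩ := exists_schauder d hα0 hα1 hM1
  have hd0 : (0 : ℝ) ≤ d := Nat.cast_nonneg d
  have hdC : 0 ≤ d * C := by positivity
  have hddC : 0 ≤ (d : ℝ) ^ 2 * C := by positivity
  refine ⟨B + M + C + d * C + d ^ 2 * C, by linarith, ?_⟩
  intro U r b S S0 ε₀ ε₁ ρ v hUm _ hU1 hrm hbm hSm hell hr hrh hb hbh hS hSh hε₀ _ hε₁ _ hM0 hMh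
    hv0 hv0b hv0h hv heq hAρ hA0 hA1
  set A := B + M + C + d * C + d ^ 2 * C with hA
  have hA1' : 1 ≤ A := by linarith
  have hCA : C ≤ A := by linarith
  have hexp : 0 < 1 - α := by linarith
  have hA2 : A ^ 2 ≤ ρ := by
    refine le_trans ?_ hAρ
    rw [← Real.rpow_natCast]
    refine Real.rpow_le_rpow_of_exponent_le hA1' ?_
    rw [le_div_iff₀ hexp]
    push_cast
    linarith
  have hρ1 : 1 ≤ ρ := by nlinarith
  have hρ0 : 0 < ρ := by linarith
  have hCρ : C ≤ ρ := by nlinarith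
  have hAρ' : A ≤ ρ ^ ((1 - α) / 2) := by
    have h1 : (A ^ (2 / (1 - α))) ^ ((1 - α) / 2) ≤ ρ ^ ((1 - α) / 2) := by gcongr
    rwa [← Real.rpow_mul (by linarith), div_mul_div_cancel₀ hexp.ne', div_self two_ne_zero,
      Real.rpow_one] at h1
  have hCq : C * ρ ^ (-1 / 2 : ℝ) ≤ 1 := by
    have h1 : C ≤ ρ ^ (1 / 2 : ℝ) := by
      rw [← Real.sqrt_eq_rpow]
      exact Real.le_sqrt_of_sq_le (by nlinarith)
    calc C * ρ ^ (-1 / 2 : ℝ) ≤ ρ ^ (1 / 2 : ℝ) * ρ ^ (-1 / 2 : ℝ) := by gcongr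
      _ = 1 := by rw [← Real.rpow_add hρ0]; norm_num
  have D : ControlData α C₀ ε₀ ε₁ U r b S S0 := by
    refine ⟨hUm, hU1, hrm, hbm, hSm, hell, hr, fun u hu x y hxy => ?_, hb,
      fun u hu x y hxy i => ?_, hS, fun u hu x y hxy i j => ?_, hM0, fun u hu x y hxy i j => ?_⟩ <;>
    rw [← dist_eq_norm] at hxy ⊢
    · exact hrh u hu y x hxy
    · exact hbh u hu y x hxy i
    · exact hSh u hu y x hxy i j
    · exact hMh u hu y x hxy i j
  have hstep : ∀ n, IterateBound α A B ρ (v n) →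
      (∀ x, |v (n + 1) x| ≤ M / ρ) ∧ (∀ x i, |pd1 d (v (n + 1)) x i| ≤ C * ρ ^ (-1 / 2 : ℝ)) ∧
      (∀ x i j, |pd2 d (v (n + 1)) x i j| ≤ C) ∧
      ∀ x y i j, |pd2 d (v (n + 1)) y i j - pd2 d (v (n + 1)) x i j|
        ≤ C * ρ ^ (α / 2) * ‖y - x‖ ^ α := fun n W => by
    obtain ⟨hvc, K, hK⟩ := hv (n + 1) (by omega)
    have h1 := D.linearSolution W hα0 hα1 hlam hC₀ hε₀.le hε₁.le (by linarith) hB hρ1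
      hA0 hA1 hAρ' hvc hK (heq (n + 1) (by omega))
    exact ⟨h1.abs_le, hC ρ _ _ _ _ hCρ h1⟩
  have hW : ∀ n, IterateBound α A B ρ (v n) := fun n => by
    induction n with
    | zero =>
      exact iterateBound_of_norm_le hv0 hα0 (by linarith) (by linarith) hρ1 hv0b hv0h
    | succ n ih =>
      obtain ⟨_, h1, h2, h3⟩ := hstep n ih
      exact ⟨(hv (n + 1) (by omega)).1, fun x i => (h1 x i).trans (hCq.trans hB),
        fun x i j => (h2 x i j).trans hCA, fun x y _ i j => (h3 x y i j).trans (by gcongr)⟩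
  intro n hn
  obtain ⟨n, rfl⟩ : ∃ m, n = m + 1 := ⟨n - 1, by omega⟩
  obtain ⟨h0, h1, h2, h3⟩ := hstep n (hW n)
  have hvc := (hv (n + 1) (by omega)).1
  refine ⟨fun x => ?_, fun x y _ => ?_⟩
  · have e1 : M / ρ ≤ M := div_le_self (by linarith) hρ1
    have e2 := norm_fderiv_le x (zero_le_one.trans hC1) fun i => ((h1 x i).trans hCq).trans hC1
    have e3 := norm_iteratedFDeriv_two_le hvc (zero_le_one.trans hC1) x (h2 x)
    have e4 := h0 x
    linarith
  · have e1 := norm_iteratedFDeriv_two_sub_le hvc (N := C * ρ ^ (α / 2) * dist x y ^ α)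
      (by positivity) x y fun i j => by rw [dist_eq_norm]; exact h3 y x i j
    have e2 : ρ ^ (-α / 2) * ρ ^ (α / 2) = 1 := by
      rw [← Real.rpow_add hρ0, ← add_div]; simp
    calc ρ ^ (-α / 2) * ‖iteratedFDeriv ℝ 2 (v (n + 1)) x - iteratedFDeriv ℝ 2 (v (n + 1)) y‖
        ≤ ρ ^ (-α / 2) * (d ^ 2 * (C * ρ ^ (α / 2) * dist x y ^ α)) := by gcongr
      _ = (ρ ^ (-α / 2) * ρ ^ (α / 2)) * (d ^ 2 * C) * dist x y ^ α := by ring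
      _ ≤ A * dist x y ^ α := by
          rw [e2, one_mul]
          gcongr
          linarith
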